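/- arXiv:1904.08312 — 4 statements merged into one kernel-verified Lean document; each statement's English description precedes it below -/
import Mathlib

section
/- Bôcher–Koebe theorem: if u is continuous on the closure of a bounded domain D ⊂ ℝ^m, continuously differentiable in D, and the flux ∫_{∂B} ∂u/∂n dS vanishes for every ball B with closure in D, then u is harmonic in D. -/
open MeasureTheory Metric Real

noncomputable section

/-- The Laplacian of `u : ℝ^m → ℝ` as the sum of second partial derivatives. -/
def lap {m : ℕ} (u : EuclideanSpace ℝ (Fin m) → ℝ) (x : EuclideanSpace ℝ (Fin m)) : ℝ :=
  ∑ i : Fin m,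
    fderiv ℝ (fun y => fderiv ℝ u y (EuclideanSpace.single i 1)) x (EuclideanSpace.single i 1)

/-- `u` is harmonic on `s`: it is `C²` there and its Laplacian vanishes. -/
def IsHarmonicOn {m : ℕ} (u : EuclideanSpace ℝ (Fin m) → ℝ)
    (s : Set (EuclideanSpace ℝ (Fin m))) : Prop :=
  ContDiffOn ℝ 2 u s ∧ ∀ x ∈ s, lap u x = 0

/-- Average of `u` over the sphere `∂B_r(x)` w.r.t. the `(m-1)`-dimensional
Hausdorff (surface) measure. -/
def sphAvg {m : ℕ} (u : EuclideanSpace ℝ (Fin m) → ℝ) (x : EuclideanSpace ℝ (Fin m))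
    (r : ℝ) : ℝ :=
  ((μH[(m : ℝ) - 1] (sphere x r)).toReal)⁻¹ * ∫ y in sphere x r, u y ∂(μH[(m : ℝ) - 1])

/-- Average of `u` over the open ball `B_r(x)` w.r.t. Lebesgue measure. -/
def ballAvg {m : ℕ} (u : EuclideanSpace ℝ (Fin m) → ℝ) (x : EuclideanSpace ℝ (Fin m))
    (r : ℝ) : ℝ :=
  ((volume (ball x r)).toReal)⁻¹ * ∫ y in ball x r, u y

/-- The volume `ω_m` of the unit ball in `ℝ^m`. -/
def unitBallVol (m : ℕ) : ℝ := (volume (ball (0 : EuclideanSpace ℝ (Fin m)) 1)).toReal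



lemma ud_unique {X : Type*} [MetricSpace X] [CompactSpace X] [MeasurableSpace X] [BorelSpace X]
    (μ ν : Measure X) [IsFiniteMeasure μ] [IsFiniteMeasure ν]
    (hμ : ∀ x y ε, μ (ball x ε) = μ (ball y ε)) (hν : ∀ x y ε, ν (ball x ε) = ν (ball y ε))
    (f : X → ℝ) (hf : Continuous f) :
    ν.real Set.univ * ∫ x, f x ∂μ = μ.real Set.univ * ∫ x, f x ∂ν := by
  have hintg : ∀ (τ : Measure X) [IsFiniteMeasure τ], Integrable f τ := fun τ _ =>
    hf.integrable_of_hasCompactSupport (HasCompactSupport.of_compactSpace f)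
  rcases isEmpty_or_nonempty X with hX | ⟨⟨x0⟩⟩
  · simp [Measure.eq_zero_of_isEmpty]
  by_cases hν0 : ν = 0
  · simp [hν0]
  have key : ∀ δ > 0, |ν.real Set.univ * ∫ x, f x ∂μ - μ.real Set.univ * ∫ x, f x ∂ν| ≤
      δ * (μ.real Set.univ * ν.real Set.univ) := by
    intro δ hδ
    have huc := CompactSpace.uniformContinuous_of_continuous hf
    obtain ⟨ε, hε, hfε⟩ := Metric.uniformContinuous_iff.1 huc δ hδ
    set A : Set (X × X) := {p | dist p.1 p.2 < ε} with hA
    have hAm : MeasurableSet A := (isOpen_lt (by fun_prop) (by fun_prop)).measurableSet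
    set cμ := μ.real (ball x0 ε)
    set cν := ν.real (ball x0 ε)
    have hcν : 0 < cν := by
      have : ν (ball x0 ε) ≠ 0 := by
        intro h0
        obtain ⟨t, -, ht, hc⟩ := finite_cover_balls_of_compact (isCompact_univ (X := X)) hε
        apply hν0
        rw [← Measure.measure_univ_eq_zero]
        refine measure_mono_null hc ?_
        rw [measure_biUnion_null_iff ht.countable]
        intro i _
        rw [hν i x0, h0]
      exact ENNReal.toReal_pos this (measure_ne_top _ _)
    have e1 : ∀ g : X → ℝ, Continuous g → ∫ p in A, g p.1 ∂(μ.prod ν) = cν * ∫ x, g x ∂μ := by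
      intro g hg
      have hgi : Integrable (fun p : X × X => g p.1) (μ.prod ν) :=
        (hg.comp continuous_fst).integrable_of_hasCompactSupport (HasCompactSupport.of_compactSpace _)
      rw [← integral_indicator hAm, integral_prod _ (hgi.indicator hAm), ← integral_const_mul]
      refine integral_congr_ae (Filter.Eventually.of_forall fun x => ?_)
      have : (fun y => A.indicator (fun p : X × X => g p.1) (x, y)) =
          (ball x ε).indicator (fun _ => g x) := by
        ext y
        simp only [Set.indicator, hA, Set.mem_ofPred_eq, mem_ball, dist_comm]
      simp only [this]
      rw [integral_indicator_const _ measurableSet_ball, smul_eq_mul]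
      simp only [cν, Measure.real, hν x x0]
    have e2 : ∀ g : X → ℝ, Continuous g → ∫ p in A, g p.2 ∂(μ.prod ν) = cμ * ∫ x, g x ∂ν := by
      intro g hg
      have hgi : Integrable (fun p : X × X => g p.2) (μ.prod ν) :=
        (hg.comp continuous_snd).integrable_of_hasCompactSupport (HasCompactSupport.of_compactSpace _)
      rw [← integral_indicator hAm, integral_prod_symm _ (hgi.indicator hAm), ← integral_const_mul]
      refine integral_congr_ae (Filter.Eventually.of_forall fun x => ?_)
      have : (fun y => A.indicator (fun p : X × X => g p.2) (y, x)) =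
          (ball x ε).indicator (fun _ => g x) := by
        ext y
        simp only [Set.indicator, hA, Set.mem_ofPred_eq, mem_ball]
      simp only [this]
      rw [integral_indicator_const _ measurableSet_ball, smul_eq_mul]
      simp only [cμ, Measure.real, hμ x x0]
    have h1 : (μ.prod ν).real A = cν * μ.real Set.univ := by
      simpa using e1 (fun _ => 1) continuous_const
    have h2 : (μ.prod ν).real A = cμ * ν.real Set.univ := by
      simpa using e2 (fun _ => 1) continuous_const
    have hb : |cν * ∫ x, f x ∂μ - cμ * ∫ x, f x ∂ν| ≤ δ * (cν * μ.real Set.univ) := by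
      have i1 : Integrable (fun p : X × X => f p.1) (μ.prod ν) :=
        (hf.comp continuous_fst).integrable_of_hasCompactSupport (HasCompactSupport.of_compactSpace _)
      have i2 : Integrable (fun p : X × X => f p.2) (μ.prod ν) :=
        (hf.comp continuous_snd).integrable_of_hasCompactSupport (HasCompactSupport.of_compactSpace _)
      rw [← e1 f hf, ← e2 f hf, ← integral_sub i1.integrableOn i2.integrableOn, ← h1]
      have := norm_setIntegral_le_of_norm_le_const (μ := μ.prod ν) (s := A) (C := δ)
        (f := fun p => f p.1 - f p.2) (measure_lt_top _ _)
        (fun p hp => by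
          have := hfε hp
          rw [Real.dist_eq] at this
          exact this.le)
      simpa using this
    have h3 : cμ * ν.real Set.univ = cν * μ.real Set.univ := by rw [← h1, h2]
    have hN : 0 ≤ ν.real Set.univ := measureReal_nonneg
    refine le_of_mul_le_mul_left ?_ hcν
    calc cν * |ν.real Set.univ * ∫ x, f x ∂μ - μ.real Set.univ * ∫ x, f x ∂ν|
        = |cν * (ν.real Set.univ * ∫ x, f x ∂μ - μ.real Set.univ * ∫ x, f x ∂ν)| := by
          rw [abs_mul, abs_of_pos hcν]
      _ = |ν.real Set.univ * (cν * ∫ x, f x ∂μ - cμ * ∫ x, f x ∂ν)| := by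
          congr 1
          linear_combination (∫ x, f x ∂ν) * h3
      _ = ν.real Set.univ * |cν * ∫ x, f x ∂μ - cμ * ∫ x, f x ∂ν| := by
          rw [abs_mul, abs_of_nonneg hN]
      _ ≤ ν.real Set.univ * (δ * (cν * μ.real Set.univ)) := by gcongr
      _ = _ := by ring
  have hz : |ν.real Set.univ * ∫ x, f x ∂μ - μ.real Set.univ * ∫ x, f x ∂ν| ≤ 0 := by
    refine le_of_forall_pos_le_add fun δ hδ => ?_
    have hM : 0 ≤ μ.real Set.univ * ν.real Set.univ := by positivity
    have := key (δ / (μ.real Set.univ * ν.real Set.univ + 1)) (by positivity)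
    refine this.trans ?_
    rw [zero_add, div_mul_eq_mul_div, div_le_iff₀ (by positivity)]
    nlinarith
  exact sub_eq_zero.1 (abs_eq_zero.1 (le_antisymm hz (abs_nonneg _)))

/-- sphere isometry induced by a linear isometry equiv -/
noncomputable def sphIso {E : Type*} [NormedAddCommGroup E] [NormedSpace ℝ E] (L : E ≃ₗᵢ[ℝ] E) :
    sphere (0 : E) 1 ≃ᵢ sphere (0 : E) 1 where
  toFun x := ⟨L x, by simp⟩
  invFun x := ⟨L.symm x, by simp⟩
  left_inv x := by simp
  right_inv x := by simp
  isometry_toFun := fun x y => L.isometry x.1 y.1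

lemma sphIso_apply {E : Type*} [NormedAddCommGroup E] [NormedSpace ℝ E] (L : E ≃ₗᵢ[ℝ] E)
    (x : sphere (0 : E) 1) : (sphIso L x : E) = L x := rfl

lemma exists_iso {E : Type*} [NormedAddCommGroup E] [InnerProductSpace ℝ E]
    (x y : E) (h : ‖x‖ = ‖y‖) : ∃ L : E ≃ₗᵢ[ℝ] E, L x = y :=
  ⟨_, Submodule.reflection_sub h⟩

lemma hausdorff_ud {E : Type*} [NormedAddCommGroup E] [InnerProductSpace ℝ E] [MeasurableSpace E]
    [BorelSpace E] (d : ℝ) (x y : sphere (0 : E) 1) (ε : ℝ) :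
    (μH[d] : Measure (sphere (0 : E) 1)) (ball x ε) = μH[d] (ball y ε) := by
  obtain ⟨L, hL⟩ := exists_iso x.1 y.1 (by simp)
  have : sphIso L x = y := Subtype.ext hL
  rw [← this, ← IsometryEquiv.image_ball, IsometryEquiv.hausdorffMeasure_image]

lemma toSphere_ud {E : Type*} [NormedAddCommGroup E] [InnerProductSpace ℝ E] [MeasurableSpace E]
    [BorelSpace E] [FiniteDimensional ℝ E] (x y : sphere (0 : E) 1) (ε : ℝ) :
    (volume : Measure E).toSphere (ball x ε) = (volume : Measure E).toSphere (ball y ε) := by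
  obtain ⟨L, hL⟩ := exists_iso x.1 y.1 (by simp)
  have : sphIso L x = y := Subtype.ext hL
  rw [Measure.toSphere_apply' _ measurableSet_ball, Measure.toSphere_apply' _ measurableSet_ball]
  congr 1
  rw [← this, ← IsometryEquiv.image_ball, eq_comm]
  rw [← (L.measurePreserving.measure_preimage_emb L.toHomeomorph.measurableEmbedding)]
  congr 1
  ext z
  simp only [Set.mem_smul, Set.mem_preimage, Set.mem_image]
  constructor
  · rintro ⟨r, hr, _, ⟨_, ⟨w, hw, rfl⟩, rfl⟩, h⟩
    refine ⟨r, hr, _, ⟨w, hw, rfl⟩, L.injective ?_⟩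
    rw [← h, sphIso_apply]; simp
  · rintro ⟨r, hr, _, ⟨w, hw, rfl⟩, rfl⟩
    exact ⟨r, hr, _, ⟨_, ⟨w, hw, rfl⟩, rfl⟩, by simp [sphIso_apply]⟩


lemma hs_pos (n : ℕ) :
    μH[(n : ℝ)] (sphere (0 : EuclideanSpace ℝ (Fin (n + 1))) 1) ≠ 0 := by
  intro h0
  set p : EuclideanSpace ℝ (Fin (n + 1)) → (Fin n → ℝ) := fun x i => x i.succ with hp
  have hlip : LipschitzWith 1 p := by
    refine LipschitzWith.of_dist_le_mul fun x y => ?_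
    rw [NNReal.coe_one, one_mul, dist_pi_le_iff dist_nonneg]
    intro i
    rw [Real.dist_eq, dist_eq_norm]
    simpa using PiLp.norm_apply_le (x - y) i.succ
  have h1 := hlip.hausdorffMeasure_image_le (d := n) (by positivity)
    (sphere (0 : EuclideanSpace ℝ (Fin (n + 1))) 1)
  rw [h0, mul_zero] at h1
  have h2 : {y : Fin n → ℝ | ∑ i, y i ^ 2 < 1} ⊆
      p '' (sphere (0 : EuclideanSpace ℝ (Fin (n + 1))) 1) := by
    intro y hy
    have hy : ∑ i, y i ^ 2 < 1 := hy
    refine ⟨WithLp.toLp 2 (Fin.cons (√(1 - ∑ i, y i ^ 2)) y), ?_, ?_⟩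
    · rw [mem_sphere_zero_iff_norm, EuclideanSpace.norm_eq, Fin.sum_univ_succ]
      simp only [Fin.cons_zero, Fin.cons_succ, Real.norm_eq_abs, sq_abs]
      rw [Real.sq_sqrt (by linarith)]; simp
    · ext i; simp [hp]
  have h3 : μH[(n : ℝ)] {y : Fin n → ℝ | ∑ i, y i ^ 2 < 1} = 0 :=
    le_antisymm ((measure_mono h2).trans h1) (zero_le)
  have h4 := hausdorffMeasure_pi_real (ι := Fin n)
  rw [Fintype.card_fin] at h4
  rw [h4] at h3
  have ho : IsOpen {y : Fin n → ℝ | ∑ i, y i ^ 2 < 1} := isOpen_lt (by fun_prop) (by fun_prop)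
  exact ho.measure_ne_zero volume ⟨0, by simp⟩ h3

lemma hs_fin (n : ℕ) :
    μH[(n : ℝ)] (sphere (0 : EuclideanSpace ℝ (Fin (n + 1))) 1) < ⊤ := by
  set q : Fin (n + 1) → ℝ → (Fin n → ℝ) → EuclideanSpace ℝ (Fin (n + 1)) :=
    fun i s y => WithLp.toLp 2 (i.insertNth (α := fun _ => ℝ) s y) with hq
  set g : Fin (n + 1) → ℝ → (Fin n → ℝ) → EuclideanSpace ℝ (Fin (n + 1)) :=
    fun i s y => ‖q i s y‖⁻¹ • q i s y with hg
  have hqc : ∀ i s, ContDiff ℝ 1 (q i s) := by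
    intro i s
    rw [contDiff_euclidean]
    intro j
    rcases Fin.eq_self_or_eq_succAbove i j with rfl | ⟨k, rfl⟩
    · simpa [hq] using contDiff_const
    · simpa [hq] using contDiff_apply ℝ ℝ k
  have hq0 : ∀ i s, s ≠ 0 → ∀ y, q i s y ≠ 0 := by
    intro i s hs y h
    apply hs
    have := congrArg (fun z : EuclideanSpace ℝ (Fin (n + 1)) => z i) h
    simpa [hq] using this
  have hgc : ∀ i s, s ≠ 0 → ContDiff ℝ 1 (g i s) := by
    intro i s hs
    exact (((hqc i s).norm ℝ (hq0 i s hs)).inv (fun y => by simpa using hq0 i s hs y)).smul (hqc i s)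
  have hfin : ∀ i s, s ≠ 0 → μH[(n : ℝ)] (g i s '' closedBall 0 1) < ⊤ := by
    intro i s hs
    obtain ⟨K, hK⟩ := ((hgc i s hs).locallyLipschitz.locallyLipschitzOn
      (s := closedBall 0 1)).exists_lipschitzOnWith_of_compact (isCompact_closedBall 0 1)
    refine (hK.hausdorffMeasure_image_le (d := n) (by positivity)).trans_lt ?_
    have h4 := hausdorffMeasure_pi_real (ι := Fin n)
    rw [Fintype.card_fin] at h4
    rw [h4]
    refine ENNReal.mul_lt_top (ENNReal.rpow_lt_top_of_nonneg (by positivity) (by simp))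
      measure_closedBall_lt_top
  have hsub : sphere (0 : EuclideanSpace ℝ (Fin (n + 1))) 1 ⊆
      ⋃ i : Fin (n + 1), (g i 1 '' closedBall 0 1) ∪ (g i (-1) '' closedBall 0 1) := by
    intro w hw
    have hw : ‖w‖ = 1 := by simpa using hw
    obtain ⟨i, -, hi⟩ := Finset.exists_max_image Finset.univ (fun j => |w j|) ⟨0, Finset.mem_univ _⟩
    have hpos : 0 < |w i| := by
      by_contra! h
      have : w = 0 := by
        ext j
        exact abs_nonpos_iff.1 ((hi j (Finset.mem_univ _)).trans h)
      simp [this] at hw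
    set y : Fin n → ℝ := fun k => |w i|⁻¹ * w (i.succAbove k)
    have hy : y ∈ closedBall (0 : Fin n → ℝ) 1 := by
      rw [mem_closedBall, dist_pi_le_iff zero_le_one]
      intro k
      have := hi (i.succAbove k) (Finset.mem_univ _)
      simp only [y, Pi.zero_apply, dist_zero_right, Real.norm_eq_abs, abs_mul, abs_inv, abs_abs]
      rw [inv_mul_le_iff₀ hpos]; linarith
    have hqq : ∀ s, s = |w i|⁻¹ * w i → g i s y = w := by
      intro s hs
      have : q i s y = |w i|⁻¹ • w := by
        ext j
        rcases Fin.eq_self_or_eq_succAbove i j with rfl | ⟨k, rfl⟩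
        · simp [hq, hs]
        · simp [hq, y]
      simp only [hg, this, norm_smul, hw, norm_inv, Real.norm_eq_abs, abs_abs, mul_one, inv_inv]
      rw [smul_smul, mul_inv_cancel₀ hpos.ne', one_smul]
    refine Set.mem_iUnion.2 ⟨i, ?_⟩
    rcases abs_cases (w i) with ⟨h, -⟩ | ⟨h, -⟩
    · left
      refine ⟨y, hy, hqq 1 ?_⟩
      rw [h] at hpos ⊢
      rw [inv_mul_cancel₀ hpos.ne']
    · right
      refine ⟨y, hy, hqq (-1) ?_⟩
      have : w i = - |w i| := by linarith
      nth_rw 2 [this]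
      field_simp
  refine (measure_mono hsub).trans_lt ?_
  refine (measure_iUnion_fintype_le _ _).trans_lt ?_
  refine ENNReal.sum_lt_top.2 fun i _ => ?_
  exact (measure_union_le _ _).trans_lt (ENNReal.add_lt_top.2
    ⟨hfin i 1 (by norm_num), hfin i (-1) (by norm_num)⟩)

lemma hsub_univ {E : Type*} [NormedAddCommGroup E] [MeasurableSpace E] [BorelSpace E] {d : ℝ}
    (hd : 0 ≤ d) :
    (μH[d] : Measure (sphere (0 : E) 1)) Set.univ = μH[d] (sphere (0 : E) 1) := by
  rw [← isometry_subtype_coe.hausdorffMeasure_image (Or.inl hd), Set.image_univ,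
    Subtype.range_coe]

lemma integral_sphere {E : Type*} [NormedAddCommGroup E] [NormedSpace ℝ E] [MeasurableSpace E]
    [BorelSpace E] {d : ℝ} (hd : 0 ≤ d) (F : E → ℝ) (x : E) {r : ℝ} (hr : 0 < r)
    (h : ∫ y in sphere x r, F y ∂μH[d] = 0) :
    ∫ w : sphere (0 : E) 1, F (x + r • (w : E)) ∂μH[d] = 0 := by
  have e1 : Measure.map (Subtype.val) (μH[d] : Measure (sphere (0 : E) 1)) =
      (μH[d]).restrict (sphere (0 : E) 1) := by
    rw [isometry_subtype_coe.map_hausdorffMeasure (Or.inl hd), Subtype.range_coe]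
  have hemb : MeasurableEmbedding (Subtype.val : sphere (0 : E) 1 → E) :=
    MeasurableEmbedding.subtype_coe isClosed_sphere.measurableSet
  rw [← hemb.integral_map (fun y => F (x + r • y)), e1]
  let H : E ≃ₜ E := (Homeomorph.smulOfNeZero r hr.ne').trans (Homeomorph.addLeft x)
  have hH : ∀ y, H y = x + r • y := fun y => rfl
  have hpre : H ⁻¹' (sphere x r) = sphere 0 1 := by
    ext y
    simp [hH, norm_smul, abs_of_pos hr, hr.ne']
  have hmap : Measure.map H μH[d] = (‖r‖₊⁻¹ ^ d) • (μH[d] : Measure E) := by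
    have h0 := map_homothety_hausdorffMeasure hd (0 : E) hr.ne'
    have h1 := (IsometryEquiv.addLeft x).map_hausdorffMeasure d
    rw [show (H : E → E) = (IsometryEquiv.addLeft x) ∘ (AffineMap.homothety (0 : E) r) by
      ext y; simp [hH, AffineMap.homothety_apply]]
    rw [← Measure.map_map (IsometryEquiv.addLeft x).continuous.measurable
      (AffineMap.homothety_continuous _ _).measurable, h0, Measure.map_smul, h1]
  have := H.measurableEmbedding.setIntegral_map (μ := μH[d]) F (sphere x r)
  rw [hpre, hmap] at this
  simp only [hH] at this
  rw [← this, Measure.restrict_smul, integral_smul_nnreal_measure, h, smul_zero]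

lemma moment {n : ℕ} (ν : Measure (sphere (0 : EuclideanSpace ℝ (Fin (n + 1))) 1))
    [IsFiniteMeasure ν] (hν : ν ≠ 0)
    (hinv : ∀ L : EuclideanSpace ℝ (Fin (n + 1)) ≃ₗᵢ[ℝ] EuclideanSpace ℝ (Fin (n + 1)),
      MeasurePreserving (sphIso L) ν ν) :
    ∃ c : ℝ, c ≠ 0 ∧ ∀ (A : EuclideanSpace ℝ (Fin (n + 1)) →L[ℝ] ℝ) (i : Fin (n + 1)),
      ∫ w, (w : EuclideanSpace ℝ (Fin (n + 1))) i * A w ∂ν = c * A (EuclideanSpace.single i 1) := by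
  have hintg : ∀ f : sphere (0 : EuclideanSpace ℝ (Fin (n + 1))) 1 → ℝ, Continuous f → Integrable f ν := fun f hf =>
    hf.integrable_of_hasCompactSupport (HasCompactSupport.of_compactSpace f)
  set Q : EuclideanSpace ℝ (Fin (n + 1)) → ℝ := fun v => ∫ w, (inner ℝ v (w : EuclideanSpace ℝ (Fin (n + 1)))) ^ 2 ∂ν with hQ
  have hQn : ∀ v v' : EuclideanSpace ℝ (Fin (n + 1)), ‖v‖ = ‖v'‖ → Q v = Q v' := by
    intro v v' h
    obtain ⟨L, rfl⟩ := exists_iso v v' h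
    simp only [hQ]
    rw [← (hinv L).integral_comp (sphIso L).toHomeomorph.measurableEmbedding
      (fun w => (inner ℝ (L v) (w : EuclideanSpace ℝ (Fin (n + 1)))) ^ 2)]
    simp [sphIso_apply]
  set e : Fin (n + 1) → EuclideanSpace ℝ (Fin (n + 1)) := fun i => EuclideanSpace.single i 1 with he
  have hei : ∀ i (w : EuclideanSpace ℝ (Fin (n + 1))), inner ℝ (e i) w = w i := by
    intro i w; simp [he, EuclideanSpace.inner_single_left]
  have hoff : ∀ i j, i ≠ j → ∫ w, (w : EuclideanSpace ℝ (Fin (n + 1))) i * (w : EuclideanSpace ℝ (Fin (n + 1))) j ∂ν = 0 := by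
    intro i j hij
    have h1 : ‖e i + e j‖ = ‖e i - e j‖ := by
      have h0 : inner ℝ (e i) (e j) = 0 := by
        rw [hei]; simp [he, hij]
      rw [← sq_eq_sq₀ (norm_nonneg _) (norm_nonneg _), norm_add_sq_real, norm_sub_sq_real, h0]
      ring
    have h2 := hQn _ _ h1
    have h3 : Q (e i + e j) - Q (e i - e j) = 4 * ∫ w, (w : EuclideanSpace ℝ (Fin (n + 1))) i * (w : EuclideanSpace ℝ (Fin (n + 1))) j ∂ν := by
      simp only [hQ]
      rw [← integral_sub (hintg _ (by fun_prop)) (hintg _ (by fun_prop)), ← integral_const_mul]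
      congr 1
      ext w
      rw [inner_add_left, inner_sub_left, hei, hei]; ring
    linarith
  have hdiag : ∀ i, ∫ w, (w : EuclideanSpace ℝ (Fin (n + 1))) i * (w : EuclideanSpace ℝ (Fin (n + 1))) i ∂ν = Q (e 0) := by
    intro i
    rw [← hQn (e i) (e 0) (by simp [he])]
    simp only [hQ, hei, sq]
  refine ⟨Q (e 0), ?_, ?_⟩
  · have hs : ∑ i, ∫ w, (w : EuclideanSpace ℝ (Fin (n + 1))) i * (w : EuclideanSpace ℝ (Fin (n + 1))) i ∂ν = ν.real Set.univ := by
      rw [← integral_finsetSum _ (fun i _ => hintg _ (by fun_prop))]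
      have : ∀ w : sphere (0 : EuclideanSpace ℝ (Fin (n + 1))) 1, ∑ i, (w : EuclideanSpace ℝ (Fin (n + 1))) i * (w : EuclideanSpace ℝ (Fin (n + 1))) i = 1 := by
        intro w
        have h := EuclideanSpace.real_norm_sq_eq (w : EuclideanSpace ℝ (Fin (n + 1)))
        simp only [← sq]
        rw [← h]; simp
      simp [this]
    simp only [hdiag] at hs
    intro h0
    rw [h0] at hs
    simp at hs
    exact hν (by rw [← Measure.measure_univ_eq_zero]; rw [eq_comm, measureReal_eq_zero_iff] at hs; exact hs)
  · intro A i
    have hA : ∀ w : EuclideanSpace ℝ (Fin (n + 1)), A w = ∑ j, w j * A (e j) := by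
      intro w
      have : w = ∑ j, w j • e j := by
        ext k
        simp [he, Finset.sum_apply, Pi.single_apply]
      conv_lhs => rw [this]
      simp
    have hA2 : (fun w : sphere (0 : EuclideanSpace ℝ (Fin (n + 1))) 1 =>
        (w : EuclideanSpace ℝ (Fin (n + 1))) i * A w) =
        fun w : sphere (0 : EuclideanSpace ℝ (Fin (n + 1))) 1 => ∑ j,
        (w : EuclideanSpace ℝ (Fin (n + 1))) i * ((w : EuclideanSpace ℝ (Fin (n + 1))) j * A (e j)) := by
      ext w
      rw [hA w, Finset.mul_sum]
    rw [hA2]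
    rw [integral_finsetSum _ (fun i _ => hintg _ (by fun_prop)), Finset.sum_eq_single i]
    · simp only [← mul_assoc]
      rw [integral_mul_const, hdiag]
    · intro j _ hj
      simp only [← mul_assoc]
      rw [integral_mul_const, hoff i j hj.symm, zero_mul]
    · simp

lemma deriv_sph {E : Type*} [NormedAddCommGroup E] [InnerProductSpace ℝ E] [MeasurableSpace E]
    [BorelSpace E] [FiniteDimensional ℝ E]
    (ν : Measure (sphere (0 : E) 1)) [IsFiniteMeasure ν] {D : Set E} (hD : IsOpen D) (v : E → ℝ)
    (hv : ContDiffOn ℝ 1 v D) (k : sphere (0 : E) 1 → ℝ) (hk : Continuous k) (x : E) (R : ℝ)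
    (hR : closedBall x R ⊆ D) (r : ℝ) (hr : |r| < R) :
    HasDerivAt (fun s : ℝ => ∫ w, k w * v (x + s • (w : E)) ∂ν)
      (∫ w, k w * fderiv ℝ v (x + r • (w : E)) w ∂ν) r := by
  have hintg : ∀ f : sphere (0 : E) 1 → ℝ, Continuous f → Integrable f ν := fun f hf =>
    hf.integrable_of_hasCompactSupport (HasCompactSupport.of_compactSpace f)
  have hmem : ∀ s : ℝ, |s| < R → ∀ w : sphere (0 : E) 1, x + s • (w : E) ∈ closedBall x R := by
    intro s hs w
    simp [norm_smul, hs.le]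
  have hdv : ContinuousOn (fderiv ℝ v) D := hv.continuousOn_fderiv_of_isOpen hD le_rfl
  have hc : ∀ s : ℝ, |s| < R → Continuous fun w : sphere (0 : E) 1 => v (x + s • (w : E)) :=
    fun s hs => hv.continuousOn.comp_continuous (by fun_prop) (fun w => hR (hmem s hs w))
  have hc' : ∀ s : ℝ, |s| < R → Continuous fun w : sphere (0 : E) 1 =>
      fderiv ℝ v (x + s • (w : E)) w :=
    fun s hs => (hdv.comp_continuous (by fun_prop) (fun w => hR (hmem s hs w))).clm_apply
      continuous_subtype_val
  obtain ⟨C, hC⟩ := (isCompact_closedBall x R).exists_bound_of_continuousOn (hdv.mono hR)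
  obtain ⟨K, hK⟩ := (isCompact_univ (X := sphere (0 : E) 1)).exists_bound_of_continuousOn
    hk.continuousOn
  have hs : Set.Ioo (-R) R ∈ nhds r := isOpen_Ioo.mem_nhds (abs_lt.1 hr)
  refine (hasDerivAt_integral_of_dominated_loc_of_deriv_le (bound := fun _ => K * C) hs
    (F' := fun s w => k w * fderiv ℝ v (x + s • (w : E)) w) ?_ ?_ ?_ ?_ ?_ ?_).2
  · filter_upwards [hs] with s hs
    exact (hintg _ (hk.mul (hc s (abs_lt.2 hs)))).aestronglyMeasurable
  · exact hintg _ (hk.mul (hc r hr))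
  · exact (hintg _ (hk.mul (hc' r hr))).aestronglyMeasurable
  · refine Filter.Eventually.of_forall fun w s hs => ?_
    rw [norm_mul]
    have h1 := hK w (Set.mem_univ _)
    have h2 := hC _ (hmem s (abs_lt.2 hs) w)
    have h3 := (fderiv ℝ v (x + s • (w : E))).le_opNorm w
    have h4 : ‖(w : E)‖ = 1 := by simp
    rw [h4, mul_one] at h3
    exact mul_le_mul h1 (h3.trans h2) (norm_nonneg _) ((norm_nonneg _).trans h1)
  · exact integrable_const _
  · refine Filter.Eventually.of_forall fun w s hs => ?_
    have hd : DifferentiableAt ℝ v (x + s • (w : E)) :=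
      (hv.differentiableOn one_ne_zero).differentiableAt (hD.mem_nhds (hR (hmem s (abs_lt.2 hs) w)))
    have hl : HasDerivAt (fun s : ℝ => x + s • (w : E)) (w : E) s := by
      simpa using ((hasDerivAt_id s).smul_const (w : E)).const_add x
    exact (hd.hasFDerivAt.comp_hasDerivAt s hl).const_mul (k w)

lemma sph_mean {E : Type*} [NormedAddCommGroup E] [InnerProductSpace ℝ E] [MeasurableSpace E]
    [BorelSpace E] [FiniteDimensional ℝ E]
    (ν : Measure (sphere (0 : E) 1)) [IsFiniteMeasure ν] {D : Set E} (hD : IsOpen D) (v : E → ℝ)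
    (hv : ContDiffOn ℝ 1 v D) (x : E) (R : ℝ)
    (hR : closedBall x R ⊆ D)
    (hfl : ∀ r, 0 < r → r < R → ∫ w : sphere (0 : E) 1, fderiv ℝ v (x + r • (w : E)) w ∂ν = 0)
    (r : ℝ) (hr0 : 0 < r) (hr : r < R) :
    ∫ w : sphere (0 : E) 1, v (x + r • (w : E)) ∂ν = ν.real Set.univ * v x := by
  have hd : ∀ s, |s| < R → HasDerivAt (fun s : ℝ => ∫ w, v (x + s • (w : E)) ∂ν)
      (∫ w : sphere (0 : E) 1, fderiv ℝ v (x + s • (w : E)) w ∂ν) s := by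
    intro s hs
    simpa using deriv_sph ν hD v hv (fun _ => 1) continuous_const x R hR s hs
  obtain ⟨c, hc, hc2⟩ := exists_hasDerivAt_eq_slope _ _ hr0
    (fun s hs => (hd s (by rw [abs_of_nonneg hs.1]; linarith [hs.2])).continuousAt.continuousWithinAt)
    (fun s hs => hd s (by rw [abs_of_pos hs.1]; linarith [hs.2]))
  rw [hfl c hc.1 (hc.2.trans hr)] at hc2
  rw [eq_comm, div_eq_zero_iff] at hc2
  rcases hc2 with h | h
  · simpa [sub_eq_zero] using h
  · linarith

lemma polar_zero {E : Type*} [NormedAddCommGroup E] [InnerProductSpace ℝ E] [MeasurableSpace E]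
    [BorelSpace E] [FiniteDimensional ℝ E] [Nontrivial E] (H : E → ℝ) (hH : Integrable H)
    (h : ∀ r : ℝ, 0 < r → ∫ w : sphere (0 : E) 1, H (r • (w : E)) ∂(volume : Measure E).toSphere = 0) :
    ∫ y, H y = 0 := by
  have mp := (volume : Measure E).measurePreserving_homeomorphUnitSphereProd
  have hemb := (homeomorphUnitSphereProd E).measurableEmbedding
  set G : sphere (0 : E) 1 × Set.Ioi (0 : ℝ) → ℝ := fun p => H ((p.2 : ℝ) • (p.1 : E)) with hG
  have hcomp : ∀ y : ({0}ᶜ : Set E), G (homeomorphUnitSphereProd E y) = H y := by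
    intro y
    have hy : ‖(y : E)‖ ≠ 0 := norm_ne_zero_iff.2 y.2
    simp [hG, smul_smul, hy]
  have e1 : ∫ y, H y = ∫ p, G p ∂((volume : Measure E).toSphere.prod
      (.volumeIoiPow (Module.finrank ℝ E - 1))) := by
    rw [← mp.integral_comp hemb]
    simp only [hcomp]
    rw [integral_subtype_comap (measurableSet_singleton _).compl H, restrict_compl_singleton]
  have hGi : Integrable G ((volume : Measure E).toSphere.prod
      (.volumeIoiPow (Module.finrank ℝ E - 1))) := by
    rw [← mp.integrable_comp_emb hemb]
    have : (G ∘ (homeomorphUnitSphereProd E)) = H ∘ Subtype.val := funext hcomp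
    rw [this, ← integrableOn_iff_comap_subtypeVal (measurableSet_singleton _).compl]
    exact hH.integrableOn
  rw [e1, integral_prod_symm _ hGi]
  simp only [hG]
  refine integral_eq_zero_of_ae (Filter.Eventually.of_forall fun r => ?_)
  exact h r r.2

lemma smooth_at {n : ℕ} (D : Set (EuclideanSpace ℝ (Fin (n + 1))))
    (hD : IsOpen D) (u U : EuclideanSpace ℝ (Fin (n + 1)) → ℝ)
    (hU : Integrable U) (hUu : ∀ x ∈ D, U x = u x) (hcont : ContinuousOn u D)
    (ν : Measure (sphere (0 : EuclideanSpace ℝ (Fin (n + 1))) 1)) [IsFiniteMeasure ν]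
    (hν : ν ≠ 0) (hud : ∀ x y ε, ν (ball x ε) = ν (ball y ε))
    (hmean : ∀ x R, closedBall x R ⊆ D → ∀ r, 0 < r → r < R →
      ∫ w : sphere (0 : EuclideanSpace ℝ (Fin (n + 1))) 1,
        u (x + r • (w : EuclideanSpace ℝ (Fin (n + 1)))) ∂ν = ν.real Set.univ * u x)
    (x0 : EuclideanSpace ℝ (Fin (n + 1))) (hx0 : x0 ∈ D) : ContDiffAt ℝ 2 u x0 := by
  obtain ⟨δ, hδ, hδD⟩ := Metric.isOpen_iff.1 hD x0 hx0
  set ρ := δ / 4 with hρ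
  have hρ0 : 0 < ρ := by positivity
  set ε := ρ / 2 with hε
  have hε0 : 0 < ε := by positivity
  set ψ : EuclideanSpace ℝ (Fin (n + 1)) → ℝ := fun y => expNegInvGlue (ε ^ 2 - ‖y‖ ^ 2) with hψ
  have hψc : ContDiff ℝ 2 ψ :=
    (expNegInvGlue.contDiff (n := 2)).comp (contDiff_const.sub (contDiff_norm_sq ℝ))
  have hψ0 : ∀ y, ε ≤ ‖y‖ → ψ y = 0 := by
    intro y hy
    exact expNegInvGlue.zero_of_nonpos (by nlinarith)
  have hψs : HasCompactSupport ψ := by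
    refine HasCompactSupport.intro (isCompact_closedBall 0 ε) fun y hy => hψ0 y ?_
    simp at hy; exact hy.le
  have hψi : Integrable ψ := hψc.continuous.integrable_of_hasCompactSupport hψs
  set c := ∫ y, ψ y with hc
  have hcpos : 0 < c := by
    rw [hc, integral_pos_iff_support_of_nonneg (fun y => expNegInvGlue.nonneg _) hψi]
    have ho : IsOpen (Function.support ψ) := hψc.continuous.isOpen_support
    refine ho.measure_pos _ ⟨0, ?_⟩
    have : 0 < ψ 0 := by
      simp only [hψ]; exact expNegInvGlue.pos_of_pos (by simpa using by positivity)
    exact this.ne'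
  have hconv : ContDiff ℝ 2 (convolution ψ U (ContinuousLinearMap.lsmul ℝ ℝ) volume) :=
    hψs.contDiff_convolution_left _ hψc hU.locallyIntegrable
  have hval : ∀ x ∈ ball x0 ρ, u x = c⁻¹ * convolution ψ U (ContinuousLinearMap.lsmul ℝ ℝ) volume x := by
    intro x hx
    have hxD : closedBall x ρ ⊆ D := by
      refine Set.Subset.trans (fun y hy => ?_) hδD
      simp only [mem_ball, mem_closedBall] at *
      have := dist_triangle y x x0
      linarith
    have hconvx : convolution ψ U (ContinuousLinearMap.lsmul ℝ ℝ) volume x = ∫ t, ψ t * U (x + t) := by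
      rw [convolution_def, ← integral_neg_eq_self]
      congr 1
      ext t
      simp [hψ]
    have hi1 : Integrable (fun t => ψ t * U (x + t)) := by
      obtain ⟨C, hC⟩ := hψs.exists_bound_of_continuous hψc.continuous
      exact (hU.comp_add_left x).bdd_mul hψc.continuous.aestronglyMeasurable
        (Filter.Eventually.of_forall hC)
    have hi2 : Integrable (fun t => ψ t * u x) := hψi.mul_const _
    have hz : ∫ t, (ψ t * U (x + t) - ψ t * u x) = 0 := by
      refine polar_zero _ (hi1.sub hi2) fun r hr => ?_
      have hnw : ∀ w : sphere (0 : EuclideanSpace ℝ (Fin (n + 1))) 1,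
          ‖r • (w : EuclideanSpace ℝ (Fin (n + 1)))‖ = r := by
        intro w; simp [norm_smul, abs_of_pos hr]
      rcases le_or_gt ε r with h | h
      · simp [hψ0 _ ((hnw _).symm ▸ h)]
      · have hrρ : r < ρ := by linarith
        have hmem : ∀ w : sphere (0 : EuclideanSpace ℝ (Fin (n + 1))) 1,
            x + r • (w : EuclideanSpace ℝ (Fin (n + 1))) ∈ D := by
          intro w
          apply hxD
          simp [hnw w, hrρ.le]
        have hfc : Continuous (fun w : sphere (0 : EuclideanSpace ℝ (Fin (n + 1))) 1 =>
            u (x + r • (w : EuclideanSpace ℝ (Fin (n + 1)))) - u x) :=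
          (hcont.comp_continuous (by fun_prop) hmem).sub continuous_const
        have hfc' : Continuous (fun w : sphere (0 : EuclideanSpace ℝ (Fin (n + 1))) 1 =>
            u (x + r • (w : EuclideanSpace ℝ (Fin (n + 1))))) :=
          (hcont.comp_continuous (by fun_prop) hmem)
        have h1 := ud_unique (volume : Measure (EuclideanSpace ℝ (Fin (n + 1)))).toSphere ν
          toSphere_ud hud _ hfc
        rw [integral_sub (hfc'.integrable_of_hasCompactSupport (HasCompactSupport.of_compactSpace _))
          (integrable_const _) (μ := ν), hmean x ρ hxD r hr hrρ] at h1
        simp only [integral_const, smul_eq_mul, sub_self, mul_zero, mul_eq_zero] at h1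
        have h2 : ν.real Set.univ ≠ 0 := by
          rw [Ne, measureReal_eq_zero_iff, Measure.measure_univ_eq_zero]; exact hν
        have h3 := h1.resolve_left h2
        have h4 : ∀ w : sphere (0 : EuclideanSpace ℝ (Fin (n + 1))) 1,
            ψ (r • (w : EuclideanSpace ℝ (Fin (n + 1)))) *
              U (x + r • (w : EuclideanSpace ℝ (Fin (n + 1)))) -
            ψ (r • (w : EuclideanSpace ℝ (Fin (n + 1)))) * u x = expNegInvGlue (ε ^ 2 - r ^ 2) *
            (u (x + r • (w : EuclideanSpace ℝ (Fin (n + 1)))) - u x) := by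
          intro w
          simp only [hψ, hnw w, hUu _ (hmem w)]; ring
        simp only [h4]
        rw [integral_const_mul, h3, mul_zero]
    rw [integral_sub hi1 hi2, integral_mul_const, sub_eq_zero] at hz
    rw [hconvx, hz, ← mul_assoc, inv_mul_cancel₀ hcpos.ne', one_mul]
  have := (contDiff_const (c := c⁻¹)).mul hconv
  refine this.contDiffAt.congr_of_eventuallyEq ?_
  filter_upwards [ball_mem_nhds x0 hρ0] with x hx using hval x hx

theorem bocher_koebe {m : ℕ} (hm : 2 ≤ m) (D : Set (EuclideanSpace ℝ (Fin m)))
    (hD : IsOpen D) (hDc : IsConnected D) (hDb : Bornology.IsBounded D)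
    (u : EuclideanSpace ℝ (Fin m) → ℝ) (hcont : ContinuousOn u (closure D))
    (hC1 : ContDiffOn ℝ 1 u D)
    (hflux : ∀ x ∈ D, ∀ r : ℝ, 0 < r → closedBall x r ⊆ D →
      ∫ y in sphere x r, fderiv ℝ u y (r⁻¹ • (y - x)) ∂(μH[(m : ℝ) - 1]) = 0) :
    IsHarmonicOn u D := by
  obtain ⟨n, rfl⟩ : ∃ n, m = n + 1 := ⟨m - 1, by omega⟩
  have hdim : ((n + 1 : ℕ) : ℝ) - 1 = n := by push_cast; ring
  rw [hdim] at hflux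
  have hn : (0 : ℝ) ≤ n := by positivity
  set ν : Measure (sphere (0 : EuclideanSpace ℝ (Fin (n + 1))) 1) := μH[(n : ℝ)] with hνdef
  have hfinν : IsFiniteMeasure ν := ⟨by rw [hνdef, hsub_univ hn]; exact hs_fin n⟩
  have hν0 : ν ≠ 0 := by
    rw [Ne, ← Measure.measure_univ_eq_zero, hνdef, hsub_univ hn]; exact hs_pos n
  have hud : ∀ x y ε, ν (ball x ε) = ν (ball y ε) := fun x y ε => hausdorff_ud _ x y ε
  have hfl : ∀ x R, closedBall x R ⊆ D → ∀ r, 0 < r → r < R →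
      ∫ w : sphere (0 : EuclideanSpace ℝ (Fin (n + 1))) 1,
        fderiv ℝ u (x + r • (w : EuclideanSpace ℝ (Fin (n + 1)))) w ∂ν = 0 := by
    intro x R hR r hr hrR
    have h := hflux x (hR (mem_closedBall_self (hr.trans hrR).le)) r hr
      ((closedBall_subset_closedBall hrR.le).trans hR)
    have h2 := integral_sphere hn _ x hr h
    rw [← h2]
    congr 1
    ext w
    rw [add_sub_cancel_left, smul_smul, inv_mul_cancel₀ hr.ne', one_smul]
  have hU : Integrable (D.indicator u) := by
    rw [integrable_indicator_iff hD.measurableSet]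
    exact (hcont.integrableOn_compact hDb.isCompact_closure).mono_set subset_closure
  have hsm : ∀ x ∈ D, ContDiffAt ℝ 2 u x := fun x hx =>
    smooth_at D hD u (D.indicator u) hU (fun x hx => Set.indicator_of_mem hx u)
      hC1.continuousOn ν hν0 hud
      (fun x R hR r hr hrR => sph_mean ν hD u hC1 x R hR (hfl x R hR) r hr hrR) x hx
  have hC2 : ContDiffOn ℝ 2 u D := fun x hx => (hsm x hx).contDiffWithinAt
  refine ⟨hC2, fun x hx => ?_⟩
  obtain ⟨c, hc0, hc⟩ := moment ν hν0
    (fun L => (sphIso L).measurePreserving_hausdorffMeasure _)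
  obtain ⟨R, hR0, hR⟩ := Metric.nhds_basis_closedBall.mem_iff.1 (hD.mem_nhds hx)
  have hdu : ContDiffOn ℝ 1 (fderiv ℝ u) D := hC2.fderiv_of_isOpen hD (by norm_num)
  set p : Fin (n + 1) → EuclideanSpace ℝ (Fin (n + 1)) → ℝ :=
    fun i y => fderiv ℝ u y (EuclideanSpace.single i 1) with hp
  have hpc : ∀ i, ContDiffOn ℝ 1 (p i) D := fun i => hdu.clm_apply contDiffOn_const
  set g : ℝ → ℝ := fun s => ∑ i, ∫ w : sphere (0 : EuclideanSpace ℝ (Fin (n + 1))) 1,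
    (w : EuclideanSpace ℝ (Fin (n + 1))) i *
      p i (x + s • (w : EuclideanSpace ℝ (Fin (n + 1)))) ∂ν with hg
  have hgd : HasDerivAt g (c * lap u x) 0 := by
    have h1 := fun i => deriv_sph ν hD (p i) (hpc i)
      (fun w => (w : EuclideanSpace ℝ (Fin (n + 1))) i) (by fun_prop) x R hR 0 (by simpa using hR0)
    have h2 := HasDerivAt.fun_sum (u := Finset.univ) (fun i _ => h1 i)
    refine h2.congr_deriv ?_
    symm
    unfold lap
    rw [Finset.mul_sum]
    refine Finset.sum_congr rfl fun i _ => ?_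
    simp only [zero_smul, add_zero]
    rw [hc]
  have hlin : ∀ (A : EuclideanSpace ℝ (Fin (n + 1)) →L[ℝ] ℝ) (w : EuclideanSpace ℝ (Fin (n + 1))),
      A w = ∑ j, w j * A (EuclideanSpace.single j 1) := by
    intro A w
    have : w = ∑ j, w j • EuclideanSpace.single j (1 : ℝ) := by
      ext k
      simp [Pi.single_apply]
    conv_lhs => rw [this]
    simp
  have hgz : ∀ s, 0 < s → s < R → g s = 0 := by
    intro s hs hsR
    rw [← hfl x R hR s hs hsR]
    simp only [hg]
    rw [← integral_finsetSum]
    · congr 1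
      ext w
      rw [hlin]
    · intro i _
      have hm : ∀ w : sphere (0 : EuclideanSpace ℝ (Fin (n + 1))) 1,
          x + s • (w : EuclideanSpace ℝ (Fin (n + 1))) ∈ D := by
        intro w
        apply hR
        simp [norm_smul, abs_of_pos hs, hsR.le]
      have : Continuous fun w : sphere (0 : EuclideanSpace ℝ (Fin (n + 1))) 1 =>
          (w : EuclideanSpace ℝ (Fin (n + 1))) i *
            p i (x + s • (w : EuclideanSpace ℝ (Fin (n + 1)))) :=
        Continuous.mul (by fun_prop) ((hpc i).continuousOn.comp_continuous (by fun_prop) hm)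
      exact this.integrable_of_hasCompactSupport (HasCompactSupport.of_compactSpace _)
  have hev : g =ᶠ[nhdsWithin 0 (Set.Ioi 0)] fun _ => 0 := by
    filter_upwards [Ioo_mem_nhdsGT hR0] with s hs using hgz s hs.1 hs.2
  have hg0 : g 0 = 0 := by
    have t1 : Filter.Tendsto g (nhdsWithin 0 (Set.Ioi 0)) (nhds (g 0)) :=
      hgd.continuousAt.continuousWithinAt
    exact tendsto_nhds_unique (t1.congr' hev) tendsto_const_nhds |>.symm ▸ rfl
  have hw : HasDerivWithinAt (fun _ : ℝ => (0 : ℝ)) (c * lap u x) (Set.Ioi 0) 0 :=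
    hgd.hasDerivWithinAt.congr_of_eventuallyEq hev.symm hg0.symm
  have := (uniqueDiffWithinAt_Ioi (0 : ℝ)).eq_deriv _ hw (hasDerivWithinAt_const _ _ _)
  exact (mul_eq_zero.1 this).resolve_left hc0
end
end

section
/- Blaschke's theorem: if u is continuous on a domain D ⊂ ℝ^m and for every x ∈ D the limit as r → 0⁺ of r^{-2}(L(u,x,r) − u(x)) equals 0, where L(u,x,r) is the average of u over the sphere of radius r centered at x, then u is harmonic in D. -/
open MeasureTheory Metric Real

noncomputable section

open Filter Topology

/-- Euclidean space. -/
abbrev EE (m : ℕ) := EuclideanSpace ℝ (Fin m)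

lemma sphere_param {m : ℕ} (v : EE m) (hv : ‖v‖ = 1) (x : EE m) {r : ℝ} (hr : 0 < r)
    (s : ℝ) (hs : s ^ 2 = 1) (y : EE m) (hy : y ∈ sphere x r) (hst : s * inner ℝ v (y - x) ≤ 0) :
    y ∈ (fun w : ((ℝ ∙ v)ᗮ : Submodule ℝ (EE m)) => x + (‖w‖ ^ 2 + r ^ 2)⁻¹ •
      ((2 * r ^ 2) • (w : EE m) + (s * r * (‖w‖ ^ 2 - r ^ 2)) • v)) '' closedBall 0 r := by
  set d := y - x with hd
  set t : ℝ := inner ℝ v d with ht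
  have hdn : ‖d‖ = r := by simpa [hd, dist_eq_norm] using hy
  have hvv : inner ℝ v v = (1 : ℝ) := by rw [real_inner_self_eq_norm_sq, hv]; norm_num
  have ha : d - t • v ∈ ((ℝ ∙ v)ᗮ : Submodule ℝ (EE m)) := by
    rw [Submodule.mem_orthogonal_singleton_iff_inner_right, inner_sub_right, inner_smul_right, hvv]
    simp [ht]
  have han : ‖d - t • v‖ ^ 2 = r ^ 2 - t ^ 2 := by
    rw [norm_sub_sq_real, norm_smul, hv, inner_smul_right, real_inner_comm, ← ht, hdn]
    simp
    ring
  have hrt : 0 < r - s * t := by linarith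
  have hwn : ‖(r / (r - s * t)) • (⟨d - t • v, ha⟩ : ((ℝ ∙ v)ᗮ : Submodule ℝ (EE m)))‖ ^ 2
      = r ^ 2 * (r + s * t) / (r - s * t) := by
    rw [norm_smul, mul_pow, Submodule.coe_norm, han, Real.norm_eq_abs, sq_abs]
    have : r ^ 2 - t ^ 2 = (r - s * t) * (r + s * t) := by linear_combination (t^2) * hs
    rw [this]; field_simp
  refine ⟨(r / (r - s * t)) • ⟨d - t • v, ha⟩, ?_, ?_⟩
  · rw [mem_closedBall_zero_iff]
    refine (sq_le_sq₀ (norm_nonneg _) hr.le).1 ?_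
    rw [hwn, div_le_iff₀ hrt]
    have : 0 < r ^ 2 := by positivity
    nlinarith
  · have h1 : r ^ 2 * (r + s * t) / (r - s * t) + r ^ 2 = 2 * r ^ 3 / (r - s * t) := by
      field_simp; ring
    have h2 : r ^ 2 * (r + s * t) / (r - s * t) - r ^ 2 = 2 * r ^ 2 * (s * t) / (r - s * t) := by
      field_simp; ring
    simp only [hwn, h1, h2, Submodule.coe_smul]
    rw [smul_add, smul_smul, smul_smul, smul_smul]
    have h3 : (2 * r ^ 3 / (r - s * t))⁻¹ * (2 * r ^ 2) * (r / (r - s * t)) = 1 := by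
      field_simp
    have h4 : (2 * r ^ 3 / (r - s * t))⁻¹ * (s * r * (2 * r ^ 2 * (s * t) / (r - s * t))) = t := by
      field_simp; linear_combination t * hs
    rw [h3, h4]
    simp [hd]

lemma sphere_finite {m : ℕ} (hm : 2 ≤ m) (x : EE m) {r : ℝ} (hr : 0 < r) :
    μH[(m : ℝ) - 1] (sphere x r) < ⊤ := by
  obtain ⟨n, rfl⟩ : ∃ n, m = n + 1 := ⟨m - 1, by omega⟩
  have e1 : ((n + 1 : ℕ) : ℝ) - 1 = n := by push_cast; ring
  rw [e1]
  let v : EE (n + 1) := EuclideanSpace.single 0 1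
  have hv : ‖v‖ = 1 := by simp [v]
  have hv0 : v ≠ 0 := by intro h; simp [h] at hv
  have : Fact (Module.finrank ℝ (EE (n + 1)) = n + 1) := ⟨by simp⟩
  have hfr : Module.finrank ℝ ((ℝ ∙ v)ᗮ : Submodule ℝ (EE (n + 1))) = n :=
    Submodule.finrank_orthogonal_span_singleton hv0
  have key : ∀ s : ℝ, μH[(n : ℝ)] ((fun w : ((ℝ ∙ v)ᗮ : Submodule ℝ (EE (n + 1))) =>
      x + (‖w‖ ^ 2 + r ^ 2)⁻¹ •
      ((2 * r ^ 2) • (w : EE (n + 1)) + (s * r * (‖w‖ ^ 2 - r ^ 2)) • v)) '' closedBall 0 r) < ⊤ := by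
    intro s
    have hc : ContDiff ℝ 1 (fun w : ((ℝ ∙ v)ᗮ : Submodule ℝ (EE (n + 1))) =>
        x + (‖w‖ ^ 2 + r ^ 2)⁻¹ •
        ((2 * r ^ 2) • (w : EE (n + 1)) + (s * r * (‖w‖ ^ 2 - r ^ 2)) • v)) := by
      have hn : ContDiff ℝ 1 (fun w : ((ℝ ∙ v)ᗮ : Submodule ℝ (EE (n + 1))) => ‖w‖ ^ 2) :=
        contDiff_norm_sq ℝ
      have hw : ContDiff ℝ 1 (fun w : ((ℝ ∙ v)ᗮ : Submodule ℝ (EE (n + 1))) => (w : EE (n + 1))) :=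
        ((ℝ ∙ v)ᗮ : Submodule ℝ (EE (n + 1))).subtypeL.contDiff
      have hi := (hn.add (contDiff_const (c := r ^ 2))).inv (fun w => by positivity)
      have h1 : ContDiff ℝ 1 (fun w : ((ℝ ∙ v)ᗮ : Submodule ℝ (EE (n + 1))) =>
          (2 * r ^ 2) • (w : EE (n + 1))) := hw.const_smul _
      have h2 : ContDiff ℝ 1 (fun w : ((ℝ ∙ v)ᗮ : Submodule ℝ (EE (n + 1))) =>
          (s * r * (‖w‖ ^ 2 - r ^ 2)) • v) :=
        (contDiff_const.mul (hn.sub contDiff_const)).smul contDiff_const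
      exact contDiff_const.add (hi.smul (h1.add h2))
    obtain ⟨K, hK⟩ := hc.contDiffOn.exists_lipschitzOnWith (by norm_num)
      (convex_closedBall (0 : ((ℝ ∙ v)ᗮ : Submodule ℝ (EE (n + 1)))) r)
      (isCompact_closedBall _ _)
    refine (hK.hausdorffMeasure_image_le (d := (n : ℝ)) (by positivity)).trans_lt ?_
    have hfin : μH[(n : ℝ)] (closedBall (0 : ((ℝ ∙ v)ᗮ : Submodule ℝ (EE (n + 1)))) r) < ⊤ := by
      have := (isCompact_closedBall (0 : ((ℝ ∙ v)ᗮ : Submodule ℝ (EE (n + 1)))) r).measure_lt_top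
        (μ := μH[Module.finrank ℝ ((ℝ ∙ v)ᗮ : Submodule ℝ (EE (n + 1)))])
      rwa [hfr] at this
    exact ENNReal.mul_lt_top (ENNReal.rpow_lt_top_of_nonneg (by positivity) (by simp)) hfin
  refine (measure_mono (t := _ ∪ _) ?_).trans_lt
    ((measure_union_le _ _).trans_lt (ENNReal.add_lt_top.2 ⟨key 1, key (-1)⟩))
  intro y hy
  rcases le_total (inner ℝ v (y - x)) 0 with h | h
  · left; exact sphere_param v hv x hr 1 (by norm_num) y hy (by linarith)
  · right; exact sphere_param v hv x hr (-1) (by norm_num) y hy (by linarith)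

lemma sphere_pos {m : ℕ} (hm : 2 ≤ m) (x : EE m) {r : ℝ} (hr : 0 < r) :
    0 < μH[(m : ℝ) - 1] (sphere x r) := by
  obtain ⟨n, rfl⟩ : ∃ n, m = n + 1 := ⟨m - 1, by omega⟩
  have e1 : ((n + 1 : ℕ) : ℝ) - 1 = n := by push_cast; ring
  rw [e1]
  let v : EE (n + 1) := EuclideanSpace.single 0 1
  have hv : ‖v‖ = 1 := by simp [v]
  have hv0 : v ≠ 0 := by intro h; simp [h] at hv
  have : Fact (Module.finrank ℝ (EE (n + 1)) = n + 1) := ⟨by simp⟩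
  let V : Submodule ℝ (EE (n + 1)) := (ℝ ∙ v)ᗮ
  have hfr : Module.finrank ℝ V = n :=
    Submodule.finrank_orthogonal_span_singleton hv0
  have hpos : 0 < μH[(n : ℝ)] (ball (V.orthogonalProjectionOnto x) r) := by
    have := isOpen_ball.measure_pos (μ := μH[Module.finrank ℝ V])
      (U := ball (V.orthogonalProjectionOnto x) r) ⟨_, mem_ball_self hr⟩
    rwa [hfr] at this
  refine hpos.trans_le ?_
  have hsub : ball (V.orthogonalProjectionOnto x) r ⊆ V.orthogonalProjectionOnto '' sphere x r := by
    intro w hw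
    rw [mem_ball, dist_eq_norm] at hw
    set a := w - V.orthogonalProjectionOnto x with ha
    have horth : inner ℝ (a : EE (n + 1)) v = 0 :=
      (Submodule.mem_orthogonal_singleton_iff_inner_left).1 a.2
    refine ⟨x + ((a : EE (n + 1)) + Real.sqrt (r ^ 2 - ‖a‖ ^ 2) • v), ?_, ?_⟩
    · rw [mem_sphere, dist_eq_norm, add_sub_cancel_left]
      have h0 : 0 ≤ r ^ 2 - ‖a‖ ^ 2 := by nlinarith [norm_nonneg a]
      have : ‖(a : EE (n + 1)) + Real.sqrt (r ^ 2 - ‖a‖ ^ 2) • v‖ ^ 2 = r ^ 2 := by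
        rw [norm_add_sq_real, inner_smul_right, horth, norm_smul, hv, mul_one, Real.norm_eq_abs,
          sq_abs, Real.sq_sqrt h0, Submodule.coe_norm]
        ring
      exact (pow_left_inj₀ (norm_nonneg _) hr.le two_ne_zero).1 this
    · have hvz : V.orthogonalProjectionOnto v = 0 := by
        apply Submodule.orthogonalProjectionOnto_orthogonal_apply_eq_zero
        exact Submodule.mem_span_singleton_self v
      rw [map_add, map_add, map_smul, hvz, Submodule.orthogonalProjectionOnto_mem_subspace_eq_self]
      simp [ha]
  calc μH[(n : ℝ)] (ball (V.orthogonalProjectionOnto x) r) ≤ _ := measure_mono hsub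
    _ ≤ _ := by
      have hL : LipschitzWith 1 V.orthogonalProjectionOnto := V.lipschitzWith_orthogonalProjectionOnto
      simpa using hL.hausdorffMeasure_image_le (d := (n : ℝ)) (by positivity) (sphere x r)

lemma sph_integrable {m : ℕ} (hm : 2 ≤ m) {f : EE m → ℝ} {x : EE m} {r : ℝ} (hr : 0 < r)
    (hf : ContinuousOn f (sphere x r)) : IntegrableOn f (sphere x r) μH[(m : ℝ) - 1] := by
  obtain ⟨C, hC⟩ := (isCompact_sphere x r).exists_bound_of_continuousOn hf
  have : IsFiniteMeasure ((μH[(m : ℝ) - 1]).restrict (sphere x r)) :=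
    ⟨by rw [Measure.restrict_apply_univ]; exact sphere_finite hm x hr⟩
  exact Integrable.of_bound (hf.aestronglyMeasurable isClosed_sphere.measurableSet) C
    ((ae_restrict_iff' isClosed_sphere.measurableSet).2 (Eventually.of_forall hC))

lemma sph_ne {m : ℕ} (hm : 2 ≤ m) (x : EE m) {r : ℝ} (hr : 0 < r) :
    0 < (μH[(m : ℝ) - 1] (sphere x r)).toReal :=
  ENNReal.toReal_pos (sphere_pos hm x hr).ne' (sphere_finite hm x hr).ne

lemma sphAvg_add {m : ℕ} (hm : 2 ≤ m) {f g : EE m → ℝ} {x : EE m} {r : ℝ} (hr : 0 < r)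
    (hf : ContinuousOn f (sphere x r)) (hg : ContinuousOn g (sphere x r)) :
    sphAvg (fun y => f y + g y) x r = sphAvg f x r + sphAvg g x r := by
  unfold sphAvg
  rw [integral_add (sph_integrable hm hr hf) (sph_integrable hm hr hg), mul_add]

lemma sphAvg_const_mul {m : ℕ} (c : ℝ) (f : EE m → ℝ) (x : EE m) (r : ℝ) :
    sphAvg (fun y => c * f y) x r = c * sphAvg f x r := by
  unfold sphAvg
  rw [integral_const_mul]; ring

lemma sphAvg_const {m : ℕ} (hm : 2 ≤ m) (c : ℝ) (x : EE m) {r : ℝ} (hr : 0 < r) :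
    sphAvg (fun _ => c) x r = c := by
  unfold sphAvg
  rw [setIntegral_const, smul_eq_mul, Measure.real, ← mul_assoc, inv_mul_cancel₀ (sph_ne hm x hr).ne',
    one_mul]

lemma sphAvg_congr {m : ℕ} {f g : EE m → ℝ} {x : EE m} {r : ℝ}
    (h : ∀ y ∈ sphere x r, f y = g y) : sphAvg f x r = sphAvg g x r := by
  unfold sphAvg
  rw [setIntegral_congr_fun isClosed_sphere.measurableSet h]

lemma sphAvg_mono {m : ℕ} (hm : 2 ≤ m) {f g : EE m → ℝ} {x : EE m} {r : ℝ} (hr : 0 < r)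
    (hf : ContinuousOn f (sphere x r)) (hg : ContinuousOn g (sphere x r))
    (h : ∀ y ∈ sphere x r, f y ≤ g y) : sphAvg f x r ≤ sphAvg g x r := by
  unfold sphAvg
  have := setIntegral_mono_on (sph_integrable hm hr hf) (sph_integrable hm hr hg)
    isClosed_sphere.measurableSet h
  have h0 := sph_ne hm x hr
  gcongr

lemma sphAvg_sum {m : ℕ} (hm : 2 ≤ m) {ι : Type*} (s : Finset ι) {f : ι → EE m → ℝ} {x : EE m}
    {r : ℝ} (hr : 0 < r) (hf : ∀ i ∈ s, ContinuousOn (f i) (sphere x r)) :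
    sphAvg (fun y => ∑ i ∈ s, f i y) x r = ∑ i ∈ s, sphAvg (f i) x r := by
  unfold sphAvg
  rw [integral_finsetSum _ (fun i hi => sph_integrable hm hr (hf i hi)), Finset.mul_sum]

lemma sphAvg_isom {m : ℕ} (e : EE m ≃ₗᵢ[ℝ] EE m) (f : EE m → ℝ) (x : EE m) (r : ℝ) :
    sphAvg (fun y => f (x + e (y - x))) x r = sphAvg f x r := by
  unfold sphAvg
  congr 1
  let T : EE m ≃ᵢ EE m := ((IsometryEquiv.subRight x).trans e.toIsometryEquiv).trans
    (IsometryEquiv.addLeft x)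
  have hT : ∀ y, T y = x + e (y - x) := fun y => rfl
  have h := (T.measurePreserving_hausdorffMeasure ((m : ℝ) - 1)).setIntegral_preimage_emb
    T.toHomeomorph.measurableEmbedding f (sphere x r)
  have hpre : T ⁻¹' (sphere x r) = sphere x r := by
    ext y
    rw [Set.mem_preimage, hT, mem_sphere, mem_sphere, dist_eq_norm, dist_eq_norm,
      add_sub_cancel_left, LinearIsometryEquiv.norm_map]
  rw [hpre] at h
  exact h

/-- sign flip of one coordinate -/
def flipE {m : ℕ} (i : Fin m) : EE m ≃ₗᵢ[ℝ] EE m :=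
  LinearIsometryEquiv.piLpCongrRight 2 (fun k => if k = i then LinearIsometryEquiv.neg ℝ
    else LinearIsometryEquiv.refl ℝ ℝ)

lemma flipE_apply {m : ℕ} (i k : Fin m) (z : EE m) :
    flipE i z k = if k = i then - z k else z k := by
  unfold flipE
  by_cases h : k = i <;> simp [h]

/-- swap of two coordinates -/
def swapE {m : ℕ} (i j : Fin m) : EE m ≃ₗᵢ[ℝ] EE m :=
  LinearIsometryEquiv.piLpCongrLeft 2 ℝ ℝ (Equiv.swap i j)

lemma swapE_apply {m : ℕ} (i j k : Fin m) (z : EE m) :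
    swapE i j z k = z (Equiv.swap i j k) := by
  unfold swapE
  simp [LinearIsometryEquiv.piLpCongrLeft_apply, Equiv.piCongrLeft'_apply]

lemma moment1 {m : ℕ} (x : EE m) (r : ℝ) (i : Fin m) :
    sphAvg (fun y => y i - x i) x r = 0 := by
  have h := sphAvg_isom (flipE i) (fun y => y i - x i) x r
  have h2 : (fun y : EE m => (x + flipE i (y - x)) i - x i) = fun y => (-1) * (y i - x i) := by
    ext y
    simp [flipE_apply]
    ring
  rw [h2, sphAvg_const_mul] at h
  linarith

lemma moment2_off {m : ℕ} (x : EE m) (r : ℝ) {i j : Fin m} (hij : i ≠ j) :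
    sphAvg (fun y => (y i - x i) * (y j - x j)) x r = 0 := by
  have h := sphAvg_isom (flipE i) (fun y => (y i - x i) * (y j - x j)) x r
  have h2 : (fun y : EE m => ((x + flipE i (y - x)) i - x i) * ((x + flipE i (y - x)) j - x j))
      = fun y => (-1) * ((y i - x i) * (y j - x j)) := by
    ext y
    simp [flipE_apply, hij.symm]
    ring
  rw [h2, sphAvg_const_mul] at h
  linarith

lemma moment2_swap {m : ℕ} (x : EE m) (r : ℝ) (i j : Fin m) :
    sphAvg (fun y => (y i - x i) * (y i - x i)) x r
      = sphAvg (fun y => (y j - x j) * (y j - x j)) x r := by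
  have h := sphAvg_isom (swapE i j) (fun y => (y i - x i) * (y i - x i)) x r
  have h2 : (fun y : EE m => ((x + swapE i j (y - x)) i - x i) * ((x + swapE i j (y - x)) i - x i))
      = fun y => ((y j - x j) * (y j - x j)) := by
    ext y
    simp [swapE_apply]
  rw [h2] at h
  exact h.symm

lemma moment2_diag {m : ℕ} (hm : 2 ≤ m) (x : EE m) {r : ℝ} (hr : 0 < r) (i : Fin m) :
    sphAvg (fun y => (y i - x i) * (y i - x i)) x r = r ^ 2 / m := by
  have h : ∑ j : Fin m, sphAvg (fun y => (y j - x j) * (y j - x j)) x r = r ^ 2 := by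
    rw [← sphAvg_sum hm _ hr (fun i _ => by fun_prop), ← sphAvg_const hm (r ^ 2) x hr]
    apply sphAvg_congr
    intro y hy
    rw [mem_sphere, dist_eq_norm] at hy
    rw [← hy, EuclideanSpace.norm_sq_eq]
    simp [sq]
  rw [Finset.sum_congr rfl (fun j _ => moment2_swap x r j i)] at h
  simp at h
  have : (m : ℝ) ≠ 0 := by positivity
  rw [eq_div_iff this]
  linarith

/-- generalized (Blaschke) Laplacian, up to normalization -/
def GLap {m : ℕ} (f : EE m → ℝ) (x : EE m) (c : ℝ) : Prop :=
  Tendsto (fun r : ℝ => (r ^ 2)⁻¹ * (sphAvg f x r - f x)) (𝓝[>] 0) (𝓝 c)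

lemma sph_in_ball {m : ℕ} {s : Set (EE m)} {x : EE m} (hs : s ∈ 𝓝 x) :
    ∀ᶠ r in 𝓝[>] (0 : ℝ), 0 < r ∧ sphere x r ⊆ s := by
  obtain ⟨δ, hδ, h⟩ := Metric.mem_nhds_iff.1 hs
  filter_upwards [Ioo_mem_nhdsGT hδ] with r hr
  exact ⟨hr.1, fun y hy => h (by rw [mem_ball, mem_sphere.1 hy]; exact hr.2)⟩

lemma GLap_add {m : ℕ} (hm : 2 ≤ m) {f g : EE m → ℝ} {x : EE m} {c d : ℝ} {s : Set (EE m)}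
    (hs : s ∈ 𝓝 x) (hf : ContinuousOn f s) (hg : ContinuousOn g s) (h1 : GLap f x c) (h2 : GLap g x d) :
    GLap (fun y => f y + g y) x (c + d) := by
  refine (Tendsto.add h1 h2).congr' ?_
  filter_upwards [sph_in_ball hs] with r hr
  rw [sphAvg_add hm hr.1 (hf.mono hr.2) (hg.mono hr.2)]
  ring

lemma GLap_const_mul {m : ℕ} {f : EE m → ℝ} {x : EE m} {c : ℝ} (a : ℝ) (h1 : GLap f x c) :
    GLap (fun y => a * f y) x (a * c) := by
  refine (h1.const_mul a).congr (fun r => ?_)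
  rw [sphAvg_const_mul]
  ring

lemma GLap_taylor {m : ℕ} (hm : 2 ≤ m) {f : EE m → ℝ} (hf : Continuous f) {x : EE m}
    (a : Fin m → ℝ) (b : Fin m → Fin m → ℝ) (C : ℝ)
    (h : ∀ y, ‖y - x‖ ≤ 1 → |f y - (f x + ∑ i, a i * (y i - x i)
      + ∑ i, ∑ j, b i j * ((y i - x i) * (y j - x j)))| ≤ C * ‖y - x‖ ^ 3) :
    GLap f x ((∑ i, b i i) / m) := by
  set R : EE m → ℝ := fun y => f y - (f x + ∑ i, a i * (y i - x i)
      + ∑ i, ∑ j, b i j * ((y i - x i) * (y j - x j))) with hR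
  have hRc : Continuous R := by fun_prop
  have hm0 : (m : ℝ) ≠ 0 := by positivity
  have key : ∀ r : ℝ, 0 < r →
      sphAvg f x r = f x + r ^ 2 * ((∑ i, b i i) / m) + sphAvg R x r := by
    intro r hr
    have e : sphAvg f x r = sphAvg (fun y => ((f x + ∑ i, a i * (y i - x i))
      + ∑ i, ∑ j, b i j * ((y i - x i) * (y j - x j))) + R y) x r := by
      apply sphAvg_congr; intro y _; simp [hR]
    rw [e, sphAvg_add hm hr (by fun_prop) (by fun_prop),
      sphAvg_add hm hr (by fun_prop) (by fun_prop),
      sphAvg_add hm hr (by fun_prop) (by fun_prop), sphAvg_const hm _ _ hr,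
      sphAvg_sum hm _ hr (fun i _ => by fun_prop), sphAvg_sum hm _ hr (fun i _ => by fun_prop)]
    have h1 : ∀ i, sphAvg (fun y => a i * (y i - x i)) x r = 0 := by
      intro i; rw [sphAvg_const_mul, moment1]; ring
    have h2 : ∀ i, sphAvg (fun y => ∑ j, b i j * ((y i - x i) * (y j - x j))) x r
        = b i i * (r ^ 2 / m) := by
      intro i
      rw [sphAvg_sum hm _ hr (fun i _ => by fun_prop), Finset.sum_eq_single i]
      · rw [sphAvg_const_mul, moment2_diag hm x hr]
      · intro j _ hj
        rw [sphAvg_const_mul, moment2_off x r hj.symm]; ring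
      · simp
    simp only [h1, h2, Finset.sum_const_zero, ← Finset.sum_mul]
    ring
  have hb : ∀ r : ℝ, 0 < r → r ≤ 1 → |sphAvg R x r| ≤ C * r ^ 3 := by
    intro r hr hr1
    have hbd : ∀ y ∈ sphere x r, |R y| ≤ C * r ^ 3 := by
      intro y hy
      rw [mem_sphere, dist_eq_norm] at hy
      have := h y (by rw [hy]; exact hr1)
      rwa [hy] at this
    rw [abs_le]
    constructor
    · rw [← sphAvg_const hm (-(C * r ^ 3)) x hr]
      exact sphAvg_mono hm hr (by fun_prop) (by fun_prop) (fun y hy => (abs_le.1 (hbd y hy)).1)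
    · refine le_trans ?_ (sphAvg_const hm (C * r ^ 3) x hr).le
      exact sphAvg_mono hm hr (by fun_prop) (by fun_prop) (fun y hy => (abs_le.1 (hbd y hy)).2)
  unfold GLap
  rw [tendsto_iff_dist_tendsto_zero]
  refine squeeze_zero' (g := fun r : ℝ => C * r) (Eventually.of_forall fun r => dist_nonneg) ?_ ?_
  · filter_upwards [Ioc_mem_nhdsGT (show (0 : ℝ) < 1 by norm_num)] with r hr
    have hr0 : r ≠ 0 := hr.1.ne'
    rw [key r hr.1, Real.dist_eq]
    have : (r ^ 2)⁻¹ * (f x + r ^ 2 * ((∑ i, b i i) / m) + sphAvg R x r - f x) - (∑ i, b i i) / m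
        = (r ^ 2)⁻¹ * sphAvg R x r := by
      field_simp; ring
    rw [this, abs_mul, abs_of_pos (by have := hr.1; positivity)]
    calc (r ^ 2)⁻¹ * |sphAvg R x r| ≤ (r ^ 2)⁻¹ * (C * r ^ 3) := by
          have := hb r hr.1 hr.2
          gcongr
      _ = C * r := by field_simp
  · have : Tendsto (fun r : ℝ => C * r) (𝓝 0) (𝓝 (C * 0)) := (continuous_const.mul continuous_id).tendsto 0
    rw [mul_zero] at this
    exact this.mono_left nhdsWithin_le_nhds

open MvPolynomial

/-- Evaluation of a polynomial at a point of Euclidean space. -/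
def ev {m : ℕ} (p : MvPolynomial (Fin m) ℝ) (y : EE m) : ℝ := MvPolynomial.eval (fun i => y i) p

/-- Laplacian of polynomials. -/
def lapP {m : ℕ} (p : MvPolynomial (Fin m) ℝ) : MvPolynomial (Fin m) ℝ :=
  ∑ i, pderiv i (pderiv i p)

@[simp] lemma ev_add {m : ℕ} (p q : MvPolynomial (Fin m) ℝ) (y : EE m) :
    ev (p + q) y = ev p y + ev q y := by simp [ev]
@[simp] lemma ev_sub {m : ℕ} (p q : MvPolynomial (Fin m) ℝ) (y : EE m) :
    ev (p - q) y = ev p y - ev q y := by simp [ev]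
@[simp] lemma ev_mul {m : ℕ} (p q : MvPolynomial (Fin m) ℝ) (y : EE m) :
    ev (p * q) y = ev p y * ev q y := by simp [ev]
@[simp] lemma ev_C {m : ℕ} (c : ℝ) (y : EE m) : ev (C c) y = c := by simp [ev]
@[simp] lemma ev_zero {m : ℕ} (y : EE m) : ev 0 y = 0 := by simp [ev]
@[simp] lemma ev_X {m : ℕ} (i : Fin m) (y : EE m) : ev (X i) y = y i := by simp [ev]
@[simp] lemma ev_sum {m : ℕ} {ι : Type*} (s : Finset ι) (f : ι → MvPolynomial (Fin m) ℝ) (y : EE m) :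
    ev (∑ i ∈ s, f i) y = ∑ i ∈ s, ev (f i) y := by simp [ev]

lemma ev_cont {m : ℕ} (p : MvPolynomial (Fin m) ℝ) : Continuous (ev p) := by
  induction p using MvPolynomial.induction_on with
  | C a => simp only [funext (ev_C a)]; exact continuous_const
  | add p q hp hq => simp only [funext (ev_add p q)]; exact hp.add hq
  | mul_X p i hp =>
    simp only [funext (ev_mul p (X i)), ev_X]; exact hp.mul (by fun_prop)

lemma pd_X {m : ℕ} (i k : Fin m) :
    pderiv i (X k : MvPolynomial (Fin m) ℝ) = C (if i = k then 1 else 0) := by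
  rw [pderiv_X]
  by_cases h : i = k
  · subst h; simp
  · simp [h, Ne.symm h]

lemma lapP_add {m : ℕ} (p q : MvPolynomial (Fin m) ℝ) : lapP (p + q) = lapP p + lapP q := by
  simp [lapP, Finset.sum_add_distrib]
lemma lapP_sub {m : ℕ} (p q : MvPolynomial (Fin m) ℝ) : lapP (p - q) = lapP p - lapP q := by
  simp [lapP, Finset.sum_sub_distrib]
lemma lapP_C_mul {m : ℕ} (c : ℝ) (q : MvPolynomial (Fin m) ℝ) : lapP (C c * q) = C c * lapP q := by
  simp [lapP, Finset.mul_sum]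

lemma poly_taylor {m : ℕ} (p : MvPolynomial (Fin m) ℝ) (x : EE m) : ∃ K : ℝ, 0 ≤ K ∧
    ∀ y : EE m, ‖y - x‖ ≤ 1 → |ev p y - (ev p x + ∑ i, ev (pderiv i p) x * (y i - x i)
      + ∑ i, ∑ j, (ev (pderiv j (pderiv i p)) x / 2) * ((y i - x i) * (y j - x j)))|
        ≤ K * ‖y - x‖ ^ 3 := by
  induction p using MvPolynomial.induction_on with
  | C a => exact ⟨0, le_rfl, fun y _ => by simp⟩
  | add p q hp hq =>
    obtain ⟨K, hK, h⟩ := hp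
    obtain ⟨L, hL, h'⟩ := hq
    refine ⟨K + L, by positivity, fun y hy => ?_⟩
    rw [add_mul]
    refine le_trans (le_of_eq ?_) ((abs_add_le _ _).trans (add_le_add (h y hy) (h' y hy)))
    congr 1
    simp only [map_add, ev_add, add_mul, add_div, Finset.sum_add_distrib]
    ring
  | mul_X p k hp =>
    obtain ⟨K, hK, h⟩ := hp
    refine ⟨K * (|x k| + 1) + ∑ i, ∑ j, |ev (pderiv j (pderiv i p)) x / 2|, by positivity,
      fun y hy => ?_⟩
    have hz : ∀ i, |y i - x i| ≤ ‖y - x‖ := fun i => by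
      have := PiLp.norm_apply_le (y - x) i
      simpa using this
    set A := ∑ i, ev (pderiv i p) x * (y i - x i) with hA
    set B := ∑ i, ∑ j, (ev (pderiv j (pderiv i p)) x / 2) * ((y i - x i) * (y j - x j)) with hB
    have hBb : |B| ≤ (∑ i, ∑ j, |ev (pderiv j (pderiv i p)) x / 2|) * ‖y - x‖ ^ 2 := by
      rw [hB, Finset.sum_mul]
      refine (Finset.abs_sum_le_sum_abs _ _).trans (Finset.sum_le_sum fun i _ => ?_)
      rw [Finset.sum_mul]
      refine (Finset.abs_sum_le_sum_abs _ _).trans (Finset.sum_le_sum fun j _ => ?_)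
      rw [abs_mul, abs_mul, sq]
      have := hz i; have := hz j
      gcongr
    have e1 : ∑ i, ev (pderiv i (p * X k)) x * (y i - x i) = A * x k + ev p x * (y k - x k) := by
      rw [hA, Finset.sum_mul]
      simp only [pderiv_mul, pd_X, ev_add, ev_mul, ev_X, ev_C, add_mul, Finset.sum_add_distrib]
      congr 1
      · exact Finset.sum_congr rfl fun i _ => by ring
      · rw [Finset.sum_eq_single k] <;> simp +contextual
    have e2 : ∑ i, ∑ j, (ev (pderiv j (pderiv i (p * X k))) x / 2) * ((y i - x i) * (y j - x j))
        = B * x k + A * (y k - x k) := by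
      have e3 : ∀ i j, ev (pderiv j (pderiv i (p * X k))) x / 2 * ((y i - x i) * (y j - x j))
          = (ev (pderiv j (pderiv i p)) x / 2) * ((y i - x i) * (y j - x j)) * x k
          + (ev (pderiv i p) x / 2 * (y i - x i)) * ((if j = k then 1 else 0) * (y j - x j))
          + ((if i = k then 1 else 0) * (y i - x i)) * (ev (pderiv j p) x / 2 * (y j - x j)) := by
        intro i j
        simp only [pderiv_mul, pd_X, map_add, ev_add, ev_mul, ev_X, ev_C, pderiv_C, ev_zero]
        ring
      have e4 : ∑ j, ((if j = k then (1 : ℝ) else 0) * (y j - x j)) = y k - x k := by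
        rw [Finset.sum_eq_single k] <;> simp +contextual
      have e5 : ∑ i, ev (pderiv i p) x / 2 * (y i - x i) = A / 2 := by
        rw [hA, Finset.sum_div]; exact Finset.sum_congr rfl fun i _ => by ring
      simp only [e3, Finset.sum_add_distrib, ← Finset.mul_sum, ← Finset.sum_mul, e4, e5]
      rw [← hB]; ring
    rw [e1, e2, ev_mul, ev_mul, ev_X, ev_X]
    have e6 : ev p y * y k - (ev p x * x k + (A * x k + ev p x * (y k - x k))
        + (B * x k + A * (y k - x k)))
        = (ev p y - (ev p x + A + B)) * y k + B * (y k - x k) := by ring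
    rw [e6, add_mul]
    refine (abs_add_le _ _).trans (add_le_add ?_ ?_)
    · rw [abs_mul]
      have h1 := h y hy
      have h2 : |y k| ≤ |x k| + 1 := by
        calc |y k| = |x k + (y k - x k)| := by ring_nf
          _ ≤ _ := (abs_add_le _ _).trans (by have := hz k; linarith)
      calc _ ≤ (K * ‖y - x‖ ^ 3) * (|x k| + 1) := mul_le_mul h1 h2 (abs_nonneg _) (by positivity)
        _ = _ := by ring
    · rw [abs_mul]
      calc _ ≤ ((∑ i, ∑ j, |ev (pderiv j (pderiv i p)) x / 2|) * ‖y - x‖ ^ 2) * ‖y - x‖ :=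
            mul_le_mul hBb (hz k) (abs_nonneg _) (by positivity)
        _ = _ := by ring

lemma GLap_poly {m : ℕ} (hm : 2 ≤ m) (p : MvPolynomial (Fin m) ℝ) (x : EE m) :
    GLap (ev p) x (ev (lapP p) x / (2 * m)) := by
  obtain ⟨K, -, h⟩ := poly_taylor p x
  have := GLap_taylor hm (ev_cont p) _ _ K h
  convert this using 1
  rw [lapP, ev_sum, ← Finset.sum_div, div_div]

/-- the squared distance polynomial -/
def qd {m : ℕ} (x : EE m) : MvPolynomial (Fin m) ℝ := ∑ i, (X i - C (x i)) * (X i - C (x i))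

lemma ev_qd {m : ℕ} (x y : EE m) : ev (qd x) y = ‖y - x‖ ^ 2 := by
  rw [EuclideanSpace.norm_sq_eq]
  simp [qd, sq]

lemma pd_qd {m : ℕ} (x : EE m) (i : Fin m) : pderiv i (qd x) = C 2 * (X i - C (x i)) := by
  rw [qd, map_sum, Finset.sum_eq_single i]
  · simp only [pderiv_mul, map_sub, pd_X, pderiv_C, if_true, map_one]
    rw [show (C 2 : MvPolynomial (Fin m) ℝ) = 2 from rfl]; ring
  · intro j _ hj
    simp only [pderiv_mul, map_sub, pd_X, pderiv_C, if_neg (Ne.symm hj)]; simp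
  · simp

lemma pd2_qd {m : ℕ} (x : EE m) (i : Fin m) : pderiv i (pderiv i (qd x)) = C 2 := by
  rw [pd_qd, pderiv_mul, map_sub, pd_X, pderiv_C, pderiv_C]; simp

lemma lapP_qd {m : ℕ} (x y : EE m) : ev (lapP (qd x)) y = 2 * m := by
  simp only [lapP, ev_sum, pd2_qd, ev_C]
  simp [mul_comm]

lemma max_principle {m : ℕ} (hm : 2 ≤ m) {x0 : EE m} {R : ℝ} {w : EE m → ℝ}
    (hw : ContinuousOn w (closedBall x0 R))
    (hG : ∀ x ∈ ball x0 R, ∃ c, 0 ≤ c ∧ GLap w x c) {M : ℝ}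
    (hM : ∀ y ∈ sphere x0 R, w y ≤ M) : ∀ y ∈ closedBall x0 R, w y ≤ M := by
  by_contra! hcon
  obtain ⟨x1, hx1, hlt⟩ := hcon
  set ε : ℝ := (w x1 - M) / (2 * (R ^ 2 + 1)) with hε
  have hε0 : 0 < ε := by
    have : 0 < w x1 - M := by linarith
    positivity
  have hε1 : M + ε * R ^ 2 < w x1 := by
    have h1 : ε * (2 * (R ^ 2 + 1)) = w x1 - M := by rw [hε]; field_simp
    nlinarith [sq_nonneg R]
  set W : EE m → ℝ := fun y => w y + ε * ev (qd x0) y with hW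
  have hqc := ev_cont (qd x0)
  have hWc : ContinuousOn W (closedBall x0 R) := hw.add (by fun_prop)
  obtain ⟨x2, hx2, hmax⟩ := (isCompact_closedBall x0 R).exists_isMaxOn ⟨x1, hx1⟩ hWc
  have h12 : w x1 ≤ W x2 := by
    refine le_trans ?_ (hmax hx1)
    simp only [hW, ev_qd]
    have : 0 ≤ ε * ‖x1 - x0‖ ^ 2 := by positivity
    linarith
  have hx2b : x2 ∈ ball x0 R := by
    rcases (mem_closedBall.1 hx2).lt_or_eq with h | h
    · exact h
    · exfalso
      have h1 := hM x2 h
      have h2 : W x2 = w x2 + ε * R ^ 2 := by simp only [hW, ev_qd, ← dist_eq_norm, h]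
      linarith
  obtain ⟨c, hc, hGc⟩ := hG x2 hx2b
  have hnh : closedBall x0 R ∈ 𝓝 x2 :=
    mem_of_superset (isOpen_ball.mem_nhds hx2b) ball_subset_closedBall
  have hGW : GLap W x2 (c + ε * (ev (lapP (qd x0)) x2 / (2 * m))) :=
    GLap_add hm hnh hw (by fun_prop) hGc (GLap_const_mul ε (GLap_poly hm (qd x0) x2))
  have hm0 : (m : ℝ) ≠ 0 := by positivity
  rw [lapP_qd, div_self (by positivity), mul_one] at hGW
  have : c + ε ≤ 0 := by
    refine le_of_tendsto hGW ?_
    filter_upwards [sph_in_ball hnh] with r hr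
    have hle : sphAvg W x2 r ≤ W x2 := by
      refine le_trans (sphAvg_mono hm hr.1 (hWc.mono hr.2) (g := fun _ => W x2)
        continuousOn_const (fun y hy => hmax (hr.2 hy))) (sphAvg_const hm _ _ hr.1).le
    have : 0 ≤ (r ^ 2)⁻¹ := by positivity
    exact mul_nonpos_of_nonneg_of_nonpos this (by linarith)
  linarith

lemma totalDegree_pd {m : ℕ} (i : Fin m) (p : MvPolynomial (Fin m) ℝ) :
    (pderiv i p).totalDegree ≤ p.totalDegree - 1 := by
  unfold totalDegree
  refine Finset.sup_le fun n hn => ?_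
  rw [mem_support_iff, coeff_pderiv] at hn
  have h1 : n + Finsupp.single i 1 ∈ p.support := by
    rw [mem_support_iff]; intro h; exact hn (by rw [h]; simp)
  have h2 := le_totalDegree h1
  rw [Finsupp.sum_add_index' (by simp) (by simp), Finsupp.sum_single_index (by simp)] at h2
  unfold totalDegree at h2
  omega

lemma totalDegree_lapP {m : ℕ} (p : MvPolynomial (Fin m) ℝ) :
    (lapP p).totalDegree ≤ p.totalDegree - 2 := by
  refine totalDegree_finsetSum_le fun i _ => ?_
  have h1 := totalDegree_pd i p
  have h2 := totalDegree_pd i (pderiv i p)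
  omega

lemma pd_comm {m : ℕ} (i j : Fin m) (p : MvPolynomial (Fin m) ℝ) :
    pderiv i (pderiv j p) = pderiv j (pderiv i p) := by
  let D1 : Derivation ℝ (MvPolynomial (Fin m) ℝ) (MvPolynomial (Fin m) ℝ) := pderiv i
  let D2 : Derivation ℝ (MvPolynomial (Fin m) ℝ) (MvPolynomial (Fin m) ℝ) := pderiv j
  have h : ⁅D1, D2⁆ = 0 := by
    apply derivation_ext
    intro k
    rw [Derivation.commutator_apply]
    simp only [D1, D2, pd_X, pderiv_C]
    simp
  have h2 : ⁅D1, D2⁆ p = D1 (D2 p) - D2 (D1 p) := Derivation.commutator_apply p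
  rw [h, Derivation.zero_apply] at h2
  exact sub_eq_zero.1 h2.symm

lemma lapP_pd {m : ℕ} (k : Fin m) (p : MvPolynomial (Fin m) ℝ) :
    lapP (pderiv k p) = pderiv k (lapP p) := by
  unfold lapP
  rw [map_sum]
  exact Finset.sum_congr rfl fun i _ => by rw [pd_comm i k p, pd_comm i k]

/-- polynomial vanishing on the sphere -/
def eta {m : ℕ} (x : EE m) (R : ℝ) : MvPolynomial (Fin m) ℝ := C (R ^ 2) - qd x

lemma ev_eta {m : ℕ} (x : EE m) (R : ℝ) (y : EE m) : ev (eta x R) y = R ^ 2 - ‖y - x‖ ^ 2 := by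
  rw [eta, ev_sub, ev_C, ev_qd]

lemma totalDegree_eta {m : ℕ} (x : EE m) (R : ℝ) : (eta x R).totalDegree ≤ 2 := by
  refine (totalDegree_sub _ _).trans (max_le (by rw [totalDegree_C]; omega) ?_)
  refine totalDegree_finsetSum_le fun i _ => (totalDegree_mul _ _).trans ?_
  have : (X i - C (x i) : MvPolynomial (Fin m) ℝ).totalDegree ≤ 1 :=
    (totalDegree_sub _ _).trans (max_le (totalDegree_X i).le (by simp))
  omega

lemma poly_max {m : ℕ} (hm : 2 ≤ m) (x0 : EE m) {R : ℝ} (p : MvPolynomial (Fin m) ℝ)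
    (hp : ∀ y ∈ ball x0 R, 0 ≤ ev (lapP p) y) {M : ℝ}
    (hM : ∀ y ∈ sphere x0 R, ev p y ≤ M) : ∀ y ∈ closedBall x0 R, ev p y ≤ M :=
  max_principle hm (ev_cont p).continuousOn
    (fun x hx => ⟨_, div_nonneg (hp x hx) (by positivity), GLap_poly hm p x⟩) hM

lemma poly_zero_of_ball {m : ℕ} (x0 : EE m) {R : ℝ} (hR : 0 < R) (p : MvPolynomial (Fin m) ℝ)
    (hp : ∀ y ∈ ball x0 R, ev p y = 0) : p = 0 := by
  have hop : IsOpen ((fun z : Fin m → ℝ => WithLp.toLp 2 z) ⁻¹' ball x0 R) :=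
    isOpen_ball.preimage (PiLp.continuous_toLp 2 _)
  obtain ⟨δ, hδ, hsub⟩ := Metric.isOpen_iff.1 hop (fun i => x0 i) (by simpa using hR)
  refine funext_set (fun i => ball (x0 i) δ) (fun i => ?_) (fun z hz => ?_)
  · rw [Real.ball_eq_Ioo]; exact Set.Ioo_infinite (by linarith)
  · have : z ∈ ball (fun i => x0 i) δ := by
      rw [ball_pi _ hδ]; exact hz
    have := hp _ (hsub this)
    simpa [ev] using this

lemma dirichlet {m : ℕ} (hm : 2 ≤ m) (x0 : EE m) {R : ℝ} (hR : 0 < R)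
    (p : MvPolynomial (Fin m) ℝ) :
    ∃ h : MvPolynomial (Fin m) ℝ, lapP h = 0 ∧ ∀ y ∈ sphere x0 R, ev h y = ev p y := by
  set k := p.totalDegree
  have hmem : ∀ q ∈ restrictTotalDegree (Fin m) ℝ k,
      lapP (eta x0 R * q) ∈ restrictTotalDegree (Fin m) ℝ k := by
    intro q hq
    rw [mem_restrictTotalDegree] at hq ⊢
    have h1 := totalDegree_lapP (eta x0 R * q)
    have h2 := totalDegree_mul (eta x0 R) q
    have h3 := totalDegree_eta x0 R
    omega
  let T : restrictTotalDegree (Fin m) ℝ k →ₗ[ℝ] restrictTotalDegree (Fin m) ℝ k :=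
    { toFun := fun q => ⟨lapP (eta x0 R * q), hmem q q.2⟩
      map_add' := fun a b => by
        ext1
        simp [mul_add, lapP_add]
      map_smul' := fun c a => by
        ext1
        simp only [Submodule.coe_smul, RingHom.id_apply, smul_eq_C_mul]
        rw [← lapP_C_mul]; congr 1; ring }
  have hT : ∀ q : restrictTotalDegree (Fin m) ℝ k, (T q : MvPolynomial (Fin m) ℝ) = lapP (eta x0 R * (q : MvPolynomial (Fin m) ℝ)) := fun q => rfl
  have hinj : Function.Injective T := by
    rw [← LinearMap.ker_eq_bot, LinearMap.ker_eq_bot']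
    intro q hq
    have h0 : lapP (eta x0 R * (q : MvPolynomial (Fin m) ℝ)) = 0 := by
      rw [← hT, hq]; rfl
    have hs : ∀ y ∈ sphere x0 R, ev (eta x0 R * (q : MvPolynomial (Fin m) ℝ)) y = 0 := by
      intro y hy
      rw [mem_sphere, dist_eq_norm] at hy
      rw [ev_mul, ev_eta, hy]; ring
    have hu := poly_max hm x0 (eta x0 R * (q : MvPolynomial (Fin m) ℝ))
      (fun y _ => by rw [h0]; simp) (fun y hy => (hs y hy).le)
    have hl := poly_max hm x0 (C (-1) * (eta x0 R * (q : MvPolynomial (Fin m) ℝ)))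
      (fun y _ => by rw [lapP_C_mul, h0]; simp)
      (M := 0) (R := R) (fun y hy => by rw [ev_mul, hs y hy]; simp)
    have : (q : MvPolynomial (Fin m) ℝ) = 0 := by
      refine poly_zero_of_ball x0 hR _ fun y hy => ?_
      have h1 := hu y (ball_subset_closedBall hy)
      have h2 := hl y (ball_subset_closedBall hy)
      rw [ev_mul, ev_C] at h2
      have h3 : ev (eta x0 R * (q : MvPolynomial (Fin m) ℝ)) y = 0 := by linarith
      rw [ev_mul, ev_eta] at h3
      rw [mem_ball, dist_eq_norm] at hy
      rcases mul_eq_zero.1 h3 with h | h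
      · nlinarith [norm_nonneg (y - x0)]
      · exact h
    exact Subtype.ext this
  have hsurj := LinearMap.injective_iff_surjective.1 hinj
  obtain ⟨q, hq⟩ := hsurj ⟨lapP p, by
    rw [mem_restrictTotalDegree]
    have := totalDegree_lapP p
    omega⟩
  refine ⟨p - eta x0 R * q, ?_, fun y hy => ?_⟩
  · rw [lapP_sub, ← hT, hq, sub_self]
  · rw [mem_sphere, dist_eq_norm] at hy
    rw [ev_sub, ev_mul, ev_eta, hy]; ring

lemma bernstein_grad {m : ℕ} (hm : 2 ≤ m) (x0 : EE m) {R : ℝ} (hR : 0 < R) : ∃ K : ℝ, 0 < K ∧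
    ∀ (h : MvPolynomial (Fin m) ℝ), lapP h = 0 → ∀ M : ℝ, 0 ≤ M →
      (∀ y ∈ closedBall x0 R, |ev h y| ≤ M) → ∀ k : Fin m, ∀ y ∈ closedBall x0 (R / 2),
        |ev (pderiv k h) y| ≤ K * M := by
  set c : ℝ := (12 + 2 * m) * R ^ 2 with hc
  have hc0 : 0 < c := by positivity
  refine ⟨Real.sqrt c / (3 * R ^ 2 / 4), by positivity, ?_⟩
  intro h hh M hM hb k y hy
  set g := pderiv k h with hg
  have hgh : lapP g = 0 := by rw [hg, lapP_pd, hh, map_zero]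
  set η := eta x0 R with hη
  set v := (η * η) * (g * g) + C c * (h * h) with hv
  have e1 : ∀ i, pderiv i η = C (-2) * (X i - C (x0 i)) := by
    intro i
    rw [hη, eta, map_sub, pderiv_C, pd_qd, zero_sub, ← neg_mul, C_neg]
  have e2 : ∀ i, pderiv i (pderiv i η) = C (-2) := by
    intro i
    rw [e1, pderiv_mul, map_sub, pd_X, pderiv_C, pderiv_C]; simp
  have hlap : ∀ z, ev (lapP v) z = ∑ i, (2 * (ev η z * ev (pderiv i g) z
      + 2 * (-2 * (z i - x0 i)) * ev g z) ^ 2 - 24 * (z i - x0 i) ^ 2 * ev g z ^ 2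
      - 4 * ev η z * ev g z ^ 2 + 2 * ev η z ^ 2 * ev g z * ev (pderiv i (pderiv i g)) z
      + c * (2 * ev (pderiv i h) z ^ 2 + 2 * ev h z * ev (pderiv i (pderiv i h)) z)) := by
    intro z
    rw [lapP, ev_sum]
    refine Finset.sum_congr rfl fun i _ => ?_
    simp only [hv, pderiv_mul, map_add, e2, pderiv_C, ev_add, ev_mul, ev_C, map_zero,
      ev_zero]
    simp only [e1, ev_mul, ev_C, ev_sub, ev_X]
    ring
  have hgl : ∀ z, ∑ i, ev (pderiv i (pderiv i g)) z = 0 := by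
    intro z
    rw [← ev_sum]; change ev (lapP g) z = 0; rw [hgh, ev_zero]
  have hhl : ∀ z, ∑ i, ev (pderiv i (pderiv i h)) z = 0 := by
    intro z
    rw [← ev_sum]; change ev (lapP h) z = 0; rw [hh, ev_zero]
  have hpos : ∀ z ∈ ball x0 R, 0 ≤ ev (lapP v) z := by
    intro z hz
    rw [mem_ball, dist_eq_norm] at hz
    have hηz := ev_eta x0 R z
    rw [← hη] at hηz
    have hn : ∑ i, (z i - x0 i) ^ 2 = ‖z - x0‖ ^ 2 := by
      rw [EuclideanSpace.norm_sq_eq]; simp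
    have hsplit : ev (lapP v) z = ∑ i, 2 * (ev η z * ev (pderiv i g) z
        + 2 * (-2 * (z i - x0 i)) * ev g z) ^ 2 - 24 * (∑ i, (z i - x0 i) ^ 2) * ev g z ^ 2
        - m * (4 * ev η z * ev g z ^ 2)
        + 2 * ev η z ^ 2 * ev g z * ∑ i, ev (pderiv i (pderiv i g)) z
        + c * (2 * ∑ i, ev (pderiv i h) z ^ 2
          + 2 * ev h z * ∑ i, ev (pderiv i (pderiv i h)) z) := by
      rw [hlap]
      simp only [Finset.sum_add_distrib, Finset.sum_sub_distrib, ← Finset.mul_sum,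
        ← Finset.sum_mul, Finset.sum_const, Finset.card_univ, Fintype.card_fin, nsmul_eq_mul]
      ring
    rw [hsplit, hgl, hhl, hn]
    have h1 : 0 ≤ ∑ i, 2 * (ev η z * ev (pderiv i g) z
        + 2 * (-2 * (z i - x0 i)) * ev g z) ^ 2 := Finset.sum_nonneg fun i _ => by positivity
    have h2 : ev g z ^ 2 ≤ ∑ i, ev (pderiv i h) z ^ 2 :=
      Finset.single_le_sum (f := fun i => ev (pderiv i h) z ^ 2) (fun i _ => by positivity)
        (Finset.mem_univ k)
    have h3 : ‖z - x0‖ ^ 2 ≤ R ^ 2 := by gcongr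
    have h4 : ev η z ≤ R ^ 2 := by rw [hηz]; nlinarith [sq_nonneg ‖z - x0‖]
    have h5 : c * ev g z ^ 2 ≤ c * ∑ i, ev (pderiv i h) z ^ 2 := by gcongr
    have h6 : ‖z - x0‖ ^ 2 * ev g z ^ 2 ≤ R ^ 2 * ev g z ^ 2 := by gcongr
    have h7 : (m : ℝ) * (ev η z * ev g z ^ 2) ≤ m * (R ^ 2 * ev g z ^ 2) := by gcongr
    rw [hc] at h5 ⊢
    nlinarith
  have hsph : ∀ z ∈ sphere x0 R, ev v z ≤ c * M ^ 2 := by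
    intro z hz
    have hbz := hb z (sphere_subset_closedBall hz)
    rw [mem_sphere, dist_eq_norm] at hz
    have hηz := ev_eta x0 R z
    rw [← hη, hz, sub_self] at hηz
    simp only [hv, ev_add, ev_mul, ev_C, hηz]
    have : ev h z * ev h z ≤ M ^ 2 := by
      rw [← sq, ← sq_abs]; gcongr
    nlinarith
  have hfin := poly_max hm x0 v hpos hsph y (closedBall_subset_closedBall (by linarith) hy)
  simp only [hv, ev_add, ev_mul, ev_C] at hfin
  rw [mem_closedBall, dist_eq_norm] at hy
  have hηy := ev_eta x0 R y
  rw [← hη] at hηy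
  have h1 : 3 * R ^ 2 / 4 ≤ ev η y := by
    rw [hηy]; nlinarith [norm_nonneg (y - x0)]
  have h2 : (ev η y * ev g y) ^ 2 ≤ (Real.sqrt c * M) ^ 2 := by
    rw [mul_pow (Real.sqrt c), Real.sq_sqrt hc0.le]
    nlinarith [mul_nonneg hc0.le (mul_self_nonneg (ev h y))]
  have h3 := abs_le_of_sq_le_sq h2 (by positivity)
  rw [div_mul_eq_mul_div, le_div_iff₀ (by positivity)]
  calc |ev g y| * (3 * R ^ 2 / 4) ≤ |ev g y| * ev η y := by gcongr
    _ ≤ |ev g y| * |ev η y| := by gcongr; exact le_abs_self _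
    _ = |ev η y * ev g y| := by rw [abs_mul, mul_comm]
    _ ≤ _ := h3

lemma stone {m : ℕ} {K : Set (EE m)} (hK : IsCompact K) {u : EE m → ℝ} (hu : ContinuousOn u K)
    {ε : ℝ} (hε : 0 < ε) : ∃ p : MvPolynomial (Fin m) ℝ, ∀ y ∈ K, |ev p y - u y| < ε := by
  have : CompactSpace K := isCompact_iff_compactSpace.1 hK
  let Φ : MvPolynomial (Fin m) ℝ →ₐ[ℝ] C(K, ℝ) :=
    MvPolynomial.aeval (fun i => (⟨fun y : K => (y : EE m) i, by fun_prop⟩ : C(K, ℝ)))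
  have hΦ : ∀ p (y : K), Φ p y = ev p y := by
    intro p y
    induction p using MvPolynomial.induction_on with
    | C a => simp [Φ, ev]
    | add p q hp hq => simp [hp, hq]
    | mul_X p i hp => rw [map_mul, ContinuousMap.mul_apply, hp]; simp [Φ]
  have hsep : Φ.range.SeparatesPoints := by
    intro a b hab
    have : ∃ i, (a : EE m) i ≠ (b : EE m) i := by
      by_contra! hcon
      exact hab (Subtype.ext (PiLp.ext hcon))
    obtain ⟨i, hi⟩ := this
    exact ⟨_, ⟨Φ (X i), ⟨X i, rfl⟩, rfl⟩, by simpa [hΦ] using hi⟩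
  obtain ⟨⟨g, p, hp⟩, hg⟩ :=
    ContinuousMap.exists_mem_subalgebra_near_continuous_of_separatesPoints Φ.range hsep
      (K.domRestrict u) hu.domRestrict ε hε
  refine ⟨p, fun y hy => ?_⟩
  have := hg ⟨y, hy⟩
  have hp' : Φ p = g := hp
  rw [← hΦ p ⟨y, hy⟩, hp']
  exact this

lemma ev_hasFDerivAt {m : ℕ} (p : MvPolynomial (Fin m) ℝ) (x : EE m) :
    HasFDerivAt (ev p) (∑ i, ev (pderiv i p) x • (EuclideanSpace.proj i : EE m →L[ℝ] ℝ)) x := by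
  induction p using MvPolynomial.induction_on with
  | C a =>
    simp only [funext (ev_C a), pderiv_C, ev_zero, zero_smul, Finset.sum_const_zero]
    exact hasFDerivAt_const _ _
  | add p q hp hq =>
    simp only [funext (ev_add p q), map_add, ev_add, add_smul, Finset.sum_add_distrib]
    exact hp.add hq
  | mul_X p k hp =>
    simp only [funext (ev_mul p (X k)), ev_X]
    have hk : HasFDerivAt (fun y : EE m => y k) (EuclideanSpace.proj k : EE m →L[ℝ] ℝ) x :=
      (EuclideanSpace.proj k : EE m →L[ℝ] ℝ).hasFDerivAt
    refine (hp.mul hk).congr_fderiv ?_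
    simp only [pderiv_mul, pd_X, ev_add, ev_mul, ev_X, ev_C, add_smul, Finset.sum_add_distrib]
    rw [add_comm, Finset.smul_sum]
    congr 1
    · exact Finset.sum_congr rfl fun i _ => by rw [smul_smul, mul_comm]
    · rw [Finset.sum_eq_single k] <;> simp +contextual

/-- sequence of harmonic polynomials converging uniformly on a closed ball -/
def GS {m : ℕ} (h : ℕ → MvPolynomial (Fin m) ℝ) (f : EE m → ℝ) (x0 : EE m) (R : ℝ) : Prop :=
  (∀ n, lapP (h n) = 0) ∧ TendstoUniformlyOn (fun n => ev (h n)) f atTop (closedBall x0 R)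

lemma GS_deriv {m : ℕ} (hm : 2 ≤ m) {h : ℕ → MvPolynomial (Fin m) ℝ} {f : EE m → ℝ} {x0 : EE m}
    {R : ℝ} (hR : 0 < R) (hG : GS h f x0 R) :
    ∃ g : Fin m → EE m → ℝ, (∀ k, GS (fun n => pderiv k (h n)) (g k) x0 (R / 2)) ∧
      ∀ x ∈ ball x0 (R / 2),
        HasFDerivAt f (∑ k, g k x • (EuclideanSpace.proj k : EE m →L[ℝ] ℝ)) x := by
  obtain ⟨hl, hu⟩ := hG
  obtain ⟨K, hK, hB⟩ := bernstein_grad hm x0 hR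
  have hc := hu.uniformCauchySeqOn
  have hc' : ∀ k, UniformCauchySeqOn (fun n => ev (pderiv k (h n))) atTop
      (closedBall x0 (R / 2)) := by
    intro k
    rw [Metric.uniformCauchySeqOn_iff] at hc ⊢
    intro ε hε
    obtain ⟨N, hN⟩ := hc (ε / (2 * K)) (by positivity)
    refine ⟨N, fun a ha b hb y hy => ?_⟩
    have := hB (h a - h b) (by rw [lapP_sub, hl, hl, sub_zero]) (ε / (2 * K)) (by positivity)
      (fun z hz => by
        have := hN a ha b hb z hz
        rw [Real.dist_eq] at this
        rw [ev_sub]; exact this.le) k y hy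
    rw [map_sub, ev_sub] at this
    rw [Real.dist_eq]
    refine this.trans_lt ?_
    have : K * (ε / (2 * K)) = ε / 2 := by field_simp
    linarith
  let g : Fin m → EE m → ℝ := fun k x => limUnder atTop (fun n => ev (pderiv k (h n)) x)
  have hg : ∀ k, TendstoUniformlyOn (fun n => ev (pderiv k (h n))) (g k) atTop
      (closedBall x0 (R / 2)) := by
    intro k
    refine (hc' k).tendstoUniformlyOn_of_tendsto fun x hx => ?_
    exact ((hc' k).cauchySeq hx).tendsto_limUnder
  refine ⟨g, fun k => ⟨fun n => by rw [lapP_pd, hl, map_zero], hg k⟩, fun x hx => ?_⟩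
  refine hasFDerivAt_of_tendstoUniformlyOn (l := atTop) (f := fun n => ev (h n))
    (f' := fun n x => ∑ k, ev (pderiv k (h n)) x • (EuclideanSpace.proj k : EE m →L[ℝ] ℝ))
    (g' := fun x => ∑ k, g k x • (EuclideanSpace.proj k : EE m →L[ℝ] ℝ))
    isOpen_ball ?_ (fun n y _ => ev_hasFDerivAt (h n) y) ?_ hx
  · rw [Metric.tendstoUniformlyOn_iff]
    intro ε hε
    set S : ℝ := ∑ k : Fin m, ‖(EuclideanSpace.proj k : EE m →L[ℝ] ℝ)‖ with hS
    have hS0 : 0 ≤ S := by positivity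
    have hall : ∀ᶠ n in atTop, ∀ k, ∀ y ∈ closedBall x0 (R / 2),
        dist (g k y) (ev (pderiv k (h n)) y) < ε / (S + 1) := by
      rw [eventually_all]
      intro k
      exact Metric.tendstoUniformlyOn_iff.1 (hg k) _ (by positivity)
    filter_upwards [hall] with n hn y hy
    rw [dist_eq_norm, ← Finset.sum_sub_distrib]
    calc _ ≤ ∑ k : Fin m, ε / (S + 1) * ‖(EuclideanSpace.proj k : EE m →L[ℝ] ℝ)‖ := by
          refine norm_sum_le_of_le _ fun k _ => ?_
          rw [← sub_smul, norm_smul, ← dist_eq_norm]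
          have := hn k y (ball_subset_closedBall hy)
          gcongr
      _ = ε / (S + 1) * S := by rw [← Finset.mul_sum]
      _ < ε := by
          rw [div_mul_eq_mul_div, div_lt_iff₀ (by positivity)]
          nlinarith
  · intro y hy
    exact hu.tendsto_at (closedBall_subset_closedBall (by linarith) (ball_subset_closedBall hy))

lemma GS_cont {m : ℕ} {h : ℕ → MvPolynomial (Fin m) ℝ} {f : EE m → ℝ} {x0 : EE m}
    {R : ℝ} (hG : GS h f x0 R) : ContinuousOn f (closedBall x0 R) :=
  hG.2.continuousOn (Frequently.of_forall fun n => (ev_cont (h n)).continuousOn)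

lemma GS_contDiff {m : ℕ} (hm : 2 ≤ m) (n : ℕ) : ∀ {h : ℕ → MvPolynomial (Fin m) ℝ}
    {f : EE m → ℝ} {x0 : EE m} {R : ℝ}, 0 < R → GS h f x0 R → ContDiffAt ℝ n f x0 := by
  suffices H : ∀ (h : ℕ → MvPolynomial (Fin m) ℝ) (f : EE m → ℝ) (x0 : EE m) (R : ℝ), 0 < R →
      GS h f x0 R → ContDiffOn ℝ n f (ball x0 (R / 2 ^ n)) by
    intro h f x0 R hR hG
    exact (H h f x0 R hR hG).contDiffAt (ball_mem_nhds _ (by positivity))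
  induction n with
  | zero =>
    intro h f x0 R hR hG
    simpa using (GS_cont hG).mono ball_subset_closedBall
  | succ n ih =>
    intro h f x0 R hR hG
    obtain ⟨g, hg, hd⟩ := GS_deriv hm hR hG
    push_cast
    rw [contDiffOn_succ_iff_hasFDerivWithinAt_of_uniqueDiffOn isOpen_ball.uniqueDiffOn]
    refine ⟨by simp, _, ?_, fun x hx => (hd x (ball_subset_ball ?_ hx)).hasFDerivWithinAt⟩
    · refine ContDiffOn.sum fun k _ => ?_
      have := ih _ _ x0 (R / 2) (by positivity) (hg k)
      rw [div_div, ← pow_succ'] at this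
      exact this.smul contDiffOn_const
    · have : (2 : ℝ) ≤ 2 ^ (n + 1) := by
        rw [pow_succ]; nlinarith [one_le_pow₀ (M₀ := ℝ) (a := 2) (n := n) (by norm_num)]
      gcongr

lemma GS_lap {m : ℕ} (hm : 2 ≤ m) {h : ℕ → MvPolynomial (Fin m) ℝ}
    {f : EE m → ℝ} {x0 : EE m} {R : ℝ} (hR : 0 < R) (hG : GS h f x0 R) : lap f x0 = 0 := by
  obtain ⟨g, hg, hd⟩ := GS_deriv hm hR hG
  have hR2 : 0 < R / 2 := by positivity
  choose g2 hg2 hd2 using fun k => GS_deriv hm hR2 (hg k)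
  have happ : ∀ (a : Fin m → ℝ) (i : Fin m),
      (∑ k, a k • (EuclideanSpace.proj k : EE m →L[ℝ] ℝ)) (EuclideanSpace.single i 1) = a i := by
    intro a i
    simp
  have h1 : ∀ i, fderiv ℝ (fun y => fderiv ℝ f y (EuclideanSpace.single i 1)) x0
      (EuclideanSpace.single i 1) = g2 i i x0 := by
    intro i
    have : (fun y => fderiv ℝ f y (EuclideanSpace.single i 1)) =ᶠ[𝓝 x0] g i := by
      filter_upwards [ball_mem_nhds x0 hR2] with y hy
      rw [(hd y hy).fderiv, happ]
    rw [this.fderiv_eq, (hd2 i x0 (mem_ball_self (by positivity))).fderiv, happ]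
  unfold lap
  simp only [h1]
  have ht : Tendsto (fun n => ∑ i, ev (pderiv i (pderiv i (h n))) x0) atTop
      (𝓝 (∑ i, g2 i i x0)) :=
    tendsto_finsetSum _ fun i _ => (hg2 i i).2.tendsto_at (mem_closedBall_self (by positivity))
  refine tendsto_nhds_unique ht ?_
  have : (fun n => ∑ i, ev (pderiv i (pderiv i (h n))) x0) = fun _ => 0 := by
    ext n
    rw [← ev_sum]; change ev (lapP (h n)) x0 = 0; rw [hG.1, ev_zero]
  rw [this]
  exact tendsto_const_nhds

theorem blaschke {m : ℕ} (hm : 2 ≤ m) (D : Set (EuclideanSpace ℝ (Fin m)))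
    (hD : IsOpen D) (hDc : IsConnected D) (u : EuclideanSpace ℝ (Fin m) → ℝ)
    (hcont : ContinuousOn u D)
    (hlim : ∀ x ∈ D,
      Filter.Tendsto (fun r : ℝ => (r ^ 2)⁻¹ * (sphAvg u x r - u x))
        (nhdsWithin 0 (Set.Ioi 0)) (nhds 0)) :
    IsHarmonicOn u D := by
  have key : ∀ x0 ∈ D, ∃ R : ℝ, 0 < R ∧ ∃ h, GS h u x0 R := by
    intro x0 hx0
    obtain ⟨R, hR, hsub⟩ := Metric.nhds_basis_closedBall.mem_iff.1 (hD.mem_nhds hx0)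
    refine ⟨R, hR, ?_⟩
    have happrox : ∀ ε : ℝ, 0 < ε → ∃ h : MvPolynomial (Fin m) ℝ, lapP h = 0 ∧
        ∀ y ∈ closedBall x0 R, |ev h y - u y| ≤ ε := by
      intro ε hε
      obtain ⟨p, hp⟩ := stone (isCompact_sphere x0 R)
        (hcont.mono (sphere_subset_closedBall.trans hsub)) hε
      obtain ⟨h, hh, hs⟩ := dirichlet hm x0 hR p
      refine ⟨h, hh, ?_⟩
      have hGL : ∀ x ∈ ball x0 R, GLap u x 0 := fun x hx => hlim x (hsub (ball_subset_closedBall hx))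
      have hGh : ∀ x, GLap (ev h) x 0 := fun x => by
        have := GLap_poly hm h x
        rwa [hh, ev_zero, zero_div] at this
      have huc : ContinuousOn u (closedBall x0 R) := hcont.mono hsub
      have hhc : ContinuousOn (ev h) (closedBall x0 R) := (ev_cont h).continuousOn
      have hnh : ∀ x ∈ ball x0 R, closedBall x0 R ∈ 𝓝 x := fun x hx =>
        Filter.mem_of_superset (isOpen_ball.mem_nhds hx) ball_subset_closedBall
      have h1 : ∀ y ∈ closedBall x0 R, ev h y + (-1) * u y ≤ ε := by
        refine max_principle hm (hhc.add (continuousOn_const.mul huc)) (fun x hx => ⟨_, ?_,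
          GLap_add hm (hnh x hx) hhc (continuousOn_const.mul huc) (hGh x)
            (GLap_const_mul (-1) (hGL x hx))⟩) (fun y hy => ?_)
        · simp
        · change ev h y + (-1) * u y ≤ ε
          rw [hs y hy]
          have := (abs_lt.1 (hp y hy)).2
          linarith
      have h2 : ∀ y ∈ closedBall x0 R, u y + (-1) * ev h y ≤ ε := by
        refine max_principle hm (huc.add (continuousOn_const.mul hhc)) (fun x hx => ⟨_, ?_,
          GLap_add hm (hnh x hx) huc (continuousOn_const.mul hhc) (hGL x hx)
            (GLap_const_mul (-1) (hGh x))⟩) (fun y hy => ?_)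
        · simp
        · change u y + (-1) * ev h y ≤ ε
          rw [hs y hy]
          have := (abs_lt.1 (hp y hy)).1
          linarith
      intro y hy
      have := h1 y hy
      have := h2 y hy
      rw [abs_le]
      constructor <;> linarith
    choose h hh hb using fun n : ℕ => happrox (1 / ((n : ℝ) + 1)) (by positivity)
    refine ⟨h, hh, ?_⟩
    rw [Metric.tendstoUniformlyOn_iff]
    intro ε hε
    obtain ⟨N, hN⟩ := exists_nat_one_div_lt hε
    filter_upwards [Filter.eventually_ge_atTop N] with n hn y hy
    rw [dist_comm, Real.dist_eq]
    refine (hb n y hy).trans_lt (lt_of_le_of_lt ?_ hN)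
    have : (N : ℝ) ≤ n := by exact_mod_cast hn
    gcongr
  refine ⟨fun x hx => ?_, fun x hx => ?_⟩
  · obtain ⟨R, hR, h, hG⟩ := key x hx
    exact_mod_cast (GS_contDiff hm 2 hR hG).contDiffWithinAt
  · obtain ⟨R, hR, h, hG⟩ := key x hx
    exact GS_lap hm hR hG
end
end

section
/- Beckenbach–Reade theorem: if u is continuous on a bounded domain D ⊂ ℝ^m and for every x ∈ D and every r with B_r(x) ⊂ D the spherical mean L(u,x,r) equals the volume mean A(u,x,r), then u is harmonic in D. -/
open MeasureTheory Metric Real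

noncomputable section

/-- Averaging a bounded continuous function over the orthogonal group. -/
lemma exists_radial {E : Type*} [NormedAddCommGroup E] [InnerProductSpace ℝ E]
    [FiniteDimensional ℝ E] [MeasurableSpace E] [BorelSpace E] (f : E → ℝ) (hf : Continuous f) (M : ℝ)
    (hM : ∀ y, |f y| ≤ M) :
    ∃ g : E → ℝ, Continuous g ∧ (∀ y z, ‖y‖ = ‖z‖ → g y = g z) ∧
      g 0 = f 0 ∧ ∀ (μ : Measure (E)) [SFinite μ],
        (∀ e : E ≃ₗᵢ[ℝ] E,
          MeasurePreserving e μ μ) →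
        ∀ w : E → ℝ, (∀ y z, ‖y‖ = ‖z‖ → w y = w z) →
          Integrable w μ → ∫ y, w y * f y ∂μ = ∫ y, w y * g y ∂μ := by
  have : ProperSpace E := FiniteDimensional.proper ℝ E
  have : CompleteSpace E := FiniteDimensional.complete ℝ E
  let G := unitary (E →L[ℝ] E)
  let : MeasurableSpace G := borel G
  have : BorelSpace G := ⟨rfl⟩
  have : CompactSpace G := by
    have hc : IsCompact ((unitary (E →L[ℝ] E) : Set (E →L[ℝ] E))) := by
      have : ProperSpace (E →L[ℝ] E) := FiniteDimensional.proper ℝ _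
      refine Metric.isCompact_of_isClosed_isBounded isClosed_unitary ?_
      refine (Metric.isBounded_closedBall (x := (0 : E →L[ℝ] E)) (r := 1)).subset ?_
      intro a ha
      rw [mem_closedBall_zero_iff]
      refine ContinuousLinearMap.opNorm_le_bound _ zero_le_one fun x => ?_
      have := (Unitary.linearIsometryEquiv (⟨a, ha⟩ : G)).norm_map x
      rw [one_mul, ← this]
      exact le_of_eq rfl
    exact isCompact_iff_compactSpace.mp hc
  let ρ : Measure G := Measure.haarMeasure ⊤
  have : IsProbabilityMeasure ρ := ⟨by
    have := Measure.haarMeasure_self (K₀ := (⊤ : TopologicalSpace.PositiveCompacts G))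
    simpa using this⟩
  have hact : Continuous (fun p : E × G => f (((p.2⁻¹ : G) : E →L[ℝ] E) p.1)) := by
    refine hf.comp ?_
    have h1 : Continuous (fun p : E × G => ((p.2⁻¹ : G) : E →L[ℝ] E)) :=
      continuous_subtype_val.comp (continuous_inv.comp continuous_snd)
    exact h1.clm_apply continuous_fst
  refine ⟨fun y => ∫ R : G, f (((R⁻¹ : G) : E →L[ℝ] E) y) ∂ρ, ?_, ?_, ?_, ?_⟩
  · have := continuous_parametric_integral_of_continuous (μ := ρ)
      (f := fun (y : E) (R : G) => f (((R⁻¹ : G) : E →L[ℝ] E) y)) hact isCompact_univ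
    simpa using this
  · intro y z hyz
    let e : E ≃ₗᵢ[ℝ] E := (ℝ ∙ (z - y))ᗮ.reflection
    have he : e z = y := Submodule.reflection_sub hyz.symm
    let R0 : G := Unitary.linearIsometryEquiv.symm e
    have hR0 : (R0 : E →L[ℝ] E) z = y := he
    have := integral_mul_left_eq_self (μ := ρ)
      (fun R : G => f (((R⁻¹ : G) : E →L[ℝ] E) y)) R0
    simp only
    rw [← this]
    congr 1
    ext R
    rw [mul_inv_rev]
    congr 1
    rw [← hR0]
    have h2 : ((R⁻¹ * R0⁻¹ : G) : E →L[ℝ] E) ((R0 : E →L[ℝ] E) z)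
        = ((R⁻¹ * R0⁻¹ * R0 : G) : E →L[ℝ] E) z := rfl
    rw [h2, inv_mul_cancel_right]
  · simp
  · intro μ _ hμ w hw hwi
    have hint : Integrable (Function.uncurry fun (y : E) (R : G) =>
        w y * f (((R⁻¹ : G) : E →L[ℝ] E) y)) (μ.prod ρ) := by
      have h1 : Integrable (fun p : E × G => w p.1) (μ.prod ρ) := hwi.comp_fst ρ
      refine Integrable.mul_bdd (c := M) h1 ?_ ?_
      · exact hact.aestronglyMeasurable
      · exact Filter.Eventually.of_forall fun p => hM _
    have hsw := integral_integral_swap hint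
    have h3 : ∀ R : G, ∫ y, w y * f (((R⁻¹ : G) : E →L[ℝ] E) y) ∂μ = ∫ y, w y * f y ∂μ := by
      intro R
      let e : E ≃ₗᵢ[ℝ] E := Unitary.linearIsometryEquiv (R⁻¹)
      have := (hμ e).integral_comp e.toHomeomorph.measurableEmbedding (fun y => w y * f y)
      rw [← this]
      congr 1
      ext y
      rw [hw (e y) y (e.norm_map y)]
      rfl
    simp only [h3, integral_const, integral_const_mul] at hsw
    simp at hsw
    exact hsw.symm

lemma max_principle_s10 {m : ℕ} (g : EuclideanSpace ℝ (Fin m) → ℝ)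
    (hg : Continuous g) (R : ℝ)
    (hmean : ∀ z : EuclideanSpace ℝ (Fin m), 0 < ‖z‖ → ‖z‖ ≤ R →
      ∫ y in ball (0 : EuclideanSpace ℝ (Fin m)) ‖z‖, (g z - g y) = 0)
    (z : EuclideanSpace ℝ (Fin m)) (hz : ‖z‖ ≤ R) : g z ≤ g 0 := by
  have hR : 0 ≤ R := (norm_nonneg z).trans hz
  have hcomp : IsCompact (closedBall (0 : EuclideanSpace ℝ (Fin m)) R) := isCompact_closedBall 0 R
  have hne : (closedBall (0 : EuclideanSpace ℝ (Fin m)) R).Nonempty := ⟨0, by simp [hR]⟩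
  obtain ⟨p, hp, hpm⟩ := hcomp.exists_isMaxOn hne hg.continuousOn
  have hS : IsCompact (closedBall (0 : EuclideanSpace ℝ (Fin m)) R ∩ g ⁻¹' {g p}) :=
    hcomp.inter_right ((isClosed_singleton).preimage hg)
  obtain ⟨q, hq, hqm⟩ := hS.exists_isMinOn ⟨p, hp, rfl⟩ continuous_norm.continuousOn
  have hgq : g q = g p := hq.2
  have hqR : ‖q‖ ≤ R := by simpa using hq.1
  have hzp : g z ≤ g p := hpm (by simpa using hz)
  rcases (norm_nonneg q).eq_or_lt with h0 | h0
  · have : q = 0 := norm_eq_zero.mp h0.symm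
    rw [this] at hgq
    linarith
  · exfalso
    have hlt : ∀ y ∈ ball (0 : EuclideanSpace ℝ (Fin m)) ‖q‖, 0 < g q - g y := by
      intro y hy
      have hy' : ‖y‖ < ‖q‖ := by simpa using hy
      have hyR : y ∈ closedBall (0 : EuclideanSpace ℝ (Fin m)) R := by
        simpa using hy'.le.trans hqR
      have h1 : g y ≤ g p := hpm hyR
      rcases h1.eq_or_lt with h2 | h2
      · exact absurd (hqm (show y ∈ _ from ⟨hyR, h2⟩)) (not_le.mpr hy')
      · linarith
    have hpos : 0 < ∫ y in ball (0 : EuclideanSpace ℝ (Fin m)) ‖q‖, (g q - g y) := by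
      rw [setIntegral_pos_iff_support_of_nonneg_ae]
      · have : Function.support (fun y => g q - g y) ∩ ball (0 : EuclideanSpace ℝ (Fin m)) ‖q‖
            = ball 0 ‖q‖ := by
          refine Set.inter_eq_right.mpr fun y hy => (hlt y hy).ne'
        rw [this]
        exact measure_ball_pos _ _ h0
      · exact (ae_restrict_iff' measurableSet_ball).mpr
          (Filter.Eventually.of_forall fun y hy => (hlt y hy).le)
      · exact ((continuous_const.sub hg).continuousOn.integrableOn_compact
          (isCompact_closedBall 0 ‖q‖)).mono_set ball_subset_closedBall
    rw [hmean q h0 hqR] at hpos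
    exact lt_irrefl _ hpos

open Pointwise in
lemma sphere_measure {m : ℕ} (hm : 2 ≤ m) (x : EuclideanSpace ℝ (Fin m)) (r : ℝ) (hr : 0 < r) :
    μH[(m : ℝ) - 1] (sphere x r) =
      ENNReal.ofReal (r ^ ((m : ℝ) - 1)) *
        μH[(m : ℝ) - 1] (sphere (0 : EuclideanSpace ℝ (Fin m)) 1) := by
  have hd : (0 : ℝ) ≤ (m : ℝ) - 1 := by
    have : (2 : ℝ) ≤ m := by exact_mod_cast hm
    linarith
  have h1 : sphere x r = (IsometryEquiv.addLeft x) '' (r • sphere (0 : EuclideanSpace ℝ (Fin m)) 1) := by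
    rw [smul_sphere' hr.ne', smul_zero, Real.norm_of_nonneg hr.le, mul_one]
    ext y
    simp [mem_sphere, dist_eq_norm, sub_eq_neg_add]
  rw [h1, IsometryEquiv.hausdorffMeasure_image, Measure.hausdorffMeasure_smul₀ hd hr.ne',
    ENNReal.smul_def, smul_eq_mul]
  congr 1
  rw [ENNReal.ofReal]
  congr 1
  apply NNReal.coe_injective
  rw [NNReal.coe_rpow, Real.coe_toNNReal _ (by positivity)]
  simp [abs_of_pos hr]

lemma restrict_preserving {m : ℕ} {μ : Measure (EuclideanSpace ℝ (Fin m))}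
    (e : EuclideanSpace ℝ (Fin m) ≃ₗᵢ[ℝ] EuclideanSpace ℝ (Fin m))
    (he : MeasurePreserving e μ μ) {s : Set (EuclideanSpace ℝ (Fin m))} (hs : MeasurableSet s)
    (hes : e ⁻¹' s = s) : MeasurePreserving e (μ.restrict s) (μ.restrict s) := by
  have := he.restrict_preimage hs
  rwa [hes] at this

lemma mean_value {m : ℕ} (hm : 2 ≤ m)
    (hc0 : μH[(m : ℝ) - 1] (sphere (0 : EuclideanSpace ℝ (Fin m)) 1) ≠ 0)
    (hc1 : μH[(m : ℝ) - 1] (sphere (0 : EuclideanSpace ℝ (Fin m)) 1) ≠ ⊤)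
    (u : EuclideanSpace ℝ (Fin m) → ℝ) (x : EuclideanSpace ℝ (Fin m)) (R : ℝ) (hR : 0 < R)
    (hcont : ContinuousOn u (closedBall x R))
    (heq : ∀ r, 0 < r → r ≤ R → sphAvg u x r = ballAvg u x r)
    (w : EuclideanSpace ℝ (Fin m) → ℝ) (hw : Continuous w)
    (hwr : ∀ y z, ‖y‖ = ‖z‖ → w y = w z) :
    ∫ y in ball 0 R, w y * u (x + y) = u x * ∫ y in ball 0 R, w y := by
  have hmem : ∀ y : EuclideanSpace ℝ (Fin m), ‖y‖ ≤ R → x + y ∈ closedBall x R := by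
    intro y hy
    simpa [mem_closedBall, dist_eq_norm] using hy
  -- a bounded continuous extension
  obtain ⟨f, hf, M, hM, hfu⟩ : ∃ f : EuclideanSpace ℝ (Fin m) → ℝ, Continuous f ∧
      ∃ M : ℝ, (∀ y, |f y| ≤ M) ∧ ∀ y, ‖y‖ ≤ R → f y = u (x + y) := by
    obtain ⟨M, hM⟩ := (isCompact_closedBall x R).exists_bound_of_continuousOn hcont
    obtain ⟨F, hF1, hF2⟩ := ContinuousMap.exists_restrict_eq_forall_mem_of_closed
      (⟨(closedBall x R).domRestrict u, hcont.domRestrict⟩ : C(closedBall x R, ℝ))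
      (t := Set.Icc (-M) M) (fun y => abs_le.mp (hM y y.2))
      ⟨u x, abs_le.mp (hM x (mem_closedBall_self hR.le))⟩ isClosed_closedBall
    refine ⟨fun y => F (x + y), by fun_prop, M, fun y => abs_le.mpr (hF1 _), fun y hy => ?_⟩
    exact congrArg (fun G : C(closedBall x R, ℝ) => G ⟨x + y, hmem y hy⟩) hF2
  obtain ⟨g, hg, hgr, hg0, hfg⟩ := exists_radial f hf M hM
  have hballpre : ∀ (e : EuclideanSpace ℝ (Fin m) ≃ₗᵢ[ℝ] EuclideanSpace ℝ (Fin m)) (r : ℝ),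
      e ⁻¹' (ball 0 r) = ball 0 r := by
    intro e r; ext y; simp
  have hsphpre : ∀ (e : EuclideanSpace ℝ (Fin m) ≃ₗᵢ[ℝ] EuclideanSpace ℝ (Fin m)) (r : ℝ),
      e ⁻¹' (sphere 0 r) = sphere 0 r := by
    intro e r; ext y; simp
  have hvol : ∀ (r : ℝ) (v : EuclideanSpace ℝ (Fin m) → ℝ), Continuous v →
      (∀ y z, ‖y‖ = ‖z‖ → v y = v z) →
      ∫ y in ball 0 r, v y * f y = ∫ y in ball 0 r, v y * g y := by
    intro r v hv hvr
    refine hfg (volume.restrict (ball 0 r)) (fun e => restrict_preserving e e.measurePreserving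
      measurableSet_ball (hballpre e r)) v hvr ?_
    exact (hv.continuousOn.integrableOn_compact
          (isCompact_closedBall 0 r)).mono_set ball_subset_closedBall
  have hball : ∀ r, 0 < r → r ≤ R → ballAvg u x r =
      ((volume (ball (0 : EuclideanSpace ℝ (Fin m)) r)).toReal)⁻¹ * ∫ y in ball 0 r, g y := by
    intro r hr hrR
    have h1 := hvol r (fun _ => 1) continuous_const (fun _ _ _ => rfl)
    simp only [one_mul] at h1
    rw [ballAvg, ← h1, Measure.addHaar_ball_center]
    congr 1
    have h2 := (measurePreserving_add_left volume x).setIntegral_preimage_emb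
      (measurableEmbedding_addLeft x) u (ball x r)
    rw [← h2]
    have h3 : (fun y => x + y) ⁻¹' (ball x r) = ball 0 r := by
      ext y; simp [mem_ball, dist_eq_norm]
    rw [h3]
    refine setIntegral_congr_fun measurableSet_ball fun y hy => ?_
    have : ‖y‖ < r := by simpa using hy
    exact (hfu y (this.le.trans hrR)).symm
  have hsph : ∀ z : EuclideanSpace ℝ (Fin m), 0 < ‖z‖ → ‖z‖ ≤ R → sphAvg u x ‖z‖ = g z := by
    intro z hz hzR
    set r := ‖z‖ with hr
    have hfin : ∀ x : EuclideanSpace ℝ (Fin m), μH[(m : ℝ) - 1] (sphere x r) ≠ ⊤ := by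
      intro x
      rw [sphere_measure hm x r hz]
      exact ENNReal.mul_ne_top ENNReal.ofReal_ne_top hc1
    have hpos : ∀ x : EuclideanSpace ℝ (Fin m), μH[(m : ℝ) - 1] (sphere x r) ≠ 0 := by
      intro x
      rw [sphere_measure hm x r hz]
      refine mul_ne_zero ?_ hc0
      simp only [ne_eq, ENNReal.ofReal_eq_zero, not_le]
      positivity
    have hFM : IsFiniteMeasure
        ((μH[(m : ℝ) - 1]).restrict (sphere (0 : EuclideanSpace ℝ (Fin m)) r)) :=
      ⟨by rw [Measure.restrict_apply_univ]; exact (hfin 0).lt_top⟩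
    have h1 := hfg ((μH[(m : ℝ) - 1]).restrict (sphere (0 : EuclideanSpace ℝ (Fin m)) r))
      (fun e => restrict_preserving e
        (e.toIsometryEquiv.measurePreserving_hausdorffMeasure _) isClosed_sphere.measurableSet (hsphpre e r))
      (fun _ => 1) (fun _ _ _ => rfl) (integrable_const _)
    simp only [one_mul] at h1
    have h2 := ((IsometryEquiv.addLeft x).measurePreserving_hausdorffMeasure
        ((m : ℝ) - 1)).setIntegral_preimage_emb
      (measurableEmbedding_addLeft x) u (sphere x r)
    have h3 : (IsometryEquiv.addLeft x) ⁻¹' (sphere x r) = sphere 0 r := by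
      ext y; simp [mem_sphere, dist_eq_norm]
    rw [sphAvg, ← h2, h3]
    have h4 : ∫ y in sphere 0 r, u (IsometryEquiv.addLeft x y) ∂(μH[(m : ℝ) - 1])
        = ∫ y in sphere 0 r, f y ∂(μH[(m : ℝ) - 1]) := by
      refine setIntegral_congr_fun isClosed_sphere.measurableSet fun y hy => ?_
      have : ‖y‖ = r := by simpa using hy
      exact (hfu y (this.le.trans hzR)).symm
    have h5 : ∫ y in sphere 0 r, g y ∂(μH[(m : ℝ) - 1])
        = ∫ y in sphere (0 : EuclideanSpace ℝ (Fin m)) r, g z ∂(μH[(m : ℝ) - 1]) := by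
      refine setIntegral_congr_fun isClosed_sphere.measurableSet fun y hy => ?_
      exact hgr y z (by simpa using hy)
    rw [h4, h1, h5, setIntegral_const, sphere_measure hm x r hz, ← sphere_measure hm 0 r hz,
      smul_eq_mul, ← mul_assoc, Measure.real, inv_mul_cancel₀, one_mul]
    exact (ENNReal.toReal_pos (hpos 0) (hfin 0)).ne'
  have hgi : ∀ r, IntegrableOn g (ball 0 r) := fun r =>
    (hg.continuousOn.integrableOn_compact
          (isCompact_closedBall 0 r)).mono_set ball_subset_closedBall
  have hfinb : ∀ r, volume (ball (0 : EuclideanSpace ℝ (Fin m)) r) ≠ ⊤ := fun r =>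
    measure_ball_lt_top.ne
  have hmean : ∀ z : EuclideanSpace ℝ (Fin m), 0 < ‖z‖ → ‖z‖ ≤ R →
      ∫ y in ball (0 : EuclideanSpace ℝ (Fin m)) ‖z‖, (g z - g y) = 0 := by
    intro z hz hzR
    have h1 := heq ‖z‖ hz hzR
    rw [hsph z hz hzR, hball _ hz hzR] at h1
    have hFM : IsFiniteMeasure (volume.restrict (ball (0 : EuclideanSpace ℝ (Fin m)) ‖z‖)) :=
      ⟨by rw [Measure.restrict_apply_univ]; exact (hfinb _).lt_top⟩
    rw [integral_sub (integrable_const _) (hgi _), setIntegral_const, smul_eq_mul,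
      Measure.real, h1, ← mul_assoc, mul_inv_cancel₀, one_mul, sub_self]
    exact (ENNReal.toReal_pos (measure_ball_pos _ _ hz).ne' (hfinb _)).ne'
  have hle : ∀ z, ‖z‖ ≤ R → g z ≤ g 0 := max_principle_s10 g hg R hmean
  have hge : ∀ z, ‖z‖ ≤ R → -g z ≤ -g 0 := by
    refine max_principle_s10 (fun z => -g z) hg.neg R ?_
    intro z hz hzR
    have := hmean z hz hzR
    rw [← neg_eq_zero, ← integral_neg, ← this]
    congr 1
    ext y
    ring
  have hconst : ∀ z, ‖z‖ ≤ R → g z = u x := by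
    intro z hz
    have h0 : f 0 = u x := by simpa using hfu 0 (by simpa using hR.le)
    linarith [hle z hz, hge z hz]
  have h1 : ∫ y in ball 0 R, w y * u (x + y) = ∫ y in ball 0 R, w y * f y := by
    refine setIntegral_congr_fun measurableSet_ball fun y hy => ?_
    have : ‖y‖ < R := by simpa using hy
    simp only [hfu y this.le]
  rw [h1, hvol R w hw hwr, ← integral_const_mul]
  refine setIntegral_congr_fun measurableSet_ball fun y hy => ?_
  have : ‖y‖ < R := by simpa using hy
  simp only [hconst y this.le]
  ring

lemma contDiffAt_of_mean {m : ℕ} (D : Set (EuclideanSpace ℝ (Fin m))) (hD : IsOpen D)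
    (u : EuclideanSpace ℝ (Fin m) → ℝ) (hcont : ContinuousOn u D)
    (hmv : ∀ (x : EuclideanSpace ℝ (Fin m)) (R : ℝ), 0 < R → closedBall x R ⊆ D →
      ∀ w : EuclideanSpace ℝ (Fin m) → ℝ, Continuous w → (∀ y z, ‖y‖ = ‖z‖ → w y = w z) →
      ∫ y in ball 0 R, w y * u (x + y) = u x * ∫ y in ball 0 R, w y)
    (x₀ : EuclideanSpace ℝ (Fin m)) (hx₀ : x₀ ∈ D) : ContDiffAt ℝ 2 u x₀ := by
  obtain ⟨ε, hε, hεD⟩ := Metric.nhds_basis_closedBall.mem_iff.mp (hD.mem_nhds hx₀)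
  set R := ε / 2 with hR
  have hRpos : 0 < R := by positivity
  let φ : EuclideanSpace ℝ (Fin m) → ℝ := fun y => expNegInvGlue (R ^ 2 - ‖y‖ ^ 2)
  have hφs : ContDiff ℝ 2 φ := by
    have h1 : ContDiff ℝ 2 (fun y : EuclideanSpace ℝ (Fin m) => R ^ 2 - ‖y‖ ^ 2) :=
      contDiff_const.sub (contDiff_norm_sq ℝ)
    exact (expNegInvGlue.contDiff (n := 2)).comp h1
  have hφ0 : ∀ y, y ∉ ball (0 : EuclideanSpace ℝ (Fin m)) R → φ y = 0 := by
    intro y hy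
    have : R ≤ ‖y‖ := by simpa using hy
    apply expNegInvGlue.zero_of_nonpos
    nlinarith
  have hφc : HasCompactSupport φ :=
    HasCompactSupport.intro (isCompact_closedBall 0 R) fun y hy =>
      hφ0 y fun h => hy (ball_subset_closedBall h)
  have hφr : ∀ y z, ‖y‖ = ‖z‖ → φ y = φ z := by
    intro y z h
    simp only [φ, h]
  let v : EuclideanSpace ℝ (Fin m) → ℝ := (closedBall x₀ ε).indicator u
  have hv : LocallyIntegrable v := by
    have h1 : IntegrableOn u (closedBall x₀ ε) :=
      (hcont.mono hεD).integrableOn_compact (isCompact_closedBall _ _)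
    exact (h1.integrable_indicator measurableSet_closedBall).locallyIntegrable
  have hconv : ContDiff ℝ 2 (convolution φ v (ContinuousLinearMap.lsmul ℝ ℝ) volume) :=
    hφc.contDiff_convolution_left (n := 2) _ hφs hv
  set C := ∫ y in ball 0 R, φ y with hC
  have hCpos : 0 < C := by
    have hp : ∀ y ∈ ball (0 : EuclideanSpace ℝ (Fin m)) R, 0 < φ y := by
      intro y hy
      have : ‖y‖ < R := by simpa using hy
      apply expNegInvGlue.pos_of_pos
      nlinarith [norm_nonneg y]
    rw [hC, setIntegral_pos_iff_support_of_nonneg_ae]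
    · have : Function.support φ ∩ ball (0 : EuclideanSpace ℝ (Fin m)) R = ball 0 R :=
        Set.inter_eq_right.mpr fun y hy => (hp y hy).ne'
      rw [this]
      exact measure_ball_pos _ _ hRpos
    · exact Filter.Eventually.of_forall fun y => expNegInvGlue.nonneg _
    · exact (hφs.continuous.integrable_of_hasCompactSupport hφc).integrableOn
  have hloc : ∀ x ∈ ball x₀ R, u x =
      C⁻¹ * (convolution φ v (ContinuousLinearMap.lsmul ℝ ℝ) volume) x := by
    intro x hx
    have hsub : ∀ y, ‖y‖ ≤ R → x + y ∈ closedBall x₀ ε := by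
      intro y hy
      have hx' : ‖x - x₀‖ < R := by simpa [dist_eq_norm] using hx
      rw [mem_closedBall, dist_eq_norm]
      calc ‖x + y - x₀‖ = ‖(x - x₀) + y‖ := by congr 1; abel
        _ ≤ ‖x - x₀‖ + ‖y‖ := norm_add_le _ _
        _ ≤ ε := by linarith
    have h1 := hmv x R hRpos (fun y hy => hεD (by
      have := hsub (y - x) (by simpa [dist_eq_norm] using hy)
      simpa using this)) φ hφs.continuous hφr
    have h2 : (convolution φ v (ContinuousLinearMap.lsmul ℝ ℝ) volume) x
        = ∫ y in ball 0 R, φ y * u (x + y) := by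
      rw [convolution_def, ← integral_neg_eq_self]
      have h3 : ∀ y, (ContinuousLinearMap.lsmul ℝ ℝ) (φ (-y)) (v (x - -y))
          = (ball 0 R).indicator (fun y => φ y * u (x + y)) y := by
        intro y
        rw [ContinuousLinearMap.lsmul_apply, smul_eq_mul, hφr (-y) y (norm_neg y), sub_neg_eq_add]
        by_cases hy : y ∈ ball (0 : EuclideanSpace ℝ (Fin m)) R
        · rw [Set.indicator_of_mem hy]
          have : ‖y‖ < R := by simpa using hy
          simp only [v]
          rw [Set.indicator_of_mem (hsub y this.le)]
        · rw [Set.indicator_of_notMem hy, hφ0 y hy, zero_mul]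
      simp only [h3]
      rw [integral_indicator measurableSet_ball]
    rw [h2, h1, ← hC, mul_comm (u x), inv_mul_cancel_left₀ hCpos.ne']
  have hcd : ContDiffAt ℝ 2 (fun x => C⁻¹ *
      (convolution φ v (ContinuousLinearMap.lsmul ℝ ℝ) volume) x) x₀ :=
    (contDiff_const.mul hconv).contDiffAt
  have hev : u =ᶠ[nhds x₀] (fun x => C⁻¹ *
      (convolution φ v (ContinuousLinearMap.lsmul ℝ ℝ) volume) x) := by
    filter_upwards [ball_mem_nhds x₀ hRpos] with x hx using hloc x hx
  exact hcd.congr_of_eventuallyEq hev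

lemma setIntegral_ball_comp {m : ℕ}
    (e : EuclideanSpace ℝ (Fin m) ≃ₗᵢ[ℝ] EuclideanSpace ℝ (Fin m)) (r : ℝ)
    (f : EuclideanSpace ℝ (Fin m) → ℝ) :
    ∫ y in ball 0 r, f (e y) = ∫ y in ball 0 r, f y := by
  have hpre : e ⁻¹' (ball 0 r) = ball 0 r := by ext y; simp
  exact (restrict_preserving e e.measurePreserving measurableSet_ball hpre).integral_comp
    e.toHomeomorph.measurableEmbedding f

lemma moment_offdiag {m : ℕ} (r : ℝ) (i j : Fin m) (hij : i ≠ j) :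
    ∫ y in ball (0 : EuclideanSpace ℝ (Fin m)) r, y i * y j = 0 := by
  let e : EuclideanSpace ℝ (Fin m) ≃ₗᵢ[ℝ] EuclideanSpace ℝ (Fin m) :=
    LinearIsometryEquiv.piLpCongrRight 2 fun k =>
      if k = i then LinearIsometryEquiv.neg ℝ else LinearIsometryEquiv.refl ℝ ℝ
  have h := setIntegral_ball_comp e r (fun y => y i * y j)
  have h1 : ∀ y : EuclideanSpace ℝ (Fin m), e y i * e y j = -(y i * y j) := by
    intro y
    have hi : e y i = - y i := by simp [e]
    have hj : e y j = y j := by simp [e, hij.symm]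
    rw [hi, hj]; ring
  simp only [h1, integral_neg] at h
  linarith

lemma moment_diag {m : ℕ} (r : ℝ) (i j : Fin m) :
    ∫ y in ball (0 : EuclideanSpace ℝ (Fin m)) r, y i * y i =
      ∫ y in ball (0 : EuclideanSpace ℝ (Fin m)) r, y j * y j := by
  let e : EuclideanSpace ℝ (Fin m) ≃ₗᵢ[ℝ] EuclideanSpace ℝ (Fin m) :=
    LinearIsometryEquiv.piLpCongrLeft 2 ℝ ℝ (Equiv.swap i j)
  have h := setIntegral_ball_comp e r (fun y => y i * y i)
  have h1 : ∀ y : EuclideanSpace ℝ (Fin m), e y i = y j := by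
    intro y
    simp [e, LinearIsometryEquiv.piLpCongrLeft_apply, Equiv.piCongrLeft']
  simp only [h1] at h
  exact h.symm

lemma integral_linear {m : ℕ} (r : ℝ) (L : EuclideanSpace ℝ (Fin m) →L[ℝ] ℝ) :
    ∫ y in ball (0 : EuclideanSpace ℝ (Fin m)) r, L y = 0 := by
  have h := setIntegral_ball_comp (LinearIsometryEquiv.neg ℝ) r L
  simp only [LinearIsometryEquiv.coe_neg, map_neg, integral_neg] at h
  linarith

lemma integrableOn_ball_of_continuous {m : ℕ} (r : ℝ) (f : EuclideanSpace ℝ (Fin m) → ℝ)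
    (hf : Continuous f) : IntegrableOn f (ball 0 r) :=
  (hf.continuousOn.integrableOn_compact
    (isCompact_closedBall 0 r)).mono_set ball_subset_closedBall

lemma integral_quadratic {m : ℕ} (r : ℝ) (k : Fin m)
    (Q : EuclideanSpace ℝ (Fin m) →L[ℝ] EuclideanSpace ℝ (Fin m) →L[ℝ] ℝ) :
    ∫ y in ball (0 : EuclideanSpace ℝ (Fin m)) r, Q y y =
      (∑ i, Q (EuclideanSpace.single i 1) (EuclideanSpace.single i 1)) *
      ∫ y in ball (0 : EuclideanSpace ℝ (Fin m)) r, y k * y k := by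
  have hexp : ∀ y : EuclideanSpace ℝ (Fin m), Q y y = ∑ i, ∑ j, (y i * y j) *
      Q (EuclideanSpace.single i 1) (EuclideanSpace.single j 1) := by
    intro y
    have hy : y = ∑ i, y i • EuclideanSpace.single i (1 : ℝ) := by
      have := (EuclideanSpace.basisFun (Fin m) ℝ).sum_repr y
      simpa using this.symm
    conv_lhs => rw [hy]
    simp only [map_sum, sum_apply, map_smul, smul_apply,
      smul_eq_mul, Finset.mul_sum]
    rw [Finset.sum_comm]
    refine Finset.sum_congr rfl fun i _ => Finset.sum_congr rfl fun j _ => ?_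
    ring
  have hint : ∀ i j : Fin m, Integrable (fun y : EuclideanSpace ℝ (Fin m) => (y i * y j) *
      Q (EuclideanSpace.single i 1) (EuclideanSpace.single j 1)) (volume.restrict (ball 0 r)) :=
    fun i j => integrableOn_ball_of_continuous r _ (by fun_prop)
  rw [integral_congr_ae (Filter.Eventually.of_forall hexp), integral_finsetSum _ fun i _ => integrable_finsetSum _ fun j _ => hint i j, Finset.sum_mul]
  refine Finset.sum_congr rfl fun i _ => ?_
  rw [integral_finsetSum _ fun j _ => hint i j, Finset.sum_eq_single i]
  · rw [integral_mul_const, moment_diag r i k, mul_comm]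
  · intro j _ hj
    rw [integral_mul_const, moment_offdiag r i j hj.symm, zero_mul]
  · simp

lemma taylor_two {m : ℕ} (u : EuclideanSpace ℝ (Fin m) → ℝ) (x : EuclideanSpace ℝ (Fin m))
    (hu : ContDiffAt ℝ 2 u x) (ε : ℝ) (hε : 0 < ε) :
    ∃ δ > 0, ∀ y, ‖y‖ < δ →
      |u (x + y) - u x - fderiv ℝ u x y - 1 / 2 * fderiv ℝ (fderiv ℝ u) x y y|
        ≤ ε * ‖y‖ ^ 2 := by
  set L := fderiv ℝ u x with hL
  set Q := fderiv ℝ (fderiv ℝ u) x with hQ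
  have hsymm : ∀ a b, Q a b = Q b a := fun a b =>
    (hu.isSymmSndFDerivAt (by simp)) a b
  have hd1 : ∀ᶠ z in nhds x, DifferentiableAt ℝ u z :=
    (hu.eventually (by simp)).mono fun z hz => hz.differentiableAt (by simp)
  have hd2 : HasFDerivAt (fderiv ℝ u) Q x :=
    ((hu.fderiv_right (m := 1) (by norm_num)).differentiableAt (by simp)).hasFDerivAt
  have hlit := hd2.isLittleO.def hε
  obtain ⟨δ, hδ, hδ'⟩ := Metric.eventually_nhds_iff.mp (hd1.and hlit)
  refine ⟨δ, hδ, fun y hy => ?_⟩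
  let F : EuclideanSpace ℝ (Fin m) → ℝ := fun y => u (x + y) - u x - L y - 1 / 2 * Q y y
  have hF : ∀ z ∈ closedBall (0 : EuclideanSpace ℝ (Fin m)) ‖y‖,
      HasFDerivWithinAt F (fderiv ℝ u (x + z) - L - Q z) (closedBall 0 ‖y‖) z := by
    intro z hz
    have hz' : ‖z‖ < δ := lt_of_le_of_lt (by simpa using hz) hy
    have h1 := (hδ' (y := x + z) (by simpa [dist_eq_norm] using hz')).1.hasFDerivAt
    have h2 : HasFDerivAt (fun z => u (x + z)) (fderiv ℝ u (x + z)) z :=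
      (hasFDerivAt_comp_add_left x).mpr h1
    have h3 : HasFDerivAt (fun z => Q z z) _ z := Q.hasFDerivAt.clm_apply (hasFDerivAt_id z)
    have h4 := ((h2.sub_const (u x)).sub L.hasFDerivAt).sub (h3.const_mul (1 / 2))
    refine (h4.congr_fderiv ?_).hasFDerivWithinAt
    ext w
    simp [hsymm w z]
    ring
  have hb : ∀ z ∈ closedBall (0 : EuclideanSpace ℝ (Fin m)) ‖y‖,
      ‖fderiv ℝ u (x + z) - L - Q z‖ ≤ ε * ‖y‖ := by
    intro z hz
    have hzy : ‖z‖ ≤ ‖y‖ := by simpa using hz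
    have h1 := (hδ' (y := x + z) (by simpa [dist_eq_norm] using lt_of_le_of_lt hzy hy)).2
    simp only [add_sub_cancel_left] at h1
    exact h1.trans (by gcongr)
  have := (convex_closedBall (0 : EuclideanSpace ℝ (Fin m)) ‖y‖).norm_image_sub_le_of_norm_hasFDerivWithin_le
    hF hb (x := 0) (y := y) (by simp) (by simp)
  simp only [F, sub_zero, add_zero, map_zero, sub_self, mul_zero, Real.norm_eq_abs] at this
  calc _ ≤ _ := this
    _ = _ := by ring

lemma lap_eq_zero {m : ℕ} (hm : 2 ≤ m) (u : EuclideanSpace ℝ (Fin m) → ℝ)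
    (x : EuclideanSpace ℝ (Fin m)) (hu : ContDiffAt ℝ 2 u x) (R : ℝ) (hR : 0 < R)
    (hcont : ContinuousOn u (closedBall x R))
    (hmv : ∀ r, 0 < r → r ≤ R →
      ∫ y in ball 0 r, u (x + y) = u x * ∫ _y in ball (0 : EuclideanSpace ℝ (Fin m)) r, (1 : ℝ)) :
    lap u x = 0 := by
  set L := fderiv ℝ u x with hL
  set Q := fderiv ℝ (fderiv ℝ u) x with hQ
  have hlap : lap u x = ∑ i, Q (EuclideanSpace.single i 1) (EuclideanSpace.single i 1) := by
    refine Finset.sum_congr rfl fun i _ => ?_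
    have hd2 : HasFDerivAt (fderiv ℝ u) Q x :=
      ((hu.fderiv_right (m := 1) (by norm_num)).differentiableAt (by simp)).hasFDerivAt
    have h1 := hd2.clm_apply
      (hasFDerivAt_const (EuclideanSpace.single i (1 : ℝ) : EuclideanSpace ℝ (Fin m)) x)
    rw [h1.fderiv]
    simp
  let k : Fin m := ⟨0, by omega⟩
  have hbound : ∀ ε > 0, |lap u x| ≤ 2 * m * ε := by
    intro ε hε
    obtain ⟨δ, hδ, hT⟩ := taylor_two u x hu ε hε
    set r := min δ R with hr
    have hrpos : 0 < r := lt_min hδ hR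
    set κ := ∫ y in ball (0 : EuclideanSpace ℝ (Fin m)) r, y k * y k with hκ
    have hκpos : 0 < κ := by
      rw [hκ, setIntegral_pos_iff_support_of_nonneg_ae]
      · have hopen : IsOpen (Function.support (fun y : EuclideanSpace ℝ (Fin m) => y k * y k) ∩
            ball 0 r) := by
          refine IsOpen.inter ?_ isOpen_ball
          exact (show Continuous (fun y : EuclideanSpace ℝ (Fin m) => y k * y k) by
            fun_prop).isOpen_support
        refine hopen.measure_pos _ ⟨EuclideanSpace.single k (r / 2), ?_, ?_⟩
        · simp [hrpos.ne']
        · simp [abs_of_pos hrpos, hrpos]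
      · exact Filter.Eventually.of_forall fun y => mul_self_nonneg _
      · exact integrableOn_ball_of_continuous r _ (by fun_prop)
    have hnorm : ∫ y in ball (0 : EuclideanSpace ℝ (Fin m)) r, ‖y‖ ^ 2 = m * κ := by
      have h1 : ∀ y : EuclideanSpace ℝ (Fin m), ‖y‖ ^ 2 = ∑ i, y i * y i := by
        intro y
        rw [EuclideanSpace.norm_sq_eq]
        refine Finset.sum_congr rfl fun i _ => ?_
        rw [Real.norm_eq_abs, sq_abs, sq]
      simp only [h1]
      rw [integral_finsetSum _ fun i _ => integrableOn_ball_of_continuous r _ (by fun_prop)]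
      simp only [fun i => moment_diag r i k]
      simp [hκ]
    have hui : IntegrableOn (fun y => u (x + y)) (ball 0 r) := by
      have : ContinuousOn (fun y => u (x + y)) (closedBall 0 r) := by
        refine hcont.comp (by fun_prop) fun y hy => ?_
        have h1 : ‖y‖ ≤ r := by simpa using hy
        simpa [dist_eq_norm] using h1.trans (min_le_right _ _)
      exact (this.integrableOn_compact (isCompact_closedBall 0 r)).mono_set ball_subset_closedBall
    have hci : IntegrableOn (fun _ : EuclideanSpace ℝ (Fin m) => u x) (ball 0 r) :=
      integrableOn_ball_of_continuous r _ continuous_const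
    have hLi : IntegrableOn (fun y => L y) (ball 0 r) :=
      integrableOn_ball_of_continuous r _ (by fun_prop)
    have hQi : IntegrableOn (fun y => 1 / 2 * Q y y) (ball 0 r) :=
      integrableOn_ball_of_continuous r _ (by fun_prop)
    have hI : ∫ y in ball 0 r, (u (x + y) - u x - L y - 1 / 2 * Q y y)
        = - (1 / 2 * (lap u x * κ)) := by
      have h12 : IntegrableOn (fun y => u (x + y) - u x) (ball 0 r) := hui.sub hci
      have h123 : IntegrableOn (fun y => u (x + y) - u x - L y) (ball 0 r) := h12.sub hLi
      rw [integral_sub h123 hQi, integral_sub h12 hLi, integral_sub hui hci,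
        integral_linear, integral_const_mul, integral_quadratic r k Q,
        ← hlap, hmv r hrpos (min_le_right _ _), ← integral_const_mul]
      simp [hκ]
    have hle : |∫ y in ball 0 r, (u (x + y) - u x - L y - 1 / 2 * Q y y)| ≤
        ∫ y in ball (0 : EuclideanSpace ℝ (Fin m)) r, ε * ‖y‖ ^ 2 := by
      rw [← Real.norm_eq_abs]
      refine norm_integral_le_of_norm_le (integrableOn_ball_of_continuous r _ (by fun_prop)) ?_
      refine (ae_restrict_iff' measurableSet_ball).mpr (Filter.Eventually.of_forall fun y hy => ?_)
      have h1 : ‖y‖ < r := by simpa using hy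
      exact hT y (h1.trans_le (min_le_left _ _))
    rw [hI, integral_const_mul, hnorm, abs_neg, abs_mul, abs_mul, abs_of_pos hκpos,
      abs_of_pos (by norm_num : (0 : ℝ) < 1 / 2)] at hle
    refine le_of_mul_le_mul_right ?_ hκpos
    linarith
  have hmpos : (0 : ℝ) < m := by exact_mod_cast (by omega : 0 < m)
  by_contra hne
  have hpos := abs_pos.mpr hne
  have := hbound (|lap u x| / (4 * m)) (by positivity)
  have h2 : 2 * (m : ℝ) * (|lap u x| / (4 * m)) = |lap u x| / 2 := by field_simp; ring
  linarith

/-- If all small ball averages vanish, the function vanishes. -/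
lemma eq_zero_of_ballAvg {m : ℕ} (D : Set (EuclideanSpace ℝ (Fin m))) (hD : IsOpen D)
    (u : EuclideanSpace ℝ (Fin m) → ℝ) (hcont : ContinuousOn u D)
    (h : ∀ x ∈ D, ∀ r : ℝ, 0 < r → ball x r ⊆ D → ballAvg u x r = 0) :
    ∀ x ∈ D, u x = 0 := by
  have key : ∀ v : EuclideanSpace ℝ (Fin m) → ℝ, ContinuousOn v D →
      (∀ x ∈ D, ∀ r : ℝ, 0 < r → ball x r ⊆ D → ∫ y in ball x r, v y = 0) →
      ∀ x ∈ D, ¬ 0 < v x := by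
    intro v hv hz x hx hpos
    obtain ⟨ε, hε, hεD⟩ := Metric.nhds_basis_closedBall.mem_iff.mp
      (Filter.inter_mem (hD.mem_nhds hx)
        ((hv.continuousAt (hD.mem_nhds hx)).eventually (lt_mem_nhds hpos)))
    have hp : ∀ y ∈ ball x ε, 0 < v y := fun y hy => (hεD (ball_subset_closedBall hy)).2
    have h1 := hz x hx ε hε fun y hy => (hεD (ball_subset_closedBall hy)).1
    have h2 : 0 < ∫ y in ball x ε, v y := by
      rw [setIntegral_pos_iff_support_of_nonneg_ae]
      · have : Function.support v ∩ ball x ε = ball x ε :=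
          Set.inter_eq_right.mpr fun y hy => (hp y hy).ne'
        rw [this]
        exact measure_ball_pos _ _ hε
      · exact (ae_restrict_iff' measurableSet_ball).mpr
          (Filter.Eventually.of_forall fun y hy => (hp y hy).le)
      · exact ((hv.mono fun y hy => (hεD hy).1).integrableOn_compact
          (isCompact_closedBall x ε)).mono_set ball_subset_closedBall
    linarith
  have hu0 : ∀ x ∈ D, ∀ r : ℝ, 0 < r → ball x r ⊆ D → ∫ y in ball x r, u y = 0 := by
    intro x hx r hr hb
    have := h x hx r hr hb
    rw [ballAvg, mul_eq_zero, inv_eq_zero] at this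
    exact this.resolve_left
      (ENNReal.toReal_pos (measure_ball_pos _ _ hr).ne' measure_ball_lt_top.ne).ne'
  intro x hx
  have h1 := key u hcont hu0 x hx
  have h2 := key (fun y => - u y) hcont.neg (fun x hx r hr hb => by
    rw [integral_neg, hu0 x hx r hr hb, neg_zero]) x hx
  simp only [Left.neg_pos_iff] at h2
  linarith

theorem beckenbach_reade {m : ℕ} (hm : 2 ≤ m)
    (D : Set (EuclideanSpace ℝ (Fin m))) (hD : IsOpen D) (hDc : IsConnected D)
    (hDb : Bornology.IsBounded D) (u : EuclideanSpace ℝ (Fin m) → ℝ)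
    (hcont : ContinuousOn u D)
    (heq : ∀ x ∈ D, ∀ r : ℝ, 0 < r → ball x r ⊆ D → sphAvg u x r = ballAvg u x r) :
    IsHarmonicOn u D := by 
  by_cases hdeg : (μH[(m : ℝ) - 1] (sphere (0 : EuclideanSpace ℝ (Fin m)) 1)).toReal = 0
  · have hz : ∀ x ∈ D, u x = 0 := by
      refine eq_zero_of_ballAvg D hD u hcont fun x hx r hr hb => ?_
      rw [← heq x hx r hr hb, sphAvg, sphere_measure hm x r hr, ENNReal.toReal_mul, hdeg]
      simp
    refine ⟨(contDiffOn_const (c := (0 : ℝ))).congr hz, fun x hx => ?_⟩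
    have hev : ∀ y ∈ D, fderiv ℝ u y = 0 := by
      intro y hy
      have h1 : u =ᶠ[nhds y] fun _ => 0 := by
        filter_upwards [hD.mem_nhds hy] with z hzD using hz z hzD
      rw [h1.fderiv_eq]
      simp
    refine Finset.sum_eq_zero fun i _ => ?_
    have h2 : (fun y => fderiv ℝ u y (EuclideanSpace.single i 1)) =ᶠ[nhds x] fun _ => 0 := by
      filter_upwards [hD.mem_nhds hx] with z hzD
      rw [hev z hzD]
      rfl
    rw [h2.fderiv_eq]
    simp
  · have hc0 : μH[(m : ℝ) - 1] (sphere (0 : EuclideanSpace ℝ (Fin m)) 1) ≠ 0 := by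
      intro h
      exact hdeg (by rw [h]; rfl)
    have hc1 : μH[(m : ℝ) - 1] (sphere (0 : EuclideanSpace ℝ (Fin m)) 1) ≠ ⊤ := by
      intro h
      exact hdeg (by rw [h]; rfl)
    have hmv : ∀ (x : EuclideanSpace ℝ (Fin m)) (R : ℝ), 0 < R → closedBall x R ⊆ D →
        ∀ w : EuclideanSpace ℝ (Fin m) → ℝ, Continuous w → (∀ y z, ‖y‖ = ‖z‖ → w y = w z) →
        ∫ y in ball 0 R, w y * u (x + y) = u x * ∫ y in ball 0 R, w y := by
      intro x R hR hb w hw hwr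
      refine mean_value hm hc0 hc1 u x R hR (hcont.mono hb) (fun r hr hrR => ?_) w hw hwr
      exact heq x (hb (mem_closedBall_self hR.le)) r hr
        (((ball_subset_ball hrR).trans ball_subset_closedBall).trans hb)
    have hsm := contDiffAt_of_mean D hD u hcont hmv
    refine ⟨fun x hx => (hsm x hx).contDiffWithinAt, fun x hx => ?_⟩
    obtain ⟨ε, hε, hεD⟩ := Metric.nhds_basis_closedBall.mem_iff.mp (hD.mem_nhds hx)
    refine lap_eq_zero hm u x (hsm x hx) ε hε (hcont.mono hεD) fun r hr hrε => ?_
    have := hmv x r hr ((closedBall_subset_closedBall hrε).trans hεD) (fun _ => 1)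
      continuous_const (fun _ _ _ => rfl)
    simpa only [one_mul] using this
end
end

section
/- Derivative identity for means: for u continuous on a domain D, x ∈ D, and r small enough that averaging is defined, the volume mean A(u,x,r) is differentiable in r with ∂_r A(u,x,r) = (m/r)(L(u,x,r) − A(u,x,r)). -/
open MeasureTheory Metric Real

noncomputable section

lemma unif_aux {X : Type*} [MetricSpace X] [CompactSpace X] [MeasurableSpace X] [BorelSpace X]
    (σ τ : Measure X) [IsFiniteMeasure σ] [IsFiniteMeasure τ] (ε c : ℝ)
    (hσ : ∀ a, σ.real (ball a ε) = c) (f : X → ℝ) (hf : Continuous f) :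
    ∫ p in {p : X × X | dist p.1 p.2 < ε}, f p.1 ∂(τ.prod σ) = c * ∫ x, f x ∂τ := by
  have hK : MeasurableSet {p : X × X | dist p.1 p.2 < ε} :=
    (isOpen_lt (by fun_prop) (by fun_prop)).measurableSet
  rw [← integral_indicator hK, integral_prod]
  · rw [← integral_const_mul]
    congr 1
    ext x
    have : (fun y => Set.indicator {p : X × X | dist p.1 p.2 < ε} (fun p => f p.1) (x, y))
        = (ball x ε).indicator (fun _ => f x) := by
      ext y
      simp [Set.indicator, dist_comm]
    rw [this, integral_indicator measurableSet_ball, setIntegral_const, hσ, smul_eq_mul]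
  · apply Integrable.indicator _ hK
    exact (hf.comp continuous_fst).integrable_of_hasCompactSupport (HasCompactSupport.of_compactSpace _)

lemma unif {X : Type*} [MetricSpace X] [CompactSpace X] [MeasurableSpace X] [BorelSpace X]
    (σ τ : Measure X) [IsFiniteMeasure σ] [IsFiniteMeasure τ]
    (hσ : ∀ a b ε, σ (ball a ε) = σ (ball b ε))
    (hτ : ∀ a b ε, τ (ball a ε) = τ (ball b ε)) (f : X → ℝ) (hf : Continuous f) :
    σ.real Set.univ * ∫ x, f x ∂τ = τ.real Set.univ * ∫ x, f x ∂σ := by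
  rcases eq_or_ne τ 0 with h0 | h0
  · simp [h0]
  have hne : Nonempty X := by
    by_contra h
    rw [not_nonempty_iff] at h
    exact h0 (Measure.eq_zero_of_isEmpty τ)
  obtain ⟨a⟩ := hne
  set S := σ.real Set.univ
  set T := τ.real Set.univ
  have hS : 0 ≤ S := measureReal_nonneg
  have hT : 0 ≤ T := measureReal_nonneg
  have key : ∀ η > 0, |S * ∫ x, f x ∂τ - T * ∫ x, f x ∂σ| ≤ T * S * η := by
    intro η hη
    obtain ⟨ε, hε, hfε⟩ := Metric.uniformContinuous_iff.1
      (CompactSpace.uniformContinuous_of_continuous hf) η hη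
    set c := σ.real (ball a ε) with hc
    set d := τ.real (ball a ε) with hd
    have hc' : ∀ b, σ.real (ball b ε) = c := fun b => by simp [hc, measureReal_def, hσ b a]
    have hd' : ∀ b, τ.real (ball b ε) = d := fun b => by simp [hd, measureReal_def, hτ b a]
    have hdpos : 0 < d := by
      refine lt_of_le_of_ne measureReal_nonneg (fun h => h0 ?_)
      have hz : ∀ b, τ (ball b ε) = 0 := fun b => by
        have := (hd' b).trans h.symm
        rwa [measureReal_eq_zero_iff] at this
      rw [← Measure.measure_univ_eq_zero]
      refine measure_null_of_locally_null _ (fun b _ => ⟨ball b ε, ?_, hz b⟩)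
      rw [nhdsWithin_univ]
      exact ball_mem_nhds b hε
    set K := {p : X × X | dist p.1 p.2 < ε} with hKdef
    have hK : MeasurableSet K := (isOpen_lt (by fun_prop) (by fun_prop)).measurableSet
    have swap : ∀ g : X → ℝ, Continuous g →
        ∫ p in K, g p.2 ∂(τ.prod σ) = d * ∫ x, g x ∂σ := by
      intro g hg
      rw [← unif_aux τ σ ε d hd' g hg, ← integral_indicator hK, ← integral_indicator hK,
        ← integral_prod_swap]
      congr 1
      ext p
      simp [Set.indicator, hKdef, dist_comm]
    have A := unif_aux σ τ ε c hc' f hf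
    have B := swap f hf
    have A1 := unif_aux σ τ ε c hc' (fun _ => 1) continuous_const
    have B1 := swap (fun _ => 1) continuous_const
    have hcd : c * T = d * S := by
      rw [A1] at B1
      simpa [S, T] using B1
    have hm : (τ.prod σ).real K = d * S := by
      simpa [S] using B1
    have int1 : IntegrableOn (fun p : X × X => f p.1) K (τ.prod σ) :=
      ((hf.comp continuous_fst).integrable_of_hasCompactSupport
        (HasCompactSupport.of_compactSpace _)).integrableOn
    have int2 : IntegrableOn (fun p : X × X => f p.2) K (τ.prod σ) :=
      ((hf.comp continuous_snd).integrable_of_hasCompactSupport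
        (HasCompactSupport.of_compactSpace _)).integrableOn
    have est : |c * ∫ x, f x ∂τ - d * ∫ x, f x ∂σ| ≤ η * (d * S) := by
      rw [← hm, ← A, ← B, ← integral_sub int1 int2, ← Real.norm_eq_abs]
      refine norm_setIntegral_le_of_norm_le_const (measure_lt_top _ _) (fun p hp => ?_)
      have := hfε (show dist p.1 p.2 < ε from hp)
      rw [Real.dist_eq] at this
      exact this.le
    have e : (S * ∫ x, f x ∂τ - T * ∫ x, f x ∂σ) * d
        = T * (c * ∫ x, f x ∂τ - d * ∫ x, f x ∂σ) := by
      linear_combination (- ∫ x, f x ∂τ) * hcd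
    have : |S * ∫ x, f x ∂τ - T * ∫ x, f x ∂σ| * d ≤ (T * S * η) * d := by
      calc _ = |(S * ∫ x, f x ∂τ - T * ∫ x, f x ∂σ) * d| := by rw [abs_mul, abs_of_pos hdpos]
        _ = T * |c * ∫ x, f x ∂τ - d * ∫ x, f x ∂σ| := by rw [e, abs_mul, abs_of_nonneg hT]
        _ ≤ T * (η * (d * S)) := by gcongr
        _ = _ := by ring
    exact le_of_mul_le_mul_right this hdpos
  have : |S * ∫ x, f x ∂τ - T * ∫ x, f x ∂σ| ≤ 0 := by
    refine le_of_forall_pos_le_add (fun δ hδ => ?_)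
    refine (key (δ / (T * S + 1)) (by positivity)).trans ?_
    rw [zero_add, mul_div_assoc', div_le_iff₀ (by positivity)]
    nlinarith
  exact sub_eq_zero.1 (abs_nonpos_iff.1 this)

lemma finrank_perp {m : ℕ} (v : EuclideanSpace ℝ (Fin m)) (hv : ‖v‖ = 1) :
    ((Module.finrank ℝ (ℝ ∙ v)ᗮ : ℕ) : ℝ) = (m : ℝ) - 1 := by
  have h1 := Submodule.finrank_add_finrank_orthogonal (ℝ ∙ v)
  rw [finrank_span_singleton (by rintro rfl; simp at hv), finrank_euclideanSpace_fin] at h1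
  have : (1 : ℝ) + (Module.finrank ℝ (ℝ ∙ v)ᗮ : ℕ) = m := by exact_mod_cast h1
  linarith

lemma sphere_fin {m : ℕ} (hm : 2 ≤ m) :
    (μH[(m : ℝ) - 1] : Measure (sphere (0 : EuclideanSpace ℝ (Fin m)) 1)) Set.univ < ⊤ := by
  have hd : (0 : ℝ) ≤ (m : ℝ) - 1 := by
    have : (2 : ℝ) ≤ m := by exact_mod_cast hm
    linarith
  refine isCompact_univ.measure_lt_top_of_nhdsWithin (fun p _ => ?_)
  rw [nhdsWithin_univ]
  have hp : ‖((-p : sphere (0 : EuclideanSpace ℝ (Fin m)) 1) : EuclideanSpace ℝ (Fin m))‖ = 1 := by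
    simp
  set v : EuclideanSpace ℝ (Fin m) := ((-p : sphere (0 : EuclideanSpace ℝ (Fin m)) 1) : EuclideanSpace ℝ (Fin m)) with hv
  have hsm : ContDiffAt ℝ 1 (fun w : (ℝ ∙ v)ᗮ => stereoInvFunAux v (w : EuclideanSpace ℝ (Fin m))) 0 :=
    (contDiff_stereoInvFunAux.comp (ℝ ∙ v)ᗮ.subtypeL.contDiff).contDiffAt
  obtain ⟨K, t, ht, hL⟩ := hsm.exists_lipschitzOnWith
  obtain ⟨δ, hδ, hsub⟩ := Metric.mem_nhds_iff.1 ht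
  have hL' : LipschitzOnWith K (stereographic hp).symm (ball 0 δ) := fun a ha b hb =>
    hL (hsub ha) (hsub hb)
  have h0 : (stereographic hp).symm 0 = p := by
    have h1 := stereographic_neg_apply p
    have h2 : p ∈ (stereographic hp).source := by
      rw [stereographic_source]
      simp only [Set.mem_compl_iff, Set.mem_singleton_iff]
      intro h
      have h3 : (p : EuclideanSpace ℝ (Fin m)) = v := congrArg Subtype.val h
      have h4 : (p : EuclideanSpace ℝ (Fin m)) = - p := by simpa [hv] using h3
      have h5 : (p : EuclideanSpace ℝ (Fin m)) = 0 := by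
        have h7 : (2 : ℝ) • (p : EuclideanSpace ℝ (Fin m)) = 0 := by
          rw [two_smul]
          nth_rewrite 1 [h4]
          exact neg_add_cancel _
        simpa using h7
      have h6 : ‖(p : EuclideanSpace ℝ (Fin m))‖ = 1 := by simp
      rw [h5] at h6
      simp at h6
    rw [← (stereographic hp).left_inv h2]
    congr 1
    exact h1.symm
  refine ⟨(stereographic hp).symm '' ball 0 δ, ?_, ?_⟩
  · have := (stereographic hp).symm.image_mem_nhds (x := 0) (by simp) (ball_mem_nhds 0 hδ)
    rwa [h0] at this
  · refine (hL'.hausdorffMeasure_image_le hd).trans_lt ?_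
    refine ENNReal.mul_lt_top (ENNReal.rpow_lt_top_of_nonneg hd (by simp)) ?_
    rw [← finrank_perp v hp]
    exact measure_ball_lt_top

lemma sphere_pos_s12 {m : ℕ} (hm : 2 ≤ m) :
    μH[(m : ℝ) - 1] (sphere (0 : EuclideanSpace ℝ (Fin m)) 1) ≠ 0 := by
  have hd : (0 : ℝ) ≤ (m : ℝ) - 1 := by
    have : (2 : ℝ) ≤ m := by exact_mod_cast hm
    linarith
  set v : EuclideanSpace ℝ (Fin m) := EuclideanSpace.single ⟨0, by omega⟩ 1 with hv
  have hv1 : ‖v‖ = 1 := by simp [hv]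
  have hlip : LipschitzWith 1 ((ℝ ∙ v)ᗮ.orthogonalProjectionOnto) := by
    refine LipschitzWith.of_dist_le_mul (fun a b => ?_)
    rw [dist_eq_norm, ← map_sub, dist_eq_norm]
    simpa using (ℝ ∙ v)ᗮ.norm_orthogonalProjectionOnto_apply_le (a - b)
  have h1 := hlip.hausdorffMeasure_image_le hd (sphere (0 : EuclideanSpace ℝ (Fin m)) 1)
  have h2 : ball (0 : (ℝ ∙ v)ᗮ) 1 ⊆ (ℝ ∙ v)ᗮ.orthogonalProjectionOnto '' sphere 0 1 := by
    intro w hw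
    have hw1 : ‖(w : EuclideanSpace ℝ (Fin m))‖ < 1 := by simpa using hw
    have hw0 : 0 ≤ ‖(w : EuclideanSpace ℝ (Fin m))‖ := norm_nonneg _
    have hin : inner ℝ (w : EuclideanSpace ℝ (Fin m)) v = 0 :=
      (Submodule.mem_orthogonal_singleton_iff_inner_left).1 w.2
    refine ⟨w + √(1 - ‖(w : EuclideanSpace ℝ (Fin m))‖ ^ 2) • v, ?_, ?_⟩
    · have hsq : ‖(w : EuclideanSpace ℝ (Fin m)) + √(1 - ‖(w : EuclideanSpace ℝ (Fin m))‖ ^ 2) • v‖ ^ 2 = 1 := by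
        rw [norm_add_sq_real, inner_smul_right, hin, norm_smul, hv1, mul_one, Real.norm_eq_abs,
          sq_abs, Real.sq_sqrt (by nlinarith)]
        ring
      rw [mem_sphere_zero_iff_norm]
      exact (pow_eq_one_iff_of_nonneg (norm_nonneg _) two_ne_zero).1 hsq
    · rw [map_add, map_smul, Submodule.orthogonalProjectionOnto_orthogonalComplement_singleton_eq_zero, smul_zero, add_zero,
        Submodule.orthogonalProjectionOnto_mem_subspace_eq_self]
  intro h0
  rw [h0, mul_zero] at h1
  have h3 := measure_mono_null h2 (le_antisymm h1 zero_le)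
  rw [← finrank_perp v hv1] at h3
  exact (measure_ball_pos _ _ one_pos).ne' h3

open scoped Pointwise in
lemma toSphere_ball {m : ℕ} (a b : sphere (0 : EuclideanSpace ℝ (Fin m)) 1) (ε : ℝ) :
    (volume : Measure (EuclideanSpace ℝ (Fin m))).toSphere (ball a ε)
      = (volume : Measure (EuclideanSpace ℝ (Fin m))).toSphere (ball b ε) := by
  obtain ⟨T, hT⟩ : ∃ T : EuclideanSpace ℝ (Fin m) ≃ₗᵢ[ℝ] EuclideanSpace ℝ (Fin m), T a = b :=
    ⟨_, Submodule.reflection_sub (by simp)⟩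
  rw [Measure.toSphere_apply' _ measurableSet_ball, Measure.toSphere_apply' _ measurableSet_ball]
  congr 1
  have h : Set.Ioo (0 : ℝ) 1 • (Subtype.val '' ball b ε)
      = T '' (Set.Ioo (0 : ℝ) 1 • (Subtype.val '' ball a ε)) := by
    rw [Subtype.image_ball, Subtype.image_ball]
    ext y
    simp only [Set.mem_smul, Set.mem_image, Set.mem_inter_iff, mem_ball, Set.mem_ofPred_eq]
    constructor
    · rintro ⟨t, ht, z, ⟨hz1, hz2⟩, rfl⟩
      refine ⟨t • T.symm z, ⟨t, ht, T.symm z, ⟨?_, ?_⟩, rfl⟩, by simp⟩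
      · rw [← T.dist_map, hT]; simpa using hz1
      · simpa using hz2
    · rintro ⟨_, ⟨t, ht, z, ⟨hz1, hz2⟩, rfl⟩, rfl⟩
      refine ⟨t, ht, T z, ⟨?_, ?_⟩, by simp⟩
      · rw [← hT, T.dist_map]; exact hz1
      · simpa using hz2
  have h2 := T.measurePreserving.measure_preimage_emb
    T.toHomeomorph.measurableEmbedding (T '' (Set.Ioo (0 : ℝ) 1 • (Subtype.val '' ball a ε)))
  rw [Set.preimage_image_eq _ T.injective] at h2
  rw [h, h2]

lemma haus_ball {m : ℕ} (d : ℝ) (a b : sphere (0 : EuclideanSpace ℝ (Fin m)) 1) (ε : ℝ) :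
    μH[d] (Subtype.val '' (ball a ε))
      = μH[d] (Subtype.val '' (ball b ε)) := by
  obtain ⟨T, hT⟩ : ∃ T : EuclideanSpace ℝ (Fin m) ≃ₗᵢ[ℝ] EuclideanSpace ℝ (Fin m), T a = b :=
    ⟨_, Submodule.reflection_sub (by simp)⟩
  have h : (Subtype.val '' ball b ε) = T '' (Subtype.val '' ball a ε) := by
    rw [Subtype.image_ball, Subtype.image_ball]
    ext z
    simp only [Set.mem_image, Set.mem_inter_iff, mem_ball, Set.mem_ofPred_eq]
    constructor
    · rintro ⟨hz1, hz2⟩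
      refine ⟨T.symm z, ⟨?_, ?_⟩, by simp⟩
      · rw [← T.dist_map, hT]; simpa using hz1
      · simpa using hz2
    · rintro ⟨z, ⟨hz1, hz2⟩, rfl⟩
      refine ⟨?_, ?_⟩
      · rw [← hT, T.dist_map]; exact hz1
      · simpa using hz2
  rw [h, T.isometry.hausdorffMeasure_image (Or.inr T.surjective)]

open scoped Pointwise in
lemma sphAvg_eq {m : ℕ} (hm : 2 ≤ m) (U : EuclideanSpace ℝ (Fin m) → ℝ) (hU : Continuous U)
    (x : EuclideanSpace ℝ (Fin m)) (r : ℝ) (hr : 0 < r) :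
    sphAvg U x r = ((volume : Measure (EuclideanSpace ℝ (Fin m))).toSphere.real Set.univ)⁻¹ *
      ∫ ω, U (x + r • (ω : EuclideanSpace ℝ (Fin m)))
        ∂(volume : Measure (EuclideanSpace ℝ (Fin m))).toSphere := by
  have hd : (0 : ℝ) ≤ (m : ℝ) - 1 := by
    have : (2 : ℝ) ≤ m := by exact_mod_cast hm
    linarith
  set φ : sphere (0 : EuclideanSpace ℝ (Fin m)) 1 → EuclideanSpace ℝ (Fin m) :=
    fun ω => x + r • (ω : EuclideanSpace ℝ (Fin m)) with hφ
  have hφc : Continuous φ := by fun_prop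
  have hφi : Function.Injective φ := by
    intro a b h
    have h1 : r • (a : EuclideanSpace ℝ (Fin m)) = r • (b : EuclideanSpace ℝ (Fin m)) :=
      add_left_cancel h
    exact Subtype.ext (smul_right_injective _ hr.ne' h1)
  have hφe : MeasurableEmbedding φ := (hφc.isClosedEmbedding hφi).measurableEmbedding
  have hrange : Set.range φ = sphere x r := by
    ext y
    simp only [Set.mem_range, mem_sphere]
    constructor
    · rintro ⟨ω, rfl⟩
      simp [hφ, norm_smul, abs_of_pos hr]
    · intro hy
      refine ⟨⟨r⁻¹ • (y - x), ?_⟩, ?_⟩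
      · rw [mem_sphere_zero_iff_norm, norm_smul, ← dist_eq_norm, hy]
        simp [abs_of_pos hr, hr.ne']
      · simp [hφ, smul_smul, hr.ne']
  set τ : Measure (sphere (0 : EuclideanSpace ℝ (Fin m)) 1) :=
    Measure.comap φ μH[(m : ℝ) - 1] with hτ
  have hτa : ∀ A, τ A = ‖r‖₊ ^ ((m : ℝ) - 1) • μH[(m : ℝ) - 1] (Subtype.val '' A) := by
    intro A
    rw [hτ, hφe.comap_apply, ← Measure.hausdorffMeasure_smul₀ hd hr.ne',
      ← (isometry_add_left x).hausdorffMeasure_image (Or.inl hd)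
        (r • (Subtype.val '' A)), ← Set.image_smul,
      Set.image_image, Set.image_image]
  have hτu : τ Set.univ = μH[(m : ℝ) - 1] (sphere x r) := by
    rw [hτ, hφe.comap_apply, Set.image_univ, hrange]
  have hτu2 : τ Set.univ = ‖r‖₊ ^ ((m : ℝ) - 1) • μH[(m : ℝ) - 1]
      (sphere (0 : EuclideanSpace ℝ (Fin m)) 1) := by
    rw [hτa, Set.image_univ, Subtype.range_coe]
  have hfin : IsFiniteMeasure τ := by
    refine ⟨?_⟩
    rw [hτa, isometry_subtype_coe.hausdorffMeasure_image (Or.inl hd)]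
    exact ENNReal.mul_lt_top (by simp) (sphere_fin hm)
  have hpos : τ Set.univ ≠ 0 := by
    rw [hτu2, ENNReal.smul_def, smul_eq_mul]
    refine mul_ne_zero ?_ (sphere_pos_s12 hm)
    have : 0 < ‖r‖₊ := by simpa using hr.ne'
    exact ENNReal.coe_ne_zero.2 (NNReal.rpow_pos this).ne'
  have hint : ∫ y in sphere x r, U y ∂(μH[(m : ℝ) - 1]) = ∫ ω, U (φ ω) ∂τ := by
    rw [← hrange, ← hφe.map_comap, hφe.integral_map]
  have key := unif (volume : Measure (EuclideanSpace ℝ (Fin m))).toSphere τ toSphere_ball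
    (fun a b ε => by rw [hτa, hτa, haus_ball _ a b]) (fun ω => U (φ ω)) (hU.comp hφc)
  have hTne : τ.real Set.univ ≠ 0 := by
    rw [measureReal_def, ENNReal.toReal_ne_zero]
    exact ⟨hpos, measure_ne_top _ _⟩
  have hSne : (volume : Measure (EuclideanSpace ℝ (Fin m))).toSphere.real Set.univ ≠ 0 := by
    have : Nonempty (Fin m) := ⟨⟨0, by omega⟩⟩
    rw [measureReal_def, ENNReal.toReal_ne_zero]
    refine ⟨?_, measure_ne_top _ _⟩
    rw [Ne, Measure.measure_univ_eq_zero]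
    exact Measure.toSphere_ne_zero _
  rw [sphAvg, hint, ← hτu, ← measureReal_def]
  field_simp
  linear_combination key

lemma polar {m : ℕ} (hm : 2 ≤ m) (U : EuclideanSpace ℝ (Fin m) → ℝ) (hU : Continuous U)
    (x : EuclideanSpace ℝ (Fin m)) (s : ℝ) (hs : 0 < s) :
    ∫ y in ball x s, U y = ∫ t in (0 : ℝ)..s, t ^ (m - 1) *
      ∫ ω, U (x + t • (ω : EuclideanSpace ℝ (Fin m)))
        ∂(volume : Measure (EuclideanSpace ℝ (Fin m))).toSphere := by
  have : Nonempty (Fin m) := ⟨⟨0, by omega⟩⟩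
  set σ := (volume : Measure (EuclideanSpace ℝ (Fin m))).toSphere
  set f : EuclideanSpace ℝ (Fin m) → ℝ := (ball 0 s).indicator (fun y => U (x + y)) with hf
  have h1 : ∫ y in ball x s, U y = ∫ y, f y := by
    rw [hf, ← integral_indicator measurableSet_ball,
      ← integral_add_left_eq_self _ x]
    congr 1
    ext y
    simp [Set.indicator]
  have hfi : Integrable f := by
    rw [hf, integrable_indicator_iff measurableSet_ball]
    exact ((by fun_prop : Continuous (fun y => U (x + y))).continuousOn.integrableOn_compact
      (isCompact_closedBall 0 s)).mono_set ball_subset_closedBall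
  have mp := (volume : Measure (EuclideanSpace ℝ (Fin m))).measurePreserving_homeomorphUnitSphereProd
  have hemb := (homeomorphUnitSphereProd (EuclideanSpace ℝ (Fin m))).measurableEmbedding
  set F : sphere (0 : EuclideanSpace ℝ (Fin m)) 1 × Set.Ioi (0 : ℝ) → ℝ :=
    fun p => f ((p.2 : ℝ) • (p.1 : EuclideanSpace ℝ (Fin m))) with hF
  have hFc : ∀ y, F (homeomorphUnitSphereProd (EuclideanSpace ℝ (Fin m)) y) = f y := by
    intro y
    rw [hF]
    simp only
    rw [← homeomorphUnitSphereProd_symm_apply_coe, Homeomorph.symm_apply_apply]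
  have h2 : ∫ y, f y = ∫ p, F p ∂(σ.prod (Measure.volumeIoiPow (m - 1))) := by
    have := mp.integral_comp hemb F
    rw [finrank_euclideanSpace_fin] at this
    rw [← this]
    simp_rw [hFc]
    rw [integral_subtype_comap (measurableSet_singleton _).compl, restrict_compl_singleton]
  have hFi : Integrable F (σ.prod (Measure.volumeIoiPow (m - 1))) := by
    have := mp.integrable_comp_emb hemb (g := F)
    rw [finrank_euclideanSpace_fin] at this
    rw [← this]
    have e : F ∘ (homeomorphUnitSphereProd (EuclideanSpace ℝ (Fin m))) = f ∘ Subtype.val :=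
      funext hFc
    rw [e, ← integrableOn_iff_comap_subtypeVal (measurableSet_singleton _).compl]
    exact hfi.integrableOn
  rw [h1, h2, integral_prod_symm _ hFi]
  set g : ℝ → ℝ := fun t => ∫ ω, f (t • (ω : EuclideanSpace ℝ (Fin m))) ∂σ with hg
  have h3 : ∫ y, ∫ w, F (w, y) ∂σ ∂(Measure.volumeIoiPow (m - 1))
      = ∫ t in Set.Ioi (0 : ℝ), t ^ (m - 1) * g t := by
    change ∫ y : Set.Ioi (0 : ℝ), g y ∂(Measure.volumeIoiPow (m - 1)) = _
    simp only [Measure.volumeIoiPow, ENNReal.ofReal]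
    rw [integral_withDensity_eq_integral_smul,
        integral_subtype_comap measurableSet_Ioi fun a ↦ Real.toNNReal (a ^ (m - 1)) • g a,
        setIntegral_congr_fun measurableSet_Ioi fun x hx ↦ ?_]
    · rw [NNReal.smul_def, Real.coe_toNNReal _ (pow_nonneg hx.out.le _), smul_eq_mul]
    · exact (measurable_subtype_coe.pow_const _).real_toNNReal
  rw [h3, intervalIntegral.integral_of_le hs.le, integral_Ioc_eq_integral_Ioo,
    ← integral_indicator measurableSet_Ioi, ← integral_indicator measurableSet_Ioo]
  congr 1
  ext t
  by_cases ht : 0 < t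
  · have hfe : ∀ ω : sphere (0 : EuclideanSpace ℝ (Fin m)) 1,
        f (t • (ω : EuclideanSpace ℝ (Fin m)))
          = if t < s then U (x + t • (ω : EuclideanSpace ℝ (Fin m))) else 0 := by
      intro ω
      simp [hf, Set.indicator, norm_smul, abs_of_pos ht]
    by_cases hts : t < s
    · simp [Set.indicator, ht, hts, hg, hfe]
    · simp [Set.indicator, ht, hts, hg, hfe]
  · simp [Set.indicator, ht]

theorem deriv_ball_average {m : ℕ} (hm : 2 ≤ m)
    (D : Set (EuclideanSpace ℝ (Fin m))) (hD : IsOpen D) (hDc : IsConnected D)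
    (u : EuclideanSpace ℝ (Fin m) → ℝ) (hcont : ContinuousOn u D)
    (x : EuclideanSpace ℝ (Fin m)) (ρ : ℝ) (hρ : 0 < ρ) (hB : closedBall x ρ ⊆ D) :
    ∀ r ∈ Set.Ioo (0 : ℝ) ρ,
      HasDerivAt (fun s => ballAvg u x s) ((m / r) * (sphAvg u x r - ballAvg u x r)) r := by
  intro r hr
  have : Nonempty (Fin m) := ⟨⟨0, by omega⟩⟩
  have hr0 : 0 < r := hr.1
  -- replace `u` by a globally continuous function
  obtain ⟨U, hUu⟩ := ContinuousMap.exists_restrict_eq (isClosed_closedBall (x := x) (ε := ρ))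
    ⟨(closedBall x ρ).domRestrict u, (hcont.mono hB).domRestrict⟩
  have hEq : ∀ y ∈ closedBall x ρ, u y = U y := by
    intro y hy
    exact (DFunLike.congr_fun hUu ⟨y, hy⟩).symm
  have hball : ∀ s ≤ ρ, ballAvg u x s = ballAvg U x s := by
    intro s hs
    rw [ballAvg, ballAvg, setIntegral_congr_fun measurableSet_ball]
    exact fun y hy => hEq y (closedBall_subset_closedBall hs (ball_subset_closedBall hy))
  have hsph : sphAvg u x r = sphAvg U x r := by
    rw [sphAvg, sphAvg, setIntegral_congr_fun isClosed_sphere.measurableSet]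
    exact fun y hy => hEq y (closedBall_subset_closedBall hr.2.le (sphere_subset_closedBall hy))
  have hUc : Continuous U := U.continuous
  rw [hsph, hball r hr.2.le, sphAvg_eq hm U hUc x r hr0]
  set σ := (volume : Measure (EuclideanSpace ℝ (Fin m))).toSphere with hσ
  set g : ℝ → ℝ := fun t => ∫ ω, U (x + t • (ω : EuclideanSpace ℝ (Fin m))) ∂σ with hg
  have hgc : Continuous g := by
    have := continuous_parametric_integral_of_continuous (μ := σ)
      (f := fun (t : ℝ) (ω : sphere (0 : EuclideanSpace ℝ (Fin m)) 1) =>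
        U (x + t • (ω : EuclideanSpace ℝ (Fin m)))) (by fun_prop) isCompact_univ
    simpa using this
  set V : ℝ := volume.real (ball (0 : EuclideanSpace ℝ (Fin m)) 1) with hV
  have hVpos : 0 < V := by
    rw [hV, measureReal_def]
    exact ENNReal.toReal_pos (measure_ball_pos _ _ one_pos).ne' measure_ball_lt_top.ne
  have hσV : σ.real Set.univ = m * V := by
    rw [hσ, Measure.toSphere_real_apply_univ, finrank_euclideanSpace_fin]
  have hform : ∀ s, 0 < s → ballAvg U x s = (s ^ m * V)⁻¹ * ∫ t in (0 : ℝ)..s, t ^ (m - 1) * g t := by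
    intro s hs
    rw [ballAvg, polar hm U hUc x s hs, Measure.addHaar_ball_of_pos _ _ hs, ENNReal.toReal_mul,
      finrank_euclideanSpace_fin, ENNReal.toReal_ofReal (by positivity), ← measureReal_def]
  have hcont2 : Continuous (fun t => t ^ (m - 1) * g t) := by fun_prop
  have hd1 : HasDerivAt (fun s => ∫ t in (0 : ℝ)..s, t ^ (m - 1) * g t) (r ^ (m - 1) * g r) r :=
    intervalIntegral.integral_hasDerivAt_right (hcont2.intervalIntegrable _ _)
      (hcont2.stronglyMeasurableAtFilter _ _) hcont2.continuousAt
  have hd2 : HasDerivAt (fun s : ℝ => (s ^ m * V)⁻¹)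
      (-(m * r ^ (m - 1) * V) / (r ^ m * V) ^ 2) r :=
    ((hasDerivAt_pow m r).mul_const V).fun_inv (by positivity)
  have hd3 := hd2.mul hd1
  have hev : (fun s => ballAvg u x s) =ᶠ[nhds r]
      (fun s => (s ^ m * V)⁻¹) * (fun s => ∫ t in (0 : ℝ)..s, t ^ (m - 1) * g t) := by
    filter_upwards [Ioo_mem_nhds hr.1 hr.2] with s hs
    rw [hball s hs.2.le, hform s hs.1]
    rfl
  refine (hd3.congr_of_eventuallyEq hev).congr_deriv ?_
  rw [hform r hr0, hσV]
  obtain ⟨k, rfl⟩ : ∃ k, m = k + 1 := ⟨m - 1, by omega⟩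
  have hk : ((k + 1 : ℕ) : ℝ) ≠ 0 := by positivity
  simp only [Nat.add_sub_cancel]
  change _ = ((k + 1 : ℕ) : ℝ) / r * ((((k + 1 : ℕ) : ℝ) * V)⁻¹ * g r - _)
  field_simp
  ring
end
end
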